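/- Fix λ ∈ ℝ. For n ≥ 1 set p_n := (1 + λ·n^{−1/3})/n, q_n := 1 − p_n, N := n(n−1)/2, and B_n := Σ_G p_n^{e(G)}·q_n^{N−e(G)}, where the sum is over all simple graphs G on the vertex set {1,…,n} that contain no odd cycle (equivalently, are 2-colorable). Then n^{1/12}·B_n → 2^{−1/4}·e^{1/8}·c(λ) as n → ∞. (B_n is the probability that the Bernoulli random graph G(n,p_n) is bipartite.) -/

import Mathlib

open Filter
open scoped Classical

/-- Number of edges of a simple graph. -/
noncomputable def edgeCount {V : Type*} (G : SimpleGraph V) : ℕ := G.edgeSet.ncard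

/-- `G` has no odd cycle (equivalently, `G` is bipartite / 2-colorable). -/
def HasNoOddCycle {V : Type*} (G : SimpleGraph V) : Prop :=
  ∀ (v : V) (w : G.Walk v v), w.IsCycle → Even w.length

/-- `ε_r = (6r)! / (2^{5r} 3^{2r} (3r)! (2r)!)`. -/
noncomputable def epsr (r : ℕ) : ℝ :=
  ((6 * r).factorial : ℝ) /
    (2 ^ (5 * r) * 3 ^ (2 * r) * ((3 * r).factorial : ℝ) * ((2 * r).factorial : ℝ))

/-- `A(y,λ) = (e^{-λ³/6}/3^{(y+1)/3}) Σ_{k≥0} (3^{2/3}λ/2)^k/k! · 1/Γ((y+1-2k)/3)`;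
Mathlib's `Real.Gamma` vanishes at nonpositive integers, so `(Real.Gamma z)⁻¹ = 0` there. -/
noncomputable def Afun (y μ : ℝ) : ℝ :=
  Real.exp (-μ ^ 3 / 6) / (3 : ℝ) ^ ((y + 1) / 3) *
    ∑' k : ℕ, ((3 : ℝ) ^ ((2 : ℝ) / 3) * μ / 2) ^ k / k.factorial *
      (Real.Gamma ((y + 1 - 2 * k) / 3))⁻¹

/-- The probability that the Bernoulli random graph `G(n, p)` with
`p = (1 + λ n^{-1/3})/n` is bipartite (has no odd cycle):
`B_n = Σ_{G bipartite} p^{e(G)} (1-p)^{N - e(G)}`, `N = n(n-1)/2`. -/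
noncomputable def bipartiteProb (lam : ℝ) (n : ℕ) : ℝ :=
  ∑ G : SimpleGraph (Fin n),
    if HasNoOddCycle G then
      ((1 + lam * (n : ℝ) ^ (-(1 : ℝ) / 3)) / n) ^ edgeCount G *
        (1 - (1 + lam * (n : ℝ) ^ (-(1 : ℝ) / 3)) / n) ^ (n * (n - 1) / 2 - edgeCount G)
    else 0

namespace BipProb

theorem length_eq_one_of_edge_mem {V : Type*} {G : SimpleGraph V} {u v : V} (p : G.Walk v u)
    (hp : p.IsPath) (h : s(u, v) ∈ p.edges) : p.length = 1 := by
  cases p with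
  | nil => simp at h
  | @cons _ x _ hadj q =>
    rw [SimpleGraph.Walk.cons_isPath_iff] at hp
    rw [SimpleGraph.Walk.edges_cons, List.mem_cons] at h
    rcases h with h | h
    · have hx : u = x := by
        rw [Sym2.eq_swap, Sym2.eq_iff] at h
        rcases h with ⟨_, h⟩ | ⟨h1, h2⟩
        · exact h
        · exact h2.trans h1
      subst hx
      have := (SimpleGraph.Walk.isPath_iff_nil (p := q)).1 hp.1
      simp [this.eq_nil]
    · exact absurd (SimpleGraph.Walk.snd_mem_support_of_mem_edges _ h) hp.2

theorem even_length_add_bypass {V : Type*} {G : SimpleGraph V} (hG : HasNoOddCycle G) {u v : V}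
    (p : G.Walk u v) : Even (p.length + p.bypass.length) := by
  induction p with
  | nil => simp [SimpleGraph.Walk.bypass]
  | @cons u x v hadj q ih =>
    rw [SimpleGraph.Walk.bypass]
    split_ifs with hs
    · have hpath : (q.bypass.takeUntil u hs).IsPath := (q.bypass_isPath).takeUntil hs
      have hl : (q.bypass.takeUntil u hs).length + (q.bypass.dropUntil u hs).length
          = q.bypass.length := by
        have := congrArg SimpleGraph.Walk.length (q.bypass.take_spec hs)
        rwa [SimpleGraph.Walk.length_append] at this
      have hev : Even ((q.bypass.takeUntil u hs).length + 1) := by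
        by_cases he : s(u, x) ∈ (q.bypass.takeUntil u hs).edges
        · rw [length_eq_one_of_edge_mem _ hpath he]; decide
        · have := hG _ _ ((SimpleGraph.Walk.cons_isCycle_iff _ hadj).2 ⟨hpath, he⟩)
          simpa using this
      rw [SimpleGraph.Walk.length_cons]
      rw [Nat.even_iff] at *
      omega
    · simp only [SimpleGraph.Walk.length_cons]
      rw [Nat.even_iff] at *
      omega

theorem hasNoOddCycle_iff {V : Type*} (G : SimpleGraph V) :
    HasNoOddCycle G ↔ G.Colorable 2 := by
  rw [SimpleGraph.two_colorable_iff_forall_loop_even]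
  refine ⟨fun h u w => ?_, fun h v w _ => h v w⟩
  have := even_length_add_bypass h w
  have h2 := (SimpleGraph.Walk.isPath_iff_nil).1 w.bypass_isPath
  rw [h2.eq_nil] at this
  simpa using this

theorem edgeCount_iso {V W : Type*} {G : SimpleGraph V} {H : SimpleGraph W} (e : G ≃g H) :
    edgeCount G = edgeCount H := by
  unfold edgeCount
  rw [← Nat.card_coe_set_eq, ← Nat.card_coe_set_eq]
  exact Nat.card_congr e.mapEdgeSet

theorem edgeCount_sum {V W : Type*} [Finite V] [Finite W] (G : SimpleGraph V) (H : SimpleGraph W) :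
    edgeCount (G ⊕g H) = edgeCount G + edgeCount H := by
  unfold edgeCount
  rw [← Nat.card_coe_set_eq, ← Nat.card_coe_set_eq, ← Nat.card_coe_set_eq,
    Nat.card_congr SimpleGraph.edgeSetSumEquiv, Nat.card_sum]

theorem colorable_iso {V W : Type*} {G : SimpleGraph V} {H : SimpleGraph W} (e : G ≃g H) (n : ℕ) :
    G.Colorable n ↔ H.Colorable n :=
  ⟨fun h => h.of_hom e.symm.toHom, fun h => h.of_hom e.toHom⟩

/-- There is no edge of `G` between `S` and its complement. -/
def NoCross {V : Type*} (S : Finset V) (G : SimpleGraph V) : Prop :=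
  ∀ u v, G.Adj u v → (u ∈ S ↔ v ∈ S)

/-- A graph without edges across `S` is the disjoint union of its two parts. -/
noncomputable def splitIso {V : Type*} (S : Finset V) (G : SimpleGraph V) (h : NoCross S G) :
    (G.induce {v | v ∈ S}) ⊕g (G.induce {v | ¬ v ∈ S}) ≃g G where
  toEquiv := Equiv.sumCompl (fun v => v ∈ S)
  map_rel_iff' := by
    rintro (⟨a, ha⟩ | ⟨a, ha⟩) (⟨b, hb⟩ | ⟨b, hb⟩)
    · exact Iff.rfl
    · simp only [Set.mem_ofPred_eq] at ha hb
      simp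
      intro hab; exact hb ((h _ _ hab).1 ha)
    · simp only [Set.mem_ofPred_eq] at ha hb
      simp
      intro hab; exact ha ((h _ _ hab).2 hb)
    · exact Iff.rfl

/-- Graphs without edges across `S` are pairs of graphs. -/
noncomputable def splitEquiv {V : Type*} (S : Finset V) :
    {G : SimpleGraph V // NoCross S G} ≃
      SimpleGraph {v // v ∈ S} × SimpleGraph {v // ¬ v ∈ S} where
  toFun G := (G.1.induce {v | v ∈ S}, G.1.induce {v | ¬ v ∈ S})
  invFun P := ⟨(P.1 ⊕g P.2).map (Equiv.sumCompl (fun v => v ∈ S)).toEmbedding, by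
    rintro u v huv
    rw [SimpleGraph.map_adj] at huv
    obtain ⟨a, b, hab, rfl, rfl⟩ := huv
    rcases a with a | a <;> rcases b with b | b
    · simp [a.2, b.2]
    · simp at hab
    · simp at hab
    · simp [a.2, b.2]⟩
  left_inv G := by
    apply Subtype.ext
    ext u v
    simp only [SimpleGraph.map_adj]
    constructor
    · rintro ⟨a, b, hab, rfl, rfl⟩
      exact ((splitIso S G.1 G.2).map_rel_iff).2 hab
    · intro huv
      refine ⟨(splitIso S G.1 G.2).symm u, (splitIso S G.1 G.2).symm v, ?_, ?_, ?_⟩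
      · exact ((splitIso S G.1 G.2).symm.map_rel_iff).2 huv
      · exact (splitIso S G.1 G.2).apply_symm_apply u
      · exact (splitIso S G.1 G.2).apply_symm_apply v
  right_inv P := by
    apply Prod.ext
    · ext u v
      have := SimpleGraph.map_adj_apply (G := P.1 ⊕g P.2)
        (f := (Equiv.sumCompl (fun v => v ∈ S)).toEmbedding) (a := Sum.inl u) (b := Sum.inl v)
      simpa using this
    · ext u v
      have := SimpleGraph.map_adj_apply (G := P.1 ⊕g P.2)
        (f := (Equiv.sumCompl (fun v => v ∈ S)).toEmbedding) (a := Sum.inr u) (b := Sum.inr v)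
      simpa using this

theorem sum_noCross {V R : Type*} [Fintype V] [CommSemiring R] (S : Finset V)
    (Φ : SimpleGraph {v // v ∈ S} → R) (Ψ : SimpleGraph {v // ¬ v ∈ S} → R) :
    ∑ G : SimpleGraph V, (if NoCross S G then
        Φ (G.induce {v | v ∈ S}) * Ψ (G.induce {v | ¬ v ∈ S}) else 0) =
      (∑ G, Φ G) * ∑ G, Ψ G := by
  rw [Finset.sum_mul_sum, ← Finset.sum_product', Finset.univ_product_univ, ← Finset.sum_filter,
    ← Finset.sum_subtype_eq_sum_filter, ← (splitEquiv S).sum_comp]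
  refine Finset.sum_congr ?_ fun _ _ => rfl
  ext; simp

/-- Weighted sum over all 2-colorable graphs on `V`. -/
noncomputable def bipV {R : Type*} [CommSemiring R] (w : R) (V : Type) [Fintype V] : R :=
  ∑ G : SimpleGraph V, if G.Colorable 2 then w ^ edgeCount G else 0

/-- Weighted sum over all connected 2-colorable graphs on `V`. -/
noncomputable def conV {R : Type*} [CommSemiring R] (w : R) (V : Type) [Fintype V] : R :=
  ∑ G : SimpleGraph V, if G.Connected ∧ G.Colorable 2 then w ^ edgeCount G else 0

theorem bipV_congr {R : Type*} [CommSemiring R] (w : R) {V W : Type} [Fintype V] [Fintype W]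
    (e : V ≃ W) : bipV w V = bipV w W := by
  unfold bipV
  rw [← (Equiv.simpleGraph e).sum_comp]
  refine Finset.sum_congr rfl fun G _ => ?_
  have i : G ≃g (Equiv.simpleGraph e G) := 
    (SimpleGraph.Iso.comap e.symm G).symm
  rw [← edgeCount_iso i, ← colorable_iso i]

theorem conV_congr {R : Type*} [CommSemiring R] (w : R) {V W : Type} [Fintype V] [Fintype W]
    (e : V ≃ W) : conV w V = conV w W := by
  unfold conV
  rw [← (Equiv.simpleGraph e).sum_comp]
  refine Finset.sum_congr rfl fun G _ => ?_
  have i : G ≃g (Equiv.simpleGraph e G) := 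
    (SimpleGraph.Iso.comap e.symm G).symm
  simp only [← edgeCount_iso i, ← colorable_iso i, i.connected_iff]

/-- `B_n` as a polynomial in the edge weight. -/
noncomputable def bipW {R : Type*} [CommSemiring R] (w : R) (n : ℕ) : R := bipV w (Fin n)

/-- Connected version of `bipW`. -/
noncomputable def conW {R : Type*} [CommSemiring R] (w : R) (n : ℕ) : R := conV w (Fin n)

theorem bipV_eq {R : Type*} [CommSemiring R] (w : R) (V : Type) [Fintype V] :
    bipV w V = bipW w (Fintype.card V) := bipV_congr w (Fintype.equivFin V)

theorem conV_eq {R : Type*} [CommSemiring R] (w : R) (V : Type) [Fintype V] :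
    conV w V = conW w (Fintype.card V) := conV_congr w (Fintype.equivFin V)

theorem card_sub_compl {V : Type} [Fintype V] (S : Finset V) :
    Fintype.card {v // ¬ v ∈ S} = Fintype.card V - S.card := by
  rw [Fintype.card_subtype_compl, Fintype.card_coe]

theorem edgeCount_split {V : Type} [Fintype V] (S : Finset V) (G : SimpleGraph V)
    (h : NoCross S G) :
    edgeCount G = edgeCount (G.induce {v | v ∈ S}) + edgeCount (G.induce {v | ¬ v ∈ S}) := by
  rw [← edgeCount_iso (splitIso S G h), edgeCount_sum]

theorem colorable_split {V : Type} (S : Finset V) (G : SimpleGraph V)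
    (h : NoCross S G) :
    G.Colorable 2 ↔ (G.induce {v | v ∈ S}).Colorable 2 ∧ (G.induce {v | ¬ v ∈ S}).Colorable 2 := by
  rw [← colorable_iso (splitIso S G h), SimpleGraph.colorable_sum]

theorem sum_noCross_bip {V : Type} {R : Type*} [Fintype V] [CommSemiring R] (w : R)
    (S : Finset V) :
    ∑ G : SimpleGraph V, (if NoCross S G ∧ G.Colorable 2 then w ^ edgeCount G else 0) =
      bipW w S.card * bipW w (Fintype.card V - S.card) := by
  have h1 := bipV_eq w {v // v ∈ S}
  have h2 := bipV_eq w {v // ¬ v ∈ S}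
  rw [Fintype.card_coe] at h1
  rw [card_sub_compl] at h2
  rw [← h1, ← h2]
  unfold bipV
  have h3 := sum_noCross S
    (fun G => if G.Colorable 2 then w ^ edgeCount G else 0)
    (fun G => if G.Colorable 2 then w ^ edgeCount G else 0)
  refine Eq.trans ?_ (h3.trans (by congr!))
  refine Finset.sum_congr rfl fun G _ => ?_
  by_cases hS : NoCross S G
  · simp only [hS, true_and, if_true, colorable_split S G hS, edgeCount_split S G hS, pow_add]
    split_ifs <;> simp_all
  · simp [hS]

theorem sum_noCross_con {V : Type} {R : Type*} [Fintype V] [CommSemiring R] (w : R)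
    (S : Finset V) :
    ∑ G : SimpleGraph V, (if (NoCross S G ∧ (G.induce {v | v ∈ S}).Connected) ∧ G.Colorable 2 then
        w ^ edgeCount G else 0) =
      conW w S.card * bipW w (Fintype.card V - S.card) := by
  have h1 := conV_eq w {v // v ∈ S}
  have h2 := bipV_eq w {v // ¬ v ∈ S}
  rw [Fintype.card_coe] at h1
  rw [card_sub_compl] at h2
  rw [← h1, ← h2]
  unfold bipV conV
  have h3 := sum_noCross S
    (fun G => if G.Connected ∧ G.Colorable 2 then w ^ edgeCount G else 0)
    (fun G => if G.Colorable 2 then w ^ edgeCount G else 0)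
  refine Eq.trans ?_ (h3.trans (by congr!))
  refine Finset.sum_congr rfl fun G _ => ?_
  by_cases hS : NoCross S G
  · simp only [hS, true_and, if_true, colorable_split S G hS, edgeCount_split S G hS, pow_add]
    split_ifs <;> simp_all
  · simp [hS]

/-- `S` is a color class of a proper 2-coloring of `G`. -/
def Proper {V : Type*} (S : Finset V) (G : SimpleGraph V) : Prop :=
  ∀ u v, G.Adj u v → (u ∈ S ↔ ¬ v ∈ S)

theorem Proper.colorable {V : Type*} {S : Finset V} {G : SimpleGraph V} (h : Proper S G) :
    G.Colorable 2 := by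
  refine ⟨SimpleGraph.Coloring.mk (fun v => if v ∈ S then 0 else 1) ?_⟩
  intro u v huv
  have := h u v huv
  by_cases hu : u ∈ S <;> simp_all

theorem exists_proper {V : Type*} [Fintype V] {G : SimpleGraph V} (h : G.Colorable 2) :
    ∃ S, Proper S G := by
  obtain ⟨c⟩ := h
  refine ⟨Finset.univ.filter fun v => c v = 0, fun u v huv => ?_⟩
  have := c.valid huv
  simp only [Finset.mem_filter, Finset.mem_univ, true_and]
  omega

theorem sum_noCross_eq_proper {V : Type} {R : Type*} [Fintype V] [CommSemiring R]
    (G : SimpleGraph V) (x : R) :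
    ∑ S : Finset V, (if NoCross S G ∧ G.Colorable 2 then x else 0) =
      ∑ S : Finset V, if Proper S G then x else 0 := by
  by_cases hG : G.Colorable 2
  · obtain ⟨T, hT⟩ := exists_proper hG
    let e : Finset V ≃ Finset V := Function.Involutive.toPerm (fun S => symmDiff S T)
      (fun S => symmDiff_symmDiff_cancel_right T S)
    rw [← e.sum_comp]
    refine Finset.sum_congr rfl fun S _ => ?_
    have : NoCross (e S) G ↔ Proper S G := by
      refine forall_congr' fun u => forall_congr' fun v => forall_congr' fun huv => ?_
      have := hT u v huv
      change (u ∈ symmDiff S T ↔ v ∈ symmDiff S T) ↔ _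
      simp only [Finset.mem_symmDiff]
      tauto
    simp [this, hG]
  · have : ∀ S : Finset V, ¬ Proper S G := fun S h => hG h.colorable
    simp [this, hG]

theorem edgeCount_eq_card {V : Type*} [Fintype V] (G : SimpleGraph V) :
    edgeCount G = G.edgeFinset.card := by
  unfold edgeCount
  rw [Set.ncard_eq_toFinset_card']
  rfl

theorem sum_le_graph {V R : Type*} [Fintype V] [CommSemiring R] (w : R) (K : SimpleGraph V) :
    ∑ G : SimpleGraph V, (if G ≤ K then w ^ edgeCount G else 0) = (w + 1) ^ edgeCount K := by
  have h := Finset.sum_pow_mul_eq_add_pow w 1 K.edgeFinset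
  simp only [one_pow, mul_one] at h
  rw [edgeCount_eq_card, ← h, ← Finset.sum_filter]
  refine Finset.sum_bij' (fun G _ => G.edgeFinset)
    (fun s _ => SimpleGraph.fromEdgeSet (s : Set (Sym2 V))) ?_ ?_ ?_ ?_ ?_
  · intro G hG
    simpa using hG
  · intro s hs
    rw [Finset.mem_powerset] at hs
    rw [Finset.mem_filter]
    refine ⟨Finset.mem_univ _, ?_⟩
    intro u v huv
    rw [SimpleGraph.fromEdgeSet_adj] at huv
    have := hs huv.1
    simpa using this
  · intro G hG
    simp
  · intro s hs
    rw [Finset.mem_powerset] at hs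
    ext e
    simp only [SimpleGraph.mem_edgeFinset, SimpleGraph.edgeSet_fromEdgeSet, Set.mem_sdiff,
      Finset.mem_coe]
    refine ⟨fun h => h.1, fun h => ⟨h, ?_⟩⟩
    have := hs h
    rw [SimpleGraph.mem_edgeFinset] at this
    exact K.not_isDiag_of_mem_edgeSet this
  · intro G hG
    rw [edgeCount_eq_card]

/-- Complete bipartite graph with color class `S`. -/
def bipComplete {V : Type*} (S : Finset V) : SimpleGraph V where
  Adj u v := (u ∈ S ↔ ¬ v ∈ S)
  symm := ⟨fun u v h => by tauto⟩
  loopless := ⟨fun u h => by tauto⟩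

theorem edgeCount_bipComplete {V : Type} [Fintype V] (S : Finset V) :
    edgeCount (bipComplete S) = S.card * (Fintype.card V - S.card) := by
  unfold edgeCount
  have : (bipComplete S).edgeSet =
      (fun p : V × V => s(p.1, p.2)) '' ((S ×ˢ Sᶜ : Finset (V × V)) : Set (V × V)) := by
    ext e
    induction e with | _ u v
    simp only [SimpleGraph.mem_edgeSet, Set.mem_image, Finset.coe_product, Set.mem_prod,
      Finset.mem_coe, Finset.coe_compl, Set.mem_compl_iff, Prod.exists]
    constructor
    · intro h
      change (u ∈ S ↔ ¬ v ∈ S) at h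
      by_cases hu : u ∈ S
      · exact ⟨u, v, ⟨hu, h.1 hu⟩, rfl⟩
      · exact ⟨v, u, ⟨by tauto, hu⟩, Sym2.eq_swap⟩
    · rintro ⟨a, b, ⟨ha, hb⟩, hab⟩
      change (u ∈ S ↔ ¬ v ∈ S)
      rw [Sym2.eq_iff] at hab
      rcases hab with ⟨rfl, rfl⟩ | ⟨rfl, rfl⟩ <;> tauto
  rw [this, Set.InjOn.ncard_image, Set.ncard_coe_finset, Finset.card_product, Finset.card_compl]
  rintro ⟨a, b⟩ hab ⟨c, d⟩ hcd h
  simp only [Finset.coe_product, Set.mem_prod, Finset.mem_coe, Finset.coe_compl,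
    Set.mem_compl_iff] at hab hcd
  simp only [Sym2.eq_iff] at h
  rcases h with ⟨rfl, rfl⟩ | ⟨rfl, rfl⟩
  · rfl
  · tauto

theorem sum_proper {V : Type} {R : Type*} [Fintype V] [CommSemiring R] (w : R) (S : Finset V) :
    ∑ G : SimpleGraph V, (if Proper S G then w ^ edgeCount G else 0) =
      (w + 1) ^ (S.card * (Fintype.card V - S.card)) := by
  rw [← edgeCount_bipComplete, ← sum_le_graph]
  rfl

theorem bipV_sq {R : Type*} [CommSemiring R] (w : R) (V : Type) [Fintype V] {n : ℕ}
    (hn : Fintype.card V = n) :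
    ∑ k ∈ Finset.range (n + 1), (n.choose k : R) * (bipW w k * bipW w (n - k)) =
      ∑ k ∈ Finset.range (n + 1), (n.choose k : R) * (w + 1) ^ (k * (n - k)) := by
  have h1 := Finset.sum_powerset_apply_card (fun k => bipW w k * bipW w (n - k))
    (x := (Finset.univ : Finset V))
  have h2 := Finset.sum_powerset_apply_card (fun k => (w + 1) ^ (k * (n - k)))
    (x := (Finset.univ : Finset V))
  simp only [Finset.card_univ, hn, nsmul_eq_mul, Finset.powerset_univ] at h1 h2
  rw [← h1, ← h2]
  have h3 : ∀ S : Finset V, bipW w S.card * bipW w (n - S.card) =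
      ∑ G : SimpleGraph V,
        (if NoCross S G ∧ G.Colorable 2 then w ^ edgeCount G else 0) := by
    intro S
    rw [sum_noCross_bip, hn]
  have h4 : ∀ S : Finset V, (w + 1) ^ (S.card * (n - S.card)) =
      ∑ G : SimpleGraph V, if Proper S G then w ^ edgeCount G else 0 := by
    intro S
    rw [sum_proper, hn]
  simp only [h3, h4]
  rw [Finset.sum_comm, Finset.sum_comm (s := Finset.univ (α := Finset V))
    (f := fun S G => if Proper S G then w ^ edgeCount G else 0)]
  exact Finset.sum_congr rfl fun G _ => sum_noCross_eq_proper G _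

theorem bipW_sq {R : Type*} [CommSemiring R] (w : R) (n : ℕ) :
    ∑ k ∈ Finset.range (n + 1), (n.choose k : R) * (bipW w k * bipW w (n - k)) =
      ∑ k ∈ Finset.range (n + 1), (n.choose k : R) * (w + 1) ^ (k * (n - k)) :=
  bipV_sq w (Fin n) (Fintype.card_fin n)

theorem component_iff {V : Type} [Fintype V] (G : SimpleGraph V) (v₀ : V) (S : Finset V) :
    (v₀ ∈ S ∧ NoCross S G ∧ (G.induce {v | v ∈ S}).Connected) ↔
      S = Finset.univ.filter fun v => G.Reachable v₀ v := by
  constructor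
  · rintro ⟨h0, hS, hc⟩
    ext v
    simp only [Finset.mem_filter, Finset.mem_univ, true_and]
    constructor
    · intro hv
      exact (hc.preconnected ⟨v₀, h0⟩ ⟨v, hv⟩).map (SimpleGraph.Embedding.induce _).toHom
    · rintro ⟨p⟩
      induction p with
      | nil => exact h0
      | cons hadj q ih => exact ih ((hS _ _ hadj).1 h0)
  · rintro rfl
    refine ⟨by simp, ?_, ?_⟩
    · intro u v huv
      simp only [Finset.mem_filter, Finset.mem_univ, true_and]
      exact ⟨fun h => h.trans huv.reachable, fun h => h.trans huv.symm.reachable⟩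
    · set S := Finset.univ.filter fun v => G.Reachable v₀ v
      have h0 : v₀ ∈ S := by simp [S]
      have key : ∀ v (p : G.Reachable v₀ v), ∃ hv : v ∈ S,
          (G.induce {v | v ∈ S}).Reachable ⟨v₀, h0⟩ ⟨v, hv⟩ := by
        intro v p
        rw [SimpleGraph.reachable_iff_reflTransGen] at p
        induction p with
        | refl => exact ⟨h0, SimpleGraph.Reachable.refl _⟩
        | @tail b c hb hbc ih =>
          obtain ⟨hb', hr⟩ := ih
          have hc : c ∈ S := by
            have : G.Reachable v₀ b := by simpa [S] using hb'
            simpa [S] using this.trans hbc.reachable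
          refine ⟨hc, hr.trans ?_⟩
          apply SimpleGraph.Adj.reachable
          exact hbc
      have : Nonempty {v | v ∈ S} := ⟨⟨v₀, h0⟩⟩
      refine ⟨?_⟩
      rintro ⟨u, hu⟩ ⟨v, hv⟩
      have hu' : G.Reachable v₀ u := by
        have : u ∈ S := hu
        simpa [S] using this
      have hv' : G.Reachable v₀ v := by
        have : v ∈ S := hv
        simpa [S] using this
      exact (key u hu').2.symm.trans (key v hv').2

theorem bipV_succ {R : Type*} [CommSemiring R] (w : R) (V : Type) [Fintype V] (v₀ : V) {n : ℕ}
    (hn : Fintype.card V = n + 1) :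
    bipV w V =
      ∑ k ∈ Finset.range (n + 1), (n.choose k : R) * (conW w (k + 1) * bipW w (n - k)) := by
  have h0 : v₀ ∉ (Finset.univ.erase v₀ : Finset V) := by simp
  have hcard : (Finset.univ.erase v₀ : Finset V).card = n := by
    rw [Finset.card_erase_of_mem (Finset.mem_univ _), Finset.card_univ, hn, Nat.add_sub_cancel]
  have h1 := Finset.sum_powerset_apply_card (fun k => conW w (k + 1) * bipW w (n - k))
    (x := (Finset.univ.erase v₀ : Finset V))
  simp only [hcard, nsmul_eq_mul] at h1
  rw [← h1]
  have h2 : bipV w V = ∑ S : Finset V, ∑ G : SimpleGraph V,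
      if v₀ ∈ S then (if (NoCross S G ∧ (G.induce {v | v ∈ S}).Connected) ∧ G.Colorable 2 then
        w ^ edgeCount G else 0) else 0 := by
    rw [Finset.sum_comm]
    unfold bipV
    refine Finset.sum_congr rfl fun G _ => ?_
    have : ∀ S : Finset V, (if v₀ ∈ S then
        (if (NoCross S G ∧ (G.induce {v | v ∈ S}).Connected) ∧ G.Colorable 2 then
        w ^ edgeCount G else 0) else 0) =
        if S = (Finset.univ.filter fun v => G.Reachable v₀ v) then
          (if G.Colorable 2 then w ^ edgeCount G else 0) else 0 := by
      intro S
      by_cases hS : S = (Finset.univ.filter fun v => G.Reachable v₀ v)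
      · have h := (component_iff G v₀ S).2 hS
        rw [if_pos hS, if_pos h.1]
        simp only [h.2.1, h.2.2, true_and]
      · rw [if_neg hS]
        split_ifs with h3 h4
        · exact absurd ((component_iff G v₀ S).1 ⟨h3, h4.1⟩) hS
        · rfl
        · rfl
    simp only [this]
    simp
  have h5 : (Finset.univ : Finset (Finset V)) =
      (insert v₀ (Finset.univ.erase v₀ : Finset V)).powerset := by
    rw [Finset.insert_erase (Finset.mem_univ v₀), Finset.powerset_univ]
  rw [h2, h5, Finset.sum_powerset_insert h0, Finset.sum_eq_zero, zero_add]
  · refine Finset.sum_congr rfl fun t ht => ?_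
    have ht0 : v₀ ∉ t := fun h => h0 (Finset.mem_powerset.1 ht h)
    simp only [Finset.mem_insert_self, if_true]
    rw [sum_noCross_con, Finset.card_insert_of_notMem ht0, hn,
      Nat.add_sub_add_right]
  · intro t ht
    have ht0 : v₀ ∉ t := fun h => h0 (Finset.mem_powerset.1 ht h)
    simp [ht0]

theorem bipW_succ {R : Type*} [CommSemiring R] (w : R) (n : ℕ) :
    bipW w (n + 1) =
      ∑ k ∈ Finset.range (n + 1), (n.choose k : R) * (conW w (k + 1) * bipW w (n - k)) :=
  bipV_succ w (Fin (n + 1)) 0 (Fintype.card_fin _)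

theorem bipW_zero {R : Type*} [CommSemiring R] (w : R) : bipW w 0 = 1 := by
  unfold bipW bipV
  refine (Finset.sum_eq_single (⊥ : SimpleGraph (Fin 0)) ?_ ?_).trans ?_
  · intro G _ hG
    exact absurd (Subsingleton.elim _ _) hG
  · simp
  · rw [if_pos (SimpleGraph.Colorable.of_isEmpty 2)]
    simp [edgeCount]

theorem edgeCount_le {n : ℕ} (G : SimpleGraph (Fin n)) : edgeCount G ≤ n * (n - 1) / 2 := by
  rw [edgeCount_eq_card]
  have := G.card_edgeFinset_le_card_choose_two
  rwa [Fintype.card_fin, Nat.choose_two_right] at this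

theorem bipartiteProb_eq (lam : ℝ) (n : ℕ) (p : ℝ)
    (hp : p = (1 + lam * (n : ℝ) ^ (-(1 : ℝ) / 3)) / n) (h1 : p ≠ 1) :
    bipartiteProb lam n = (1 - p) ^ (n * (n - 1) / 2) * bipW (p / (1 - p)) n := by
  unfold bipartiteProb bipW bipV
  rw [Finset.mul_sum]
  have hq : (1 - p) ≠ 0 := sub_ne_zero.2 (Ne.symm h1)
  have key : ∀ G : SimpleGraph (Fin n), p ^ edgeCount G * (1 - p) ^ (n * (n - 1) / 2 - edgeCount G)
      = (1 - p) ^ (n * (n - 1) / 2) * (p / (1 - p)) ^ edgeCount G := by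
    intro G
    obtain ⟨m, hm⟩ := Nat.exists_eq_add_of_le (edgeCount_le G)
    rw [hm, Nat.add_sub_cancel_left, pow_add, div_pow]
    field_simp
  refine Finset.sum_congr (by congr!) fun G _ => ?_
  rw [← hp, mul_ite, mul_zero, ← key]
  simp only [hasNoOddCycle_iff]

open PowerSeries in
/-- The exponential series `e^{cX}`. -/
noncomputable def expS {A : Type*} [CommRing A] [Algebra ℚ A] (c : A) : PowerSeries A :=
  rescale c (exp A)

open PowerSeries in
/-- The series `e^{dX²}`. -/
noncomputable def expQ {A : Type*} [CommRing A] [Algebra ℚ A] (d : A) : PowerSeries A :=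
  (expS d).subst (X ^ 2 : PowerSeries A)

open PowerSeries in
/-- The inner series `X e^{-αX}`. -/
noncomputable def innerS {A : Type*} [CommRing A] [Algebra ℚ A] (α : A) : PowerSeries A :=
  X * expS (-α)

/-- The substitution `X ↦ X e^{-αX}`. -/
noncomputable def subS {A : Type*} [CommRing A] [Algebra ℚ A] (α : A) (P : PowerSeries A) :
    PowerSeries A :=
  P.subst (innerS α)

open PowerSeries in
/-- The inverse of the substitution `X ↦ X e^{-αX}`, by Lagrange inversion. -/
noncomputable def lagS {A : Type*} [CommRing A] [Algebra ℚ A] (α : A) (Z : PowerSeries A) :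
    PowerSeries A :=
  mk fun n => coeff n ((1 - C α * X) * expS (n * α) * Z)

section

open PowerSeries

theorem hasSubst_sq {A : Type*} [CommRing A] : HasSubst (X ^ 2 : PowerSeries A) :=
  HasSubst.of_constantCoeff_zero' (by simp)

theorem isUnit_one_sub {A : Type*} [CommRing A] (α : A) : IsUnit (1 - C α * X : PowerSeries A) := by
  rw [isUnit_iff_constantCoeff]
  simp

variable {A : Type*} [CommRing A] [Algebra ℚ A]

theorem coeff_expS (c : A) (n : ℕ) :
    coeff n (expS c) = c ^ n * algebraMap ℚ A (1 / n.factorial) := by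
  rw [expS, coeff_rescale, coeff_exp]

theorem expS_add (c d : A) : expS (c + d) = expS c * expS d :=
  (exp_mul_exp_eq_exp_add c d).symm

theorem expS_zero : expS (0 : A) = 1 := by
  ext n
  rw [coeff_expS, coeff_one]
  rcases n with _ | n <;> simp

theorem expS_pow (c : A) (k : ℕ) : expS c ^ k = expS (k * c) := by
  induction k with
  | zero => simp [expS_zero]
  | succ k ih => rw [pow_succ, ih, ← expS_add]; push_cast; ring_nf

theorem constantCoeff_expS (c : A) : constantCoeff (expS c) = 1 := by
  rw [← coeff_zero_eq_constantCoeff_apply, coeff_expS]; simp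

theorem derivative_expS (c : A) : d⁄dX A (expS c) = C c * expS c := by
  ext n
  rw [coeff_derivative, coeff_C_mul, coeff_expS, coeff_expS]
  have h : algebraMap ℚ A (1 / (n + 1).factorial) * ((n : A) + 1)
      = algebraMap ℚ A (1 / n.factorial) := by
    have : ((n : A) + 1) = algebraMap ℚ A (n + 1) := by simp
    rw [this, ← map_mul, Nat.factorial_succ]
    congr 1
    have := Nat.factorial_ne_zero n
    push_cast
    field_simp
  rw [mul_assoc, h]
  ring

theorem map_expS {B : Type*} [CommRing B] [Algebra ℚ B] (φ : A →+* B) (c : A) :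
    map φ (expS c) = expS (φ c) := by
  rw [expS, expS, ← rescale_map, map_exp]

theorem hasSubst_innerS (α : A) : HasSubst (innerS α) :=
  HasSubst.of_constantCoeff_zero' (by simp [innerS])

theorem coeff_expQ (d : A) (n : ℕ) :
    coeff n (expQ d) = if 2 ∣ n then d ^ (n / 2) * algebraMap ℚ A (1 / (n / 2).factorial) else 0 := by
  rw [expQ, coeff_subst_X_pow two_ne_zero, coeff_expS]
  rfl

theorem expQ_add (c d : A) : expQ (c + d) = expQ c * expQ d := by
  rw [expQ, expS_add, subst_mul hasSubst_sq]
  rfl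

theorem expQ_zero : expQ (0 : A) = 1 := by
  rw [expQ, expS_zero, ← coe_substAlgHom hasSubst_sq, map_one]

theorem constantCoeff_expQ (d : A) : constantCoeff (expQ d) = 1 := by
  rw [← coeff_zero_eq_constantCoeff_apply, coeff_expQ]; simp

theorem derivative_expQ (d : A) : d⁄dX A (expQ d) = C (2 * d) * X * expQ d := by
  rw [expQ, derivative_subst hasSubst_sq, derivative_expS, subst_mul hasSubst_sq, subst_C]
  have h1 : d⁄dX A (X ^ 2 : PowerSeries A) = 2 * X := by
    rw [Derivation.leibniz_pow, derivative_X]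
    simp
  rw [h1]
  have h2 : (MvPowerSeries.C d : PowerSeries A) = C d := rfl
  rw [h2, map_mul, map_ofNat]
  ring

theorem map_expQ {B : Type*} [CommRing B] [Algebra ℚ B] (φ : A →+* B) (d : A) :
    map φ (expQ d) = expQ (φ d) := by
  ext n
  rw [coeff_map, coeff_expQ, coeff_expQ]
  split_ifs
  · rw [map_mul, map_pow]
    congr 1
    exact RingHom.congr_fun (Subsingleton.elim (φ.comp (algebraMap ℚ A)) (algebraMap ℚ B)) _
  · simp

theorem subS_mul (α : A) (P Q : PowerSeries A) : subS α (P * Q) = subS α P * subS α Q :=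
  subst_mul (hasSubst_innerS α) P Q

theorem subS_add (α : A) (P Q : PowerSeries A) : subS α (P + Q) = subS α P + subS α Q :=
  subst_add (hasSubst_innerS α) P Q

theorem subS_C (α c : A) : subS α (C c) = C c := subst_C c

theorem subS_X_pow (α : A) (m : ℕ) : subS α (X ^ m) = X ^ m * expS (-(m * α)) := by
  rw [subS, subst_pow (hasSubst_innerS α), subst_X (hasSubst_innerS α), innerS]
  change (X * expS (-α)) ^ m = _
  rw [mul_pow, expS_pow, mul_neg]

theorem subS_sum {ι : Type*} (α : A) (s : Finset ι) (P : ι → PowerSeries A) :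
    subS α (∑ i ∈ s, P i) = ∑ i ∈ s, subS α (P i) := by
  unfold subS
  rw [← coe_substAlgHom (hasSubst_innerS α), map_sum]

theorem subS_trunc (α : A) (P : PowerSeries A) (n : ℕ) :
    subS α (trunc n P : Polynomial A) =
      ∑ m ∈ Finset.range n, C (coeff m P) * (X ^ m * expS (-(m * α))) := by
  have h : ((trunc n P : Polynomial A) : PowerSeries A) =
      ∑ m ∈ Finset.range n, C (coeff m P) * X ^ m := by
    ext k
    rw [Polynomial.coeff_coe, coeff_trunc, map_sum]
    simp [coeff_C_mul, coeff_X_pow]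
  rw [h, subS_sum]
  refine Finset.sum_congr rfl fun m _ => ?_
  rw [subS_mul, subS_C, subS_X_pow]

/-- The coefficients of `Z · P(X e^{-αX})`. -/
theorem coeff_mul_subS (α : A) (Z P : PowerSeries A) (N : ℕ) :
    coeff N (Z * subS α P) =
      ∑ m ∈ Finset.range (N + 1), coeff m P * coeff N (Z * (X ^ m * expS (-(m * α)))) := by
  conv_lhs => rw [eq_X_pow_mul_shift_add_trunc (N + 1) P]
  rw [subS_add, subS_mul, subS_X_pow, subS_trunc, mul_add, map_add]
  have h0 : ∀ Q R : PowerSeries A, coeff N (Z * (X ^ (N + 1) * Q * R)) = 0 := by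
    intro Q R
    rw [show Z * (X ^ (N + 1) * Q * R) = X ^ (N + 1) * (Z * Q * R) by ring, coeff_X_pow_mul',
      if_neg (by omega)]
  rw [h0, zero_add, Finset.mul_sum, map_sum]
  refine Finset.sum_congr rfl fun m _ => ?_
  rw [mul_left_comm, coeff_C_mul]

theorem coeff_one_sub_mul_expS (α : A) (k : ℕ) :
    coeff k ((1 - C α * X) * expS (k * α)) = if k = 0 then 1 else 0 := by
  rw [sub_mul, one_mul, mul_assoc, map_sub, coeff_C_mul]
  rcases k with _ | k
  · simp [expS_zero]
  · rw [coeff_succ_X_mul, coeff_expS, coeff_expS, if_neg (Nat.succ_ne_zero k)]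
    have h : algebraMap ℚ A (1 / (k + 1).factorial) * ((k : A) + 1)
        = algebraMap ℚ A (1 / k.factorial) := by
      have : ((k : A) + 1) = algebraMap ℚ A (k + 1) := by simp
      rw [this, ← map_mul, Nat.factorial_succ]
      congr 1
      have := Nat.factorial_ne_zero k
      push_cast
      field_simp
    rw [← h]
    push_cast
    ring

theorem lagS_subS (α : A) (P : PowerSeries A) : lagS α (subS α P) = P := by
  ext n
  rw [lagS, coeff_mk, coeff_mul_subS, Finset.sum_range_succ, Finset.sum_eq_zero, zero_add]
  · rw [mul_left_comm, mul_assoc, ← expS_add, add_neg_cancel, expS_zero, mul_one]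
    rw [coeff_X_pow_mul', if_pos le_rfl, Nat.sub_self]
    simp
  · intro m hm
    have hm' := Finset.mem_range.1 hm
    rw [mul_left_comm, mul_assoc, ← expS_add, coeff_X_pow_mul', if_pos hm'.le]
    have : (n : A) * α + -((m : A) * α) = ((n - m : ℕ) : A) * α := by
      rw [Nat.cast_sub hm'.le]; ring
    rw [this, coeff_one_sub_mul_expS, if_neg (by omega), mul_zero]

theorem subS_injective (α : A) : Function.Injective (subS α) :=
  Function.LeftInverse.injective (lagS_subS α)

theorem lagS_injective (α : A) : Function.Injective (lagS α) := by
  intro Y Z h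
  have h1 : ∀ n, coeff n ((1 - C α * X) * expS (n * α) * (Y - Z)) = 0 := by
    intro n
    have := congrArg (coeff n) h
    rw [lagS, lagS, coeff_mk, coeff_mk] at this
    rw [mul_sub, map_sub, this, sub_self]
  have h2 : ∀ n, coeff n (Y - Z) = 0 := by
    intro n
    induction n using Nat.strong_induction_on with
    | _ n ih =>
      have := h1 n
      rw [coeff_mul, Finset.sum_eq_single (0, n)] at this
      · rw [coeff_zero_eq_constantCoeff_apply] at this
        simpa [constantCoeff_expS] using this
      · rintro ⟨i, j⟩ hij hne
        replace hij := Finset.HasAntidiagonal.mem_antidiagonal.1 hij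
        simp only at hij ⊢
        rw [ih j, mul_zero]
        by_contra hc
        apply hne
        ext <;> simp <;> omega
      · simp
  ext n
  have := h2 n
  rw [map_sub] at this
  exact sub_eq_zero.1 this

theorem subS_lagS (α : A) (Z : PowerSeries A) : subS α (lagS α Z) = Z :=
  lagS_injective α (lagS_subS α _)

theorem map_lagS {B : Type*} [CommRing B] [Algebra ℚ B] (φ : A →+* B) (α : A)
    (Z : PowerSeries A) : map φ (lagS α Z) = lagS (φ α) (map φ Z) := by
  ext n
  rw [coeff_map, lagS, lagS, coeff_mk, coeff_mk, ← coeff_map]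
  simp [map_expS]

theorem rescale_expS (c α : A) : rescale c (expS α) = expS (c * α) := by
  rw [expS, rescale_rescale, expS, mul_comm]

theorem rescale_expQ (c d : A) : rescale c (expQ d) = expQ (c ^ 2 * d) := by
  ext n
  rw [coeff_rescale, coeff_expQ, coeff_expQ]
  split_ifs with h
  · obtain ⟨k, rfl⟩ := h
    rw [Nat.mul_div_cancel_left _ two_pos, mul_pow, pow_mul]
    ring
  · simp

theorem subS_rescale (c α : A) (P : PowerSeries A) :
    subS (c * α) (rescale c P) = rescale c (subS α P) := by
  ext N
  rw [coeff_rescale, ← one_mul (subS (c * α) _), ← one_mul (subS α P), coeff_mul_subS,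
    coeff_mul_subS, Finset.mul_sum]
  refine Finset.sum_congr rfl fun m hm => ?_
  have hm' : m ≤ N := by have := Finset.mem_range.1 hm; omega
  rw [coeff_rescale, one_mul, one_mul, coeff_X_pow_mul', coeff_X_pow_mul', if_pos hm', if_pos hm',
    coeff_expS, coeff_expS]
  obtain ⟨k, rfl⟩ := Nat.exists_eq_add_of_le hm'
  rw [Nat.add_sub_cancel_left, pow_add]
  have : (-((m : A) * (c * α))) ^ k = c ^ k * (-((m : A) * α)) ^ k := by
    rw [← mul_pow]; ring
  rw [this]
  ring

theorem derivative_innerS (α : A) :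
    d⁄dX A (innerS α) = (1 - C α * X) * expS (-α) := by
  rw [innerS, Derivation.leibniz, derivative_X, derivative_expS, smul_eq_mul, smul_eq_mul, map_neg]
  ring

theorem derivative_subS (α : A) (P : PowerSeries A) :
    d⁄dX A (subS α P) = subS α (d⁄dX A P) * ((1 - C α * X) * expS (-α)) := by
  rw [subS, derivative_subst (hasSubst_innerS α), derivative_innerS]
  rfl

end

section

open PowerSeries

/-- A rational scalar in a `ℚ`-algebra. -/
noncomputable def rat (A : Type*) [CommRing A] [Algebra ℚ A] (q : ℚ) : A := algebraMap ℚ A q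

/-- The generating function `ê` with `ê(X e^{-αX}) = e^{X - αX²/2}`. -/
noncomputable def eS {A : Type*} [CommRing A] [Algebra ℚ A] (α : A) : PowerSeries A :=
  lagS α (expS 1 * expQ (-(rat A (1 / 2) * α)))

/-- The weighted generating function of trees. -/
noncomputable def treeS {A : Type*} [CommRing A] [Algebra ℚ A] (α : A) : PowerSeries A :=
  lagS α (X - C (rat A (1 / 2) * α) * X ^ 2)

variable {A : Type*} [CommRing A] [Algebra ℚ A]

theorem two_mul_rat_half : (2 : A) * rat A (1 / 2) = 1 := by
  have : (2 : A) = algebraMap ℚ A 2 := (map_ofNat _ 2).symm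
  rw [this, rat, ← map_mul]
  norm_num

theorem map_rat {B : Type*} [CommRing B] [Algebra ℚ B] (φ : A →+* B) (q : ℚ) :
    φ (rat A q) = rat B q :=
  RingHom.congr_fun (Subsingleton.elim (φ.comp (algebraMap ℚ A)) (algebraMap ℚ B)) _

theorem derivative_eS (α : A) : d⁄dX A (eS α) = d⁄dX A (treeS α) * eS α := by
  have hV : d⁄dX A (expS 1 * expQ (-(rat A (1 / 2) * α))) =
      (1 - C α * X) * (expS 1 * expQ (-(rat A (1 / 2) * α))) := by
    rw [Derivation.leibniz, derivative_expS, derivative_expQ, smul_eq_mul, smul_eq_mul]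
    have h2 : C (2 * -(rat A (1 / 2) * α)) = (-C α : PowerSeries A) := by
      rw [← map_neg]
      congr 1
      linear_combination (-α) * (two_mul_rat_half (A := A))
    rw [h2, map_one]
    ring
  have hT : d⁄dX A (X - C (rat A (1 / 2) * α) * X ^ 2) = (1 - C α * X : PowerSeries A) := by
    rw [map_sub, derivative_X, Derivation.leibniz, Derivation.leibniz_pow, derivative_X,
      derivative_C]
    simp only [smul_eq_mul, nsmul_eq_mul, mul_zero, add_zero, mul_one]
    have h2 : (C (rat A (1 / 2) * α) * 2 : PowerSeries A) = C α := by
      rw [← map_ofNat C 2, ← map_mul]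
      congr 1
      linear_combination α * (two_mul_rat_half (A := A))
    push_cast
    linear_combination (-X) * h2
  have h1 := derivative_subS α (eS α)
  rw [eS, subS_lagS, hV] at h1
  have h2 := derivative_subS α (treeS α)
  rw [treeS, subS_lagS, hT] at h2
  have h3 : expS 1 * expQ (-(rat A (1 / 2) * α)) = subS α (d⁄dX A (eS α)) * expS (-α) := by
    refine (isUnit_one_sub α).mul_left_cancel ?_
    rw [h1, eS]
    ring
  have h4 : 1 = subS α (d⁄dX A (treeS α)) * expS (-α) := by
    refine (isUnit_one_sub α).mul_left_cancel ?_
    rw [mul_one]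
    conv_lhs => rw [h2]
    rw [treeS]
    ring
  apply subS_injective α
  rw [subS_mul]
  conv_rhs => rw [eS, subS_lagS, h3]
  calc _ = subS α (d⁄dX A (eS α)) * 1 := (mul_one _).symm
    _ = _ := by rw [h4]; ring

theorem eS_two_mul_sq (α : A) : eS (2 * α) ^ 2 = rescale 2 (eS α) := by
  apply subS_injective (2 * α)
  rw [subS_rescale, eS, eS, subS_lagS, pow_two, subS_mul, subS_lagS, map_mul, rescale_expS,
    rescale_expQ, mul_mul_mul_comm, ← expS_add, ← expQ_add]
  congr 2
  · norm_num
  · ring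

theorem map_eS {B : Type*} [CommRing B] [Algebra ℚ B] (φ : A →+* B) (α : A) :
    map φ (eS α) = eS (φ α) := by
  rw [eS, map_lagS, map_mul, map_expS, map_expQ, map_neg, map_mul, map_rat, map_one]
  rfl

theorem constantCoeff_eS (α : A) : constantCoeff (eS α) = 1 := by
  rw [← coeff_zero_eq_constantCoeff_apply, eS, lagS, coeff_mk, coeff_zero_eq_constantCoeff_apply]
  simp [constantCoeff_expS, constantCoeff_expQ]

/-- The coefficients of the tree series, as given by Cayley's formula. -/
theorem coeff_treeS (α : A) (n : ℕ) :
    coeff (n + 1) (treeS α) =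
      α ^ n * rat A (((n + 1 : ℕ) : ℚ) ^ ((n : ℤ) - 1) / (n + 1).factorial) := by
  have hc : ∀ m : ℕ, (m : A) = rat A m := fun m => by simp [rat]
  have hm : ∀ p q : ℚ, rat A p * rat A q = rat A (p * q) := fun p q => (map_mul _ _ _).symm
  have hp : ∀ (p : ℚ) (k : ℕ), rat A p ^ k = rat A (p ^ k) := fun p q => (map_pow _ _ _).symm
  have key : ∀ Z : PowerSeries A, (1 - C α * X) * Z * (X - C (rat A (1 / 2) * α) * X ^ 2) =
      Z * X - C (rat A (3 / 2) * α) * (Z * X ^ 2) + C (rat A (1 / 2) * α ^ 2) * (Z * X ^ 3) := by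
    intro Z
    have h32 : rat A (3 / 2) = 1 + rat A (1 / 2) := by
      rw [← map_one (algebraMap ℚ A)]
      change _ = rat A 1 + _
      rw [rat, rat, rat, ← map_add]
      norm_num
    rw [h32]
    simp only [map_mul, map_add, map_pow, map_one]
    ring
  rw [treeS, lagS, coeff_mk, key, map_add, map_sub, coeff_C_mul, coeff_C_mul,
    coeff_succ_mul_X, coeff_mul_X_pow', coeff_mul_X_pow']
  simp only [coeff_expS]
  rcases n with _ | _ | n
  · simp [rat]
  · norm_num
    have h32 : rat A (3 / 2) = 1 + rat A (1 / 2) := by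
      rw [← map_one (algebraMap ℚ A), rat, rat, ← map_add]
      norm_num
    linear_combination (-α) * h32 - α * (two_mul_rat_half (A := A))
  · rw [if_pos (by omega), if_pos (by omega)]
    simp only [show n + 1 + 1 + 1 - 2 = n + 1 by omega, show n + 1 + 1 + 1 - 3 = n by omega]
    have h0 : ∀ q, algebraMap ℚ A q = rat A q := fun q => rfl
    have hs : ∀ (p q r s : ℚ), p - q + r = s → rat A p - rat A q + rat A r = rat A s := by
      intro p q r s h
      rw [rat, rat, rat, ← map_sub, ← map_add, h]; rfl
    have hz : ((n + 1 + 1 : ℕ) : ℤ) - 1 = ((n + 1 : ℕ) : ℤ) := by push_cast; ring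
    rw [hz, zpow_natCast]
    simp only [mul_pow, hc, h0, hp]
    set x : ℚ := ((n + 1 + 1 + 1 : ℕ) : ℚ) with hx
    have e := hs (x ^ (n + 1 + 1) * (1 / (n + 1 + 1).factorial))
      (3 / 2 * (x ^ (n + 1) * (1 / (n + 1).factorial))) (1 / 2 * (x ^ n * (1 / n.factorial)))
      (x ^ (n + 1) / (n + 1 + 1 + 1).factorial) (by
        have hx1 : ((n + 1 + 1 + 1).factorial : ℚ) = x * (n + 2) * (n + 1) * n.factorial := by
          rw [hx]; push_cast [Nat.factorial_succ]; ring
        have hx2 : ((n + 1 + 1).factorial : ℚ) = (n + 2) * (n + 1) * n.factorial := by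
          push_cast [Nat.factorial_succ]; ring
        have hx3 : ((n + 1).factorial : ℚ) = (n + 1) * n.factorial := by
          push_cast [Nat.factorial_succ]; ring
        rw [hx1, hx2, hx3]
        have := Nat.factorial_ne_zero n
        have h1 : x = n + 3 := by rw [hx]; push_cast; ring
        have h2 : x ≠ 0 := by rw [h1]; positivity
        field_simp
        rw [h1]
        ring)
    rw [← e, ← hm (x ^ (n + 1 + 1)), ← hm (3 / 2), ← hm (x ^ (n + 1)), ← hm (1 / 2),
      ← hm (x ^ n)]
    ring

/-- Positivity of the solution of `H' = G H`. -/
theorem coeff_mem_of_derivative_eq (S : Subsemiring A) (hS : ∀ q : ℚ, 0 ≤ q → rat A q ∈ S)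
    (G H : PowerSeries A) (h : d⁄dX A H = G * H) (h0 : constantCoeff H ∈ S)
    (hG : ∀ n, coeff n G ∈ S) (n : ℕ) : coeff n H ∈ S := by
  induction n using Nat.strong_induction_on with
  | _ n ih =>
    rcases n with _ | n
    · simpa using h0
    · have h1 := congrArg (coeff n) h
      rw [coeff_derivative, coeff_mul] at h1
      have h2 : coeff (n + 1) H = rat A (1 / ((n : ℚ) + 1)) *
          ∑ p ∈ Finset.HasAntidiagonal.antidiagonal n, coeff p.1 G * coeff p.2 H := by
        rw [← h1]
        have : ((n : A) + 1) = rat A (n + 1) := by simp [rat]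
        rw [this, mul_left_comm, rat, rat, ← map_mul]
        have : (1 / ((n : ℚ) + 1)) * (n + 1) = 1 := by field_simp
        rw [this, map_one, mul_one]
      rw [h2]
      refine S.mul_mem (hS _ (by positivity)) (S.sum_mem fun p hp => S.mul_mem (hG _) (ih _ ?_))
      have := Finset.HasAntidiagonal.mem_antidiagonal.1 hp
      omega

/-- Exponential generating functions. -/
noncomputable def egf (u : ℕ → A) : PowerSeries A := mk fun n => rat A (1 / n.factorial) * u n

theorem coeff_egf (u : ℕ → A) (n : ℕ) : coeff n (egf u) = rat A (1 / n.factorial) * u n :=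
  coeff_mk _ _

theorem coeff_egf_mul (u v : ℕ → A) (n : ℕ) : coeff n (egf u * egf v) =
    rat A (1 / n.factorial) *
      ∑ k ∈ Finset.range (n + 1), (n.choose k : A) * (u k * v (n - k)) := by
  rw [coeff_mul, Finset.Nat.sum_antidiagonal_eq_sum_range_succ
    (fun i j => coeff i (egf u) * coeff j (egf v)), Finset.mul_sum]
  refine Finset.sum_congr rfl fun k hk => ?_
  have hk' : k ≤ n := by have := Finset.mem_range.1 hk; omega
  rw [coeff_egf, coeff_egf]
  have : rat A (1 / n.factorial) * (n.choose k : A) =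
      rat A (1 / k.factorial) * rat A (1 / (n - k).factorial) := by
    have h1 : (n.choose k : A) = rat A (n.choose k) := by simp [rat]
    rw [h1, rat, rat, rat, rat, ← map_mul, ← map_mul, Nat.cast_choose ℚ hk']
    congr 1
    have := Nat.factorial_ne_zero n
    field_simp
  linear_combination (-(u k * v (n - k))) * this

theorem egf_bipW_sq (w : A) : egf (bipW w) ^ 2 =
    mk fun n => ∑ p ∈ Finset.HasAntidiagonal.antidiagonal n,
      rat A (1 / p.1.factorial) * rat A (1 / p.2.factorial) * (w + 1) ^ (p.1 * p.2) := by
  ext n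
  have h := coeff_egf_mul (bipW w) (bipW w) n
  have h' := coeff_egf_mul (fun _ => (1 : A)) (fun _ => 1) n
  rw [pow_two, h, bipW_sq, coeff_mk, Finset.mul_sum,
    Finset.Nat.sum_antidiagonal_eq_sum_range_succ (fun i j => 
      rat A (1 / i.factorial) * rat A (1 / j.factorial) * (w + 1) ^ (i * j))]
  refine Finset.sum_congr rfl fun k hk => ?_
  have hk' : k ≤ n := by have := Finset.mem_range.1 hk; omega
  rw [← mul_assoc]
  congr 1
  have h1 : (n.choose k : A) = rat A (n.choose k) := by simp [rat]
  rw [h1, rat, rat, rat, rat, ← map_mul, ← map_mul, Nat.cast_choose ℚ hk']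
  congr 1
  have := Nat.factorial_ne_zero n
  field_simp

theorem derivative_egf (u : ℕ → A) : d⁄dX A (egf u) = egf fun n => u (n + 1) := by
  ext n
  rw [coeff_derivative, coeff_egf, coeff_egf]
  have : ((n : A) + 1) = rat A (n + 1) := by simp [rat]
  rw [this, mul_right_comm, rat, rat, ← map_mul]
  congr 2
  rw [Nat.factorial_succ]
  have := Nat.factorial_ne_zero n
  push_cast
  field_simp

theorem derivative_egf_bipW (w : A) :
    d⁄dX A (egf (bipW w)) = d⁄dX A (egf (conW w)) * egf (bipW w) := by
  rw [derivative_egf, derivative_egf]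
  ext n
  rw [coeff_egf_mul, coeff_egf, bipW_succ]

/-- Exchange of the two variables of a bivariate power series. -/
noncomputable def swapS (P : PowerSeries (PowerSeries ℝ)) : PowerSeries (PowerSeries ℝ) :=
  mk fun s => mk fun m => coeff s (coeff m P)

theorem coeff_swapS (P : PowerSeries (PowerSeries ℝ)) (m s : ℕ) :
    coeff m (coeff s (swapS P)) = coeff s (coeff m P) := by
  rw [swapS, coeff_mk, coeff_mk]

theorem swapS_swapS (P : PowerSeries (PowerSeries ℝ)) : swapS (swapS P) = P := by
  ext s m
  rw [coeff_swapS, coeff_swapS]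

theorem swapS_mul (P Q : PowerSeries (PowerSeries ℝ)) :
    swapS (P * Q) = swapS P * swapS Q := by
  ext s m
  rw [coeff_swapS, coeff_mul, coeff_mul, map_sum, map_sum]
  simp_rw [coeff_mul]
  rw [Finset.sum_comm]
  simp_rw [coeff_swapS]

theorem rat_eq_C (q : ℚ) : rat (PowerSeries ℝ) q = C (q : ℝ) := by
  rw [rat, PowerSeries.algebraMap_apply]; simp

theorem coeff_expS' (c : PowerSeries ℝ) (n : ℕ) :
    coeff n (expS c) = c ^ n * C (1 / (n.factorial : ℝ)) := by
  rw [coeff_expS]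
  change _ * rat _ _ = _
  rw [rat_eq_C]
  simp

theorem coeff_expS_real (c : ℝ) (n : ℕ) :
    coeff n (expS c) = c ^ n * (1 / (n.factorial : ℝ)) := by
  rw [coeff_expS]
  simp

theorem swapS_C_expS (c : ℝ) : swapS (C (expS c)) = expS (C c) := by
  ext s m
  rw [coeff_swapS, coeff_expS', coeff_C, ← map_pow, ← map_mul, coeff_C]
  split_ifs
  · rw [coeff_expS_real]
  · simp

theorem swapS_C_C (c : ℝ) : swapS (C (C c)) = C (C c) := by
  ext s m
  rw [coeff_swapS, coeff_C, coeff_C]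
  split_ifs <;> simp [coeff_C, *]

theorem swapS_expS_C (c : ℝ) : swapS (expS (C c)) = C (expS c) := by
  rw [← swapS_C_expS, swapS_swapS]

theorem swapS_expS_mul_X (c : ℝ) : swapS (expS (C c * X)) = expS (C c * X) := by
  ext s m
  rw [coeff_swapS, coeff_expS', coeff_expS', mul_pow, mul_pow, ← map_pow, ← map_pow,
    mul_assoc, mul_assoc, mul_comm (X ^ m), mul_comm (X ^ s), coeff_C_mul, coeff_C_mul,
    coeff_C_mul, coeff_C_mul, coeff_X_pow, coeff_X_pow]
  by_cases h : s = m
  · rw [h]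
  · rw [if_neg h, if_neg (Ne.symm h)]; simp

theorem swapS_expQ_X : swapS (expQ X) = expS (X ^ 2) := by
  ext s m
  rw [coeff_swapS, coeff_expS', coeff_expQ, ← pow_mul, mul_comm _ (C _), coeff_C_mul, coeff_X_pow]
  change coeff s (ite _ (_ * rat _ _) _) = _
  rw [rat_eq_C]
  split_ifs with h1 h2 h2
  · subst h2
    rw [Nat.mul_div_cancel_left _ two_pos, mul_comm, coeff_C_mul, coeff_X_pow, if_pos rfl]
    simp
  · obtain ⟨k, rfl⟩ := h1
    rw [Nat.mul_div_cancel_left _ two_pos, mul_comm, coeff_C_mul, coeff_X_pow, if_neg]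
    · simp
    · rintro rfl; exact h2 rfl
  · exact absurd ⟨s, h2⟩ h1
  · simp

theorem swapS_X_pow (m : ℕ) : swapS (X ^ m) = C (X ^ m) := by
  ext s k
  rw [coeff_swapS, coeff_X_pow, coeff_C]
  split_ifs with h1 h2 h2
  · simp [h1, h2]
  · simp [coeff_one, h2]
  · rw [coeff_X_pow, if_neg h1]; simp
  · simp

/-- `τ^j (j-τ)^s / j!`. -/
noncomputable def touchTerm (s j : ℕ) : PowerSeries ℝ :=
  C (1 / (j.factorial : ℝ)) * (X ^ j * (C (j : ℝ) - X) ^ s)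

/-- `Σ_j τ^j (j-τ)^s / j!`. -/
noncomputable def touchSum (s : ℕ) : PowerSeries ℝ :=
  mk fun N => ∑ j ∈ Finset.range (N + 1), coeff N (touchTerm s j)

theorem coeff_touchTerm_eq_zero (s j N : ℕ) (h : N < j) : coeff N (touchTerm s j) = 0 := by
  rw [touchTerm, coeff_C_mul, coeff_X_pow_mul', if_neg (by omega), mul_zero]

theorem coeff_touchSum (s N M : ℕ) (h : N ≤ M) :
    coeff N (touchSum s) = ∑ j ∈ Finset.range (M + 1), coeff N (touchTerm s j) := by
  rw [touchSum, coeff_mk]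
  refine Finset.sum_subset (Finset.range_mono (by omega)) fun j _ hj => ?_
  exact coeff_touchTerm_eq_zero s j N (by simpa using hj)

theorem coeff_touchSum_sq (s N : ℕ) : coeff N (touchSum s ^ 2) =
    ∑ m ∈ Finset.range (N + 1), ∑ p ∈ Finset.HasAntidiagonal.antidiagonal m,
      coeff N (touchTerm s p.1 * touchTerm s p.2) := by
  have h0 : ∀ j k, N < j + k → coeff N (touchTerm s j * touchTerm s k) = 0 := by
    intro j k h
    rw [touchTerm, touchTerm, show C (1 / (j.factorial : ℝ)) * (X ^ j * (C (j : ℝ) - X) ^ s) *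
      (C (1 / (k.factorial : ℝ)) * (X ^ k * (C (k : ℝ) - X) ^ s)) = X ^ (j + k) *
      (C (1 / (j.factorial : ℝ)) * (C (j : ℝ) - X) ^ s *
      (C (1 / (k.factorial : ℝ)) * (C (k : ℝ) - X) ^ s)) by ring, coeff_X_pow_mul',
      if_neg (by omega)]
  have h1 : coeff N (touchSum s ^ 2) = ∑ j ∈ Finset.range (N + 1), ∑ k ∈ Finset.range (N + 1),
      coeff N (touchTerm s j * touchTerm s k) := by
    rw [pow_two, coeff_mul]
    simp_rw [coeff_mul]
    have : ∀ p ∈ Finset.HasAntidiagonal.antidiagonal N,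
        coeff p.1 (touchSum s) * coeff p.2 (touchSum s) =
        ∑ j ∈ Finset.range (N + 1), ∑ k ∈ Finset.range (N + 1),
          coeff p.1 (touchTerm s j) * coeff p.2 (touchTerm s k) := by
      intro p hp
      have hp' := Finset.HasAntidiagonal.mem_antidiagonal.1 hp
      rw [coeff_touchSum s p.1 N (by omega), coeff_touchSum s p.2 N (by omega),
        Finset.sum_mul_sum]
    rw [Finset.sum_congr rfl this, Finset.sum_comm]
    refine Finset.sum_congr rfl fun j _ => ?_
    rw [Finset.sum_comm]
  rw [h1, Finset.sum_sigma', Finset.sum_sigma']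
  symm
  refine Finset.sum_of_injOn (fun x => ⟨x.2.1, x.2.2⟩) ?_ ?_ ?_ ?_
  · rintro ⟨m, p⟩ h ⟨m', p'⟩ h' heq
    replace h := Finset.mem_sigma.1 (Finset.mem_coe.1 h)
    replace h' := Finset.mem_sigma.1 (Finset.mem_coe.1 h')
    have e1 := Finset.HasAntidiagonal.mem_antidiagonal.1 h.2
    have e2 := Finset.HasAntidiagonal.mem_antidiagonal.1 h'.2
    simp only [Sigma.mk.injEq, heq_eq_eq] at heq
    obtain rfl : p = p' := Prod.ext heq.1 heq.2
    simp only at e1 e2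
    obtain rfl : m = m' := by omega
    rfl
  · rintro ⟨m, p⟩ h
    replace h := Finset.mem_sigma.1 (Finset.mem_coe.1 h)
    simp only [Finset.mem_range] at h
    refine Finset.mem_coe.2 (Finset.mem_sigma.2 ?_)
    simp only [Finset.mem_range]
    have e1 := Finset.HasAntidiagonal.mem_antidiagonal.1 h.2
    omega
  · rintro ⟨j, k⟩ h hn
    simp only [Set.mem_image, not_exists, not_and] at hn
    refine h0 j k ?_
    by_contra hc
    refine hn ⟨j + k, (j, k)⟩ ?_ rfl
    refine Finset.mem_coe.2 (Finset.mem_sigma.2 ?_)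
    simp only [Finset.mem_range]
    exact ⟨by omega, Finset.HasAntidiagonal.mem_antidiagonal.2 rfl⟩
  · rintro ⟨m, p⟩ h
    rfl

/-- The generating function of all 2-colored graphs, weighted by `e^a - 1` per edge. -/
noncomputable def biS : PowerSeries (PowerSeries ℝ) := egf (bipW (expS 1 - 1))

theorem coeff_swapS_biS (s : ℕ) :
    coeff s (swapS (expQ X * subS X (biS ^ 2))) =
      C (1 / (s.factorial : ℝ)) * touchSum s ^ 2 := by
  ext N
  rw [coeff_swapS, coeff_mul_subS, coeff_C_mul, coeff_touchSum_sq, map_sum, Finset.mul_sum]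
  refine Finset.sum_congr rfl fun m hm => ?_
  rw [biS, egf_bipW_sq, coeff_mk, Finset.sum_mul, map_sum, Finset.mul_sum]
  refine Finset.sum_congr rfl fun p hp => ?_
  have hp' := Finset.HasAntidiagonal.mem_antidiagonal.1 hp
  rw [sub_add_cancel, expS_pow, mul_one, ← coeff_C_mul, ← coeff_swapS, map_mul, map_mul]
  have e1 : -((m : PowerSeries ℝ) * X) = C (-(m : ℝ)) * X := by
    rw [map_neg, map_natCast, neg_mul]
  have e2 : (((p.1 * p.2 : ℕ) : ℝ)) = (p.1 : ℝ) * p.2 := by push_cast; rfl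
  rw [rat_eq_C, rat_eq_C, swapS_mul, swapS_mul, swapS_mul, swapS_C_C, swapS_C_C, swapS_C_expS, 
    swapS_mul, swapS_mul, swapS_expQ_X, swapS_X_pow, e1, swapS_expS_mul_X]
  have e3 : ∀ u v : PowerSeries ℝ, C u * C v * expS (C ((p.1 * p.2 : ℕ) : ℝ)) *
      (expS (X ^ 2) * (C (X ^ m) * expS (C (-(m : ℝ)) * X))) =
      C (u * v * X ^ m) * expS ((C (p.1 : ℝ) - X) * (C (p.2 : ℝ) - X)) := by
    intro u v
    have : (C (p.1 : ℝ) - X) * (C (p.2 : ℝ) - X) =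
        C ((p.1 * p.2 : ℕ) : ℝ) + (X ^ 2 + C (-(m : ℝ)) * X) := by
      rw [← hp']
      push_cast
      simp only [map_mul, map_neg, map_add]
      ring
    rw [this, expS_add, expS_add, map_mul, map_mul]
    ring
  rw [e3, coeff_C_mul, coeff_expS', ← coeff_C_mul, touchTerm, touchTerm]
  congr 1
  rw [← hp', mul_pow, pow_add]
  push_cast
  ring

/-- `[z^s] (e^z - 1 - z)^N / N!`. -/
noncomputable def phiC (N s : ℕ) : ℝ :=
  coeff s (coeff N (expS (expS (1 : ℝ) - 1 - X)))

theorem coeff_C_sub_X_pow (c : ℝ) (i s : ℕ) :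
    coeff i ((C c - X : PowerSeries ℝ) ^ s) = s.factorial * coeff s (expS c * ((-X) ^ i * C (1 / (i.factorial : ℝ)))) := by
  have e : ((C c - X : PowerSeries ℝ) ^ s) =
      C ((s.factorial : ℝ)) * coeff s (expS (C c - X)) := by
    rw [coeff_expS', mul_left_comm, ← map_mul]
    have := Nat.factorial_ne_zero s
    field_simp
    simp
  have e2 : coeff i (coeff s (expS (C c - X))) =
      coeff s (expS c * ((-X) ^ i * C (1 / (i.factorial : ℝ)))) := by
    rw [sub_eq_add_neg, ← coeff_swapS, expS_add, swapS_mul, swapS_expS_C]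
    have : (-X : PowerSeries ℝ) = C (-1) * X := by simp
    rw [this, swapS_expS_mul_X, ← coeff_expS', coeff_C_mul]
  rw [e, coeff_C_mul, e2]

theorem coeff_expS_neg_one_mul_touchSum (s N : ℕ) :
    coeff N (expS (-1) * touchSum s) = s.factorial * phiC N s := by
  have h1 : ∀ m, coeff m (touchSum s) =
      s.factorial * coeff s (coeff m (expS (expS (1 : ℝ) + -X))) := by
    intro m
    rw [touchSum, coeff_mk, expS_add, coeff_mul, Finset.Nat.sum_antidiagonal_eq_sum_range_succ
      (fun i j => coeff i (expS (expS (1 : ℝ))) * coeff j (expS (-X))), map_sum, Finset.mul_sum]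
    refine Finset.sum_congr rfl fun j hj => ?_
    have hj' : j ≤ m := by have := Finset.mem_range.1 hj; omega
    rw [touchTerm, coeff_C_mul, coeff_X_pow_mul', if_pos hj', coeff_C_sub_X_pow, coeff_expS',
      coeff_expS', expS_pow, mul_one]
    rw [mul_right_comm, ← mul_assoc, mul_comm _ (C (1 / (j.factorial : ℝ))), coeff_C_mul]
    ring
  have h2 : (expS (1 : ℝ) - 1 - X) = C (-1) + (expS 1 + -X) := by simp; ring
  rw [phiC, h2, expS_add, coeff_mul, coeff_mul, map_sum, Finset.mul_sum]
  refine Finset.sum_congr rfl fun p _ => ?_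
  rw [h1, coeff_expS' (C (-1)), ← map_pow, ← map_mul, coeff_C_mul, coeff_expS_real]
  ring

theorem coeff_coeff_subS_biS (s N : ℕ) :
    coeff s (coeff N (expS (-2) * (expQ X * subS X (biS ^ 2)))) =
      s.factorial * ∑ p ∈ Finset.HasAntidiagonal.antidiagonal N, phiC p.1 s * phiC p.2 s := by
  have h : (-2 : PowerSeries ℝ) = C (-1) + C (-1) := by
    simp only [map_neg, map_one]; norm_num
  rw [← coeff_swapS, swapS_mul, h, expS_add, swapS_mul, swapS_expS_C, ← map_mul, coeff_C_mul,
    coeff_swapS_biS]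
  have h2 : expS (-1) * expS (-1) * (C (1 / (s.factorial : ℝ)) * touchSum s ^ 2) =
    C (1 / (s.factorial : ℝ)) * ((expS (-1) * touchSum s) * (expS (-1) * touchSum s)) := by ring
  rw [h2, coeff_C_mul, coeff_mul, Finset.mul_sum, Finset.mul_sum]
  refine Finset.sum_congr rfl fun p _ => ?_
  rw [coeff_expS_neg_one_mul_touchSum, coeff_expS_neg_one_mul_touchSum]
  have := Nat.factorial_ne_zero s
  field_simp

theorem X_sq_dvd_expS_sub : (X : PowerSeries ℝ) ^ 2 ∣ expS 1 - 1 - X := by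
  rw [X_pow_dvd_iff]
  intro m hm
  rw [map_sub, map_sub, coeff_expS_real]
  interval_cases m <;> simp [coeff_one, coeff_X]

theorem phiC_eq_zero (N s : ℕ) (h : s < 2 * N) : phiC N s = 0 := by
  rw [phiC, coeff_expS', mul_comm, coeff_C_mul]
  have : (X : PowerSeries ℝ) ^ (2 * N) ∣ (expS 1 - 1 - X) ^ N := by
    rw [pow_mul]; exact pow_dvd_pow_of_dvd X_sq_dvd_expS_sub N
  rw [X_pow_dvd_iff.1 this s h, mul_zero]

/-- The coefficient `[t^N] Ê_r`. -/
noncomputable def ehC (r N : ℕ) : ℝ :=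
  (N + r).factorial *
    ∑ p ∈ Finset.HasAntidiagonal.antidiagonal N, phiC p.1 (N + r) * phiC p.2 (N + r)

/-- The series `Ê = Σ_r a^r Ê_r(t)`. -/
noncomputable def ehS : PowerSeries (PowerSeries ℝ) := mk fun N => mk fun r => ehC r N

theorem subS_biS_sq : subS X (biS ^ 2) = expS 2 * expQ (-X) * rescale X ehS := by
  have h : expS (-2) * (expQ X * subS X (biS ^ 2)) = rescale (X : PowerSeries ℝ) ehS := by
    ext N s
    rw [coeff_coeff_subS_biS, coeff_rescale, coeff_X_pow_mul']
    split_ifs with hs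
    · obtain ⟨r, rfl⟩ := Nat.exists_eq_add_of_le hs
      rw [Nat.add_sub_cancel_left, ehS, coeff_mk, coeff_mk, ehC]
    · rw [Finset.sum_eq_zero, mul_zero]
      intro p hp
      have hp' := Finset.HasAntidiagonal.mem_antidiagonal.1 hp
      by_cases h1 : s < 2 * p.1
      · rw [phiC_eq_zero _ _ h1, zero_mul]
      · rw [phiC_eq_zero p.2 s (by omega), mul_zero]
  rw [← h, show expS 2 * expQ (-X) * (expS (-2) * (expQ X * subS X (biS ^ 2))) =
    (expS 2 * expS (-2)) * (expQ (-X) * expQ X) * subS X (biS ^ 2) by ring, ← expS_add,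
    ← expQ_add, add_neg_cancel, neg_add_cancel, expS_zero, expQ_zero, one_mul, one_mul]

theorem sum_antidiagonal_quad (g : ℕ → ℕ → ℕ → ℕ → ℝ) (N : ℕ) :
    (∑ u ∈ Finset.HasAntidiagonal.antidiagonal N, ∑ x ∈ Finset.HasAntidiagonal.antidiagonal u.1,
      ∑ y ∈ Finset.HasAntidiagonal.antidiagonal u.2, g x.1 x.2 y.1 y.2) =
    ∑ u ∈ Finset.HasAntidiagonal.antidiagonal N, ∑ x ∈ Finset.HasAntidiagonal.antidiagonal u.1,
      ∑ y ∈ Finset.HasAntidiagonal.antidiagonal u.2, g y.1 x.1 y.2 x.2 := by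
  simp_rw [← Finset.sum_product' (f := fun x y => g (Prod.fst x) (Prod.snd x) (Prod.fst y) (Prod.snd y)),
    ← Finset.sum_product' (f := fun x y => g (Prod.fst y) (Prod.fst x) (Prod.snd y) (Prod.snd x))]
  rw [Finset.sum_sigma', Finset.sum_sigma']
  refine Finset.sum_nbij'
    (fun z => ⟨(z.2.1.2 + z.2.2.2, z.2.1.1 + z.2.2.1), ((z.2.1.2, z.2.2.2), (z.2.1.1, z.2.2.1))⟩)
    (fun z => ⟨(z.2.2.1 + z.2.1.1, z.2.2.2 + z.2.1.2), ((z.2.2.1, z.2.1.1), (z.2.2.2, z.2.1.2))⟩)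
    ?_ ?_ ?_ ?_ ?_
  · rintro ⟨⟨a, b⟩, ⟨⟨c, d⟩, ⟨e, f⟩⟩⟩ h
    obtain ⟨h1, h2⟩ := Finset.mem_sigma.1 h
    obtain ⟨h2, h3⟩ := Finset.mem_product.1 h2
    rw [Finset.HasAntidiagonal.mem_antidiagonal] at h1 h2 h3
    simp only at h1 h2 h3
    refine Finset.mem_sigma.2 ⟨Finset.HasAntidiagonal.mem_antidiagonal.2 ?_,
      Finset.mem_product.2 ⟨Finset.HasAntidiagonal.mem_antidiagonal.2 rfl,
        Finset.HasAntidiagonal.mem_antidiagonal.2 rfl⟩⟩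
    simp only
    omega
  · rintro ⟨⟨a, b⟩, ⟨⟨c, d⟩, ⟨e, f⟩⟩⟩ h
    obtain ⟨h1, h2⟩ := Finset.mem_sigma.1 h
    obtain ⟨h2, h3⟩ := Finset.mem_product.1 h2
    rw [Finset.HasAntidiagonal.mem_antidiagonal] at h1 h2 h3
    simp only at h1 h2 h3
    refine Finset.mem_sigma.2 ⟨Finset.HasAntidiagonal.mem_antidiagonal.2 ?_,
      Finset.mem_product.2 ⟨Finset.HasAntidiagonal.mem_antidiagonal.2 rfl,
        Finset.HasAntidiagonal.mem_antidiagonal.2 rfl⟩⟩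
    simp only
    omega
  · rintro ⟨⟨a, b⟩, ⟨⟨c, d⟩, ⟨e, f⟩⟩⟩ h
    obtain ⟨h1, h2⟩ := Finset.mem_sigma.1 h
    obtain ⟨h2, h3⟩ := Finset.mem_product.1 h2
    rw [Finset.HasAntidiagonal.mem_antidiagonal] at h1 h2 h3
    simp only at h2 h3
    subst h2 h3
    rfl
  · rintro ⟨⟨a, b⟩, ⟨⟨c, d⟩, ⟨e, f⟩⟩⟩ h
    obtain ⟨h1, h2⟩ := Finset.mem_sigma.1 h
    obtain ⟨h2, h3⟩ := Finset.mem_product.1 h2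
    rw [Finset.HasAntidiagonal.mem_antidiagonal] at h1 h2 h3
    simp only at h2 h3
    subst h2 h3
    rfl
  · rintro ⟨⟨a, b⟩, ⟨⟨c, d⟩, ⟨e, f⟩⟩⟩ h
    rfl

/-- `e^z - 1 - z - z²/2`. -/
noncomputable def expTail : PowerSeries ℝ := expS 1 - 1 - X - C (1 / 2) * X ^ 2

/-- `[z^d] (e^z - 1 - z - z²/2)^k / k!`. -/
noncomputable def yC (d k : ℕ) : ℝ := coeff d (expTail ^ k * C (1 / (k.factorial : ℝ)))

theorem phiC_eq (N s : ℕ) : phiC N s = ∑ x ∈ Finset.HasAntidiagonal.antidiagonal N,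
    1 / (2 ^ x.1 * x.1.factorial) * (if 2 * x.1 ≤ s then yC (s - 2 * x.1) x.2 else 0) := by
  have h : expS (1 : ℝ) - 1 - X = C (1 / 2) * X ^ 2 + expTail := by rw [expTail]; ring
  rw [phiC, h, expS_add, coeff_mul, map_sum]
  refine Finset.sum_congr rfl fun x _ => ?_
  rw [coeff_expS', coeff_expS']
  have : (C (1 / 2) * X ^ 2 : PowerSeries ℝ) ^ x.1 * C (1 / (x.1.factorial : ℝ)) *
      (expTail ^ x.2 * C (1 / (x.2.factorial : ℝ))) =
      C (1 / ((2 : ℝ) ^ x.1 * (x.1.factorial : ℝ))) *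
        (X ^ (2 * x.1) * (expTail ^ x.2 * C (1 / (x.2.factorial : ℝ)))) := by
    rw [mul_pow, ← map_pow, ← pow_mul, one_div (2 ^ x.1 * _), mul_inv, map_mul]
    simp only [one_div, inv_pow]
    ring
  rw [this, coeff_C_mul, coeff_X_pow_mul']
  rfl

/-- `6 Σ_m X^m / (m+3)!`. -/
noncomputable def expTailQuot : PowerSeries ℝ := mk fun m => 6 / ((m + 3).factorial : ℝ)

theorem expTail_eq : expTail = C (1 / 6) * (X ^ 3 * expTailQuot) := by
  ext n
  rw [expTail, map_sub, map_sub, map_sub, coeff_expS_real, coeff_C_mul, coeff_C_mul,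
    coeff_X_pow_mul', coeff_X_pow, coeff_one, coeff_X]
  rcases n with _ | _ | _ | n
  · simp
  · simp
  · simp [Nat.factorial]
  · rw [expTailQuot, coeff_mk, if_pos (by omega : 3 ≤ n + 1 + 1 + 1),
      show n + 1 + 1 + 1 - 3 = n by omega]
    simp
    field_simp

theorem yC_eq (d k : ℕ) : yC d k =
    if 3 * k ≤ d then 1 / (6 ^ k * k.factorial) * coeff (d - 3 * k) (expTailQuot ^ k) else 0 := by
  have : expTail ^ k * C (1 / (k.factorial : ℝ)) =
      C (1 / ((6 : ℝ) ^ k * (k.factorial : ℝ))) * (X ^ (3 * k) * expTailQuot ^ k) := by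
    rw [expTail_eq, mul_pow, mul_pow, ← map_pow, ← pow_mul, one_div (6 ^ k * _), mul_inv, map_mul]
    simp only [one_div, inv_pow]
    ring
  rw [yC, this, coeff_C_mul, coeff_X_pow_mul']
  split_ifs <;> simp

theorem coeff_expTailQuot_pow (k j : ℕ) : 0 ≤ coeff j (expTailQuot ^ k) ∧
    coeff j (expTailQuot ^ k) ≤ (k : ℝ) ^ j / j.factorial := by
  have h : ∀ k j : ℕ, 0 ≤ coeff j (expTailQuot ^ k) ∧
      coeff j (expTailQuot ^ k) ≤ coeff j (expS (1 : ℝ) ^ k) := by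
    intro k
    induction k with
    | zero => intro j; simp only [pow_zero, le_refl, and_true, coeff_one]; split_ifs <;> simp
    | succ k ih =>
      intro j
      rw [pow_succ, pow_succ, coeff_mul, coeff_mul]
      have h1 : ∀ m, 0 ≤ coeff m expTailQuot ∧ coeff m expTailQuot ≤ coeff m (expS (1 : ℝ)) := by
        intro m
        rw [expTailQuot, coeff_mk, coeff_expS_real]
        refine ⟨by positivity, ?_⟩
        rw [one_pow, one_mul, div_le_div_iff₀ (by positivity) (by positivity), one_mul]
        have : 6 * m.factorial ≤ (m + 3).factorial := by
          rw [Nat.factorial_succ, Nat.factorial_succ, Nat.factorial_succ]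
          have : 6 ≤ (m + 3) * ((m + 2) * (m + 1)) := 
            Nat.mul_le_mul (by omega : 3 ≤ m + 3)
              (Nat.mul_le_mul (by omega : 2 ≤ m + 2) (by omega : 1 ≤ m + 1))
          nlinarith [Nat.factorial_pos m]
        exact_mod_cast this
      refine ⟨Finset.sum_nonneg fun p _ => mul_nonneg (ih _).1 (h1 _).1,
        Finset.sum_le_sum fun p _ => mul_le_mul (ih _).2 (h1 _).2 (h1 _).1
          ((ih _).1.trans (ih _).2)⟩
  refine ⟨(h k j).1, (h k j).2.trans ?_⟩
  rw [expS_pow, mul_one, coeff_expS_real, mul_one_div]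

theorem yC_nonneg (d k : ℕ) : 0 ≤ yC d k := by
  rw [yC_eq]
  split_ifs
  · exact mul_nonneg (by positivity) (coeff_expTailQuot_pow _ _).1
  · exact le_rfl

theorem yC_eq_zero {d k : ℕ} (h : d < 3 * k) : yC d k = 0 := by
  rw [yC_eq, if_neg (by omega)]

theorem yC_le (k j : ℕ) : yC (3 * k + j) k ≤ 1 / (6 ^ k * k.factorial) * ((k : ℝ) ^ j / j.factorial) := by
  rw [yC_eq, if_pos (by omega), Nat.add_sub_cancel_left]
  exact mul_le_mul_of_nonneg_left (coeff_expTailQuot_pow _ _).2 (by positivity)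

theorem sum_yC (K D : ℕ) : ∑ x ∈ Finset.HasAntidiagonal.antidiagonal K,
    ∑ d ∈ Finset.HasAntidiagonal.antidiagonal D, yC d.1 x.1 * yC d.2 x.2 = 2 ^ K * yC D K := by
  have h : ∀ x : ℕ × ℕ, ∑ d ∈ Finset.HasAntidiagonal.antidiagonal D, yC d.1 x.1 * yC d.2 x.2 =
      coeff D ((expTail ^ x.1 * C (1 / (x.1.factorial : ℝ))) *
        (expTail ^ x.2 * C (1 / (x.2.factorial : ℝ)))) := by
    intro x
    rw [coeff_mul]
    rfl
  simp_rw [h]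
  rw [← map_sum, yC, ← coeff_C_mul]
  congr 1
  simp_rw [← coeff_expS']
  rw [← coeff_mul, ← expS_add, coeff_expS', ← two_mul, mul_pow, mul_assoc, map_pow, map_ofNat,
    coeff_expS']

/-- The series `M_{d,d'}`. -/
noncomputable def mS (d d' : ℕ) : PowerSeries ℝ :=
  mk fun n => ∑ x ∈ Finset.HasAntidiagonal.antidiagonal n,
    if d + 2 * x.1 = d' + 2 * x.2 then
      ((d + 2 * x.1).factorial : ℝ) / (2 ^ n * x.1.factorial * x.2.factorial) else 0

theorem ehC_eq (r : ℕ) : (mk fun N => ehC r N : PowerSeries ℝ) =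
    ∑ K ∈ Finset.range (2 * r + 1), ∑ x ∈ Finset.HasAntidiagonal.antidiagonal K,
      ∑ d ∈ Finset.HasAntidiagonal.antidiagonal (2 * r + 2 * K),
        C (yC d.1 x.1 * yC d.2 x.2) * (X ^ K * mS d.1 d.2) := by
  ext N
  set F : ℕ → ℕ → ℝ := fun K n => ∑ x ∈ Finset.HasAntidiagonal.antidiagonal K,
      ∑ d ∈ Finset.HasAntidiagonal.antidiagonal (2 * r + 2 * K),
        yC d.1 x.1 * yC d.2 x.2 * coeff n (mS d.1 d.2) with hF
  have h1 : ∀ K, 2 * r < K → ∀ n, F K n = 0 := by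
    intro K hK n
    rw [hF]
    refine Finset.sum_eq_zero fun x hx => Finset.sum_eq_zero fun d hd => ?_
    have hx' := Finset.HasAntidiagonal.mem_antidiagonal.1 hx
    have hd' := Finset.HasAntidiagonal.mem_antidiagonal.1 hd
    by_cases h : d.1 < 3 * x.1
    · rw [yC_eq_zero h]; ring
    · rw [yC_eq_zero (by omega : d.2 < 3 * x.2)]; ring
  have h2 : ehC r N = ∑ u ∈ Finset.HasAntidiagonal.antidiagonal N, F u.1 u.2 := by
    rw [ehC]
    set s := N + r with hs
    simp_rw [phiC_eq, Finset.sum_mul_sum]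
    rw [sum_antidiagonal_quad (fun p k q l =>
      1 / (2 ^ p * (p.factorial : ℝ)) * (if 2 * p ≤ s then yC (s - 2 * p) k else 0) *
      (1 / (2 ^ q * (q.factorial : ℝ)) * (if 2 * q ≤ s then yC (s - 2 * q) l else 0))),
      Finset.mul_sum]
    refine Finset.sum_congr rfl fun u hu => ?_
    have hu' := Finset.HasAntidiagonal.mem_antidiagonal.1 hu
    rw [hF, Finset.mul_sum]
    refine Finset.sum_congr rfl fun x hx => ?_
    have hx' := Finset.HasAntidiagonal.mem_antidiagonal.1 hx
    simp only [mS, coeff_mk, Finset.mul_sum]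
    rw [Finset.sum_comm]
    refine Finset.sum_congr rfl fun y hy => ?_
    have hy' := Finset.HasAntidiagonal.mem_antidiagonal.1 hy
    by_cases hc : 2 * y.1 ≤ s ∧ 2 * y.2 ≤ s
    · rw [if_pos hc.1, if_pos hc.2, Finset.sum_eq_single (s - 2 * y.1, s - 2 * y.2)]
      · have e1 : s - 2 * y.1 + 2 * y.1 = s := Nat.sub_add_cancel hc.1
        have e2 : s - 2 * y.2 + 2 * y.2 = s := Nat.sub_add_cancel hc.2
        simp only [e1, e2, if_true]
        rw [← hy', pow_add]
        field_simp
      · rintro ⟨d, d'⟩ hd hne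
        have hd' := Finset.HasAntidiagonal.mem_antidiagonal.1 hd
        simp only at hd' ⊢
        rw [if_neg, mul_zero]
        intro h
        apply hne
        ext <;> simp only <;> omega
      · intro h
        exfalso
        apply h
        rw [Finset.HasAntidiagonal.mem_antidiagonal]
        simp only
        omega
    · rw [Finset.sum_eq_zero]
      · rw [not_and_or] at hc
        rcases hc with hc | hc <;> simp [hc]
      · rintro ⟨d, d'⟩ hd
        have hd' := Finset.HasAntidiagonal.mem_antidiagonal.1 hd
        simp only at hd' ⊢
        rw [if_neg, mul_zero]
        intro h
        apply hc
        omega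
  have h3 : ∀ K, coeff N (∑ x ∈ Finset.HasAntidiagonal.antidiagonal K,
      ∑ d ∈ Finset.HasAntidiagonal.antidiagonal (2 * r + 2 * K),
        C (yC d.1 x.1 * yC d.2 x.2) * (X ^ K * mS d.1 d.2)) =
      if K ≤ N then F K (N - K) else 0 := by
    intro K
    rw [map_sum]
    simp_rw [map_sum, coeff_C_mul, coeff_X_pow_mul']
    split_ifs
    · rfl
    · simp
  rw [coeff_mk, h2, map_sum, Finset.sum_congr rfl fun K _ => h3 K,
    Finset.Nat.sum_antidiagonal_eq_sum_range_succ F]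
  have h4 : ∑ K ∈ Finset.range (2 * r + 1), (if K ≤ N then F K (N - K) else 0) =
      ∑ K ∈ Finset.range (N + 2 * r + 1), (if K ≤ N then F K (N - K) else 0) := by
    refine Finset.sum_subset (Finset.range_mono (by omega)) fun K _ hK => ?_
    rw [h1 K (by simpa using hK)]
    simp
  have h5 : ∑ K ∈ Finset.range (N + 1), (if K ≤ N then F K (N - K) else 0) =
      ∑ K ∈ Finset.range (N + 2 * r + 1), (if K ≤ N then F K (N - K) else 0) := by
    refine Finset.sum_subset (Finset.range_mono (by omega)) fun K _ hK => ?_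
    rw [if_neg]
    simpa using hK
  rw [h4, ← h5]
  refine Finset.sum_congr rfl fun K hK => ?_
  rw [if_pos]
  have := Finset.mem_range.1 hK
  omega

theorem mS_comm (i j : ℕ) : mS i j = mS j i := by
  ext n
  rw [mS, mS, coeff_mk, coeff_mk, ← Finset.Nat.sum_antidiagonal_swap]
  refine Finset.sum_congr rfl fun x _ => ?_
  simp only [Prod.fst_swap, Prod.snd_swap]
  by_cases h : i + 2 * x.2 = j + 2 * x.1
  · rw [if_pos h, if_pos h.symm, h]; ring
  · rw [if_neg h, if_neg (Ne.symm h)]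

theorem mS_succ (i j : ℕ) :
    mS (i + 1) j = C (j : ℝ) * mS i (j - 1) + X * mS i (j + 1) := by
  ext n
  have h1 : coeff n (mS (i + 1) j) = coeff n (C (j : ℝ) * mS i (j - 1)) +
      ∑ x ∈ Finset.HasAntidiagonal.antidiagonal n, if i + 1 + 2 * x.1 = j + 2 * x.2 then
        (2 * x.2 * (i + 2 * x.1).factorial : ℝ) / (2 ^ n * x.1.factorial * x.2.factorial) else 0 := by
    rw [coeff_C_mul, mS, mS, coeff_mk, coeff_mk, Finset.mul_sum, ← Finset.sum_add_distrib]
    refine Finset.sum_congr rfl fun x _ => ?_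
    by_cases h : i + 1 + 2 * x.1 = j + 2 * x.2
    · have e : ((i + 1 + 2 * x.1).factorial : ℝ) = (j + 2 * x.2) * (i + 2 * x.1).factorial := by
        rw [show i + 1 + 2 * x.1 = i + 2 * x.1 + 1 by ring, Nat.factorial_succ,
          show i + 2 * x.1 + 1 = j + 2 * x.2 by omega]
        push_cast
        ring
      rw [if_pos h, if_pos h, e]
      rcases j with _ | j
      · simp
      · rw [if_pos (by omega)]
        ring
    · rw [if_neg h, if_neg h]
      rcases j with _ | j
      · simp
      · rw [if_neg (by omega)]
        simp
  rw [h1, map_add]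
  congr 1
  rcases n with _ | n
  · simp
  · rw [Finset.Nat.sum_antidiagonal_succ', coeff_succ_X_mul, mS, coeff_mk]
    simp only [Nat.cast_zero, mul_zero, zero_mul, zero_div, ite_self, zero_add, add_zero]
    refine Finset.sum_congr rfl fun x _ => ?_
    by_cases h : i + 2 * x.1 = j + 1 + 2 * x.2
    · rw [if_pos h, if_pos (by omega), Nat.factorial_succ, pow_succ]
      push_cast
      field_simp
    · rw [if_neg h, if_neg (by omega)]

theorem mS_succ_succ (i j : ℕ) : mS (i + 1) (j + 1) * (1 - X ^ 2) =
    C ((j : ℝ) + 1) * mS i j + C (i : ℝ) * (X * mS (i - 1) (j + 1)) := by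
  have h1 := mS_succ i (j + 1)
  have h2 := mS_succ (j + 1) i
  rw [mS_comm, mS_comm (j + 1), mS_comm (j + 1)] at h2
  simp only [Nat.add_sub_cancel, Nat.cast_add, Nat.cast_one] at h1
  rw [show j + 1 + 1 = j + 2 by ring] at h1 h2
  linear_combination h1 + X * h2

theorem exists_mPoly (h : ℕ) : ∀ i j : ℕ, i + j = 2 * h → ∃ m : Polynomial ℝ,
    (∀ k, 0 ≤ m.coeff k) ∧ m.eval 1 = ((2 * h - 1).doubleFactorial : ℝ) ∧
      mS i j * (1 - X ^ 2) ^ h = (m : PowerSeries ℝ) * mS 0 0 := by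
  induction h with
  | zero =>
    intro i j hij
    obtain ⟨rfl, rfl⟩ : i = 0 ∧ j = 0 := by omega
    exact ⟨1, fun k => by rw [Polynomial.coeff_one]; split_ifs <;> simp, by simp, by simp⟩
  | succ h ih =>
    have hdf : ((2 * (h + 1) - 1).doubleFactorial : ℝ) =
        (2 * h + 1) * ((2 * h - 1).doubleFactorial : ℝ) := by
      rcases h with _ | h
      · simp
      · rw [show 2 * (h + 1 + 1) - 1 = (2 * (h + 1) - 1) + 2 by omega, Nat.doubleFactorial_add_two]
        rw [show 2 * (h + 1) - 1 + 2 = 2 * (h + 1) + 1 by omega]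
        push_cast
        ring
    have key : ∀ i j : ℕ, i + 1 + (j + 1) = 2 * (h + 1) → ∃ m : Polynomial ℝ,
        (∀ k, 0 ≤ m.coeff k) ∧ m.eval 1 = ((2 * (h + 1) - 1).doubleFactorial : ℝ) ∧
          mS (i + 1) (j + 1) * (1 - X ^ 2) ^ (h + 1) = (m : PowerSeries ℝ) * mS 0 0 := by
      intro i j hij
      obtain ⟨m1, hm1, hm1', hm1''⟩ := ih i j (by omega)
      have hi : ((i : ℝ) + j) = 2 * h := by
        have : i + j = 2 * h := by omega
        exact_mod_cast this
      rcases i with _ | i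
      · refine ⟨Polynomial.C ((j : ℝ) + 1) * m1, fun k => ?_, ?_, ?_⟩
        · rw [Polynomial.coeff_C_mul]
          exact mul_nonneg (by positivity) (hm1 k)
        · rw [Polynomial.eval_mul, Polynomial.eval_C, hm1', hdf]
          congr 1
          push_cast at hi
          linarith
        · rw [pow_succ', ← mul_assoc, mS_succ_succ]
          rw [Polynomial.coe_mul, Polynomial.coe_C, mul_assoc, ← hm1'']
          simp
          ring
      · obtain ⟨m2, hm2, hm2', hm2''⟩ := ih i (j + 1) (by omega)
        refine ⟨Polynomial.C ((j : ℝ) + 1) * m1 + Polynomial.C ((i : ℝ) + 1) * (Polynomial.X * m2),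
          fun k => ?_, ?_, ?_⟩
        · rw [Polynomial.coeff_add, Polynomial.coeff_C_mul, Polynomial.coeff_C_mul]
          have : 0 ≤ (Polynomial.X * m2).coeff k := by
            rcases k with _ | k
            · simp
            · rw [Polynomial.coeff_X_mul]; exact hm2 k
          exact add_nonneg (mul_nonneg (by positivity) (hm1 k)) (mul_nonneg (by positivity) this)
        · simp only [Polynomial.eval_add, Polynomial.eval_mul, Polynomial.eval_C,
            Polynomial.eval_X, hm1', hm2', hdf]
          push_cast at hi
          linear_combination hi * ((2 * h - 1).doubleFactorial : ℝ)
        · rw [pow_succ', ← mul_assoc, mS_succ_succ]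
          simp only [Polynomial.coe_mul, Polynomial.coe_C, Polynomial.coe_add, Polynomial.coe_X,
            Nat.add_sub_cancel, Nat.cast_add, Nat.cast_one]
          linear_combination C ((j : ℝ) + 1) * hm1'' + C ((i : ℝ) + 1) * X * hm2''
    have edge : ∀ j : ℕ, j + 1 = 2 * (h + 1) → ∃ m : Polynomial ℝ,
        (∀ k, 0 ≤ m.coeff k) ∧ m.eval 1 = ((2 * (h + 1) - 1).doubleFactorial : ℝ) ∧
          mS (j + 1) 0 * (1 - X ^ 2) ^ (h + 1) = (m : PowerSeries ℝ) * mS 0 0 := by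
      intro j hj
      obtain ⟨j, rfl⟩ : ∃ j', j = j' + 1 := ⟨j - 1, by omega⟩
      obtain ⟨m, hm, hm', hm''⟩ := key j 0 (by omega)
      refine ⟨Polynomial.X * m, fun k => ?_, ?_, ?_⟩
      · rcases k with _ | k
        · simp
        · rw [Polynomial.coeff_X_mul]; exact hm k
      · rw [Polynomial.eval_mul, Polynomial.eval_X, one_mul, hm']
      · rw [mS_succ, Polynomial.coe_mul, Polynomial.coe_X, mul_assoc, ← hm'']
        simp
        ring
    intro i j hij
    rcases i with _ | i
    · rcases j with _ | j
      · omega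
      · rw [mS_comm]; exact edge j (by omega)
    · rcases j with _ | j
      · exact edge i (by omega)
      · exact key i j (by omega)

/-- The polynomial `m_{i,j}` with `M_{i,j} (1-X²)^h = m_{i,j} M_{0,0}`, where `i + j = 2h`. -/
noncomputable def mPoly (i j : ℕ) : Polynomial ℝ :=
  if h : i + j = 2 * ((i + j) / 2) then (exists_mPoly _ i j h).choose else 0

theorem mPoly_spec {h i j : ℕ} (hij : i + j = 2 * h) :
    (∀ k, 0 ≤ (mPoly i j).coeff k) ∧ (mPoly i j).eval 1 = ((2 * h - 1).doubleFactorial : ℝ) ∧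
      mS i j * (1 - X ^ 2) ^ h = (mPoly i j : PowerSeries ℝ) * mS 0 0 := by
  obtain rfl : h = (i + j) / 2 := by omega
  rw [mPoly, dif_pos hij]
  exact (exists_mPoly _ i j hij).choose_spec

/-- The numerator of the `r`-th coefficient of the square. -/
noncomputable def qPoly (r : ℕ) : Polynomial ℝ :=
  ∑ K ∈ Finset.range (2 * r + 1), ∑ x ∈ Finset.HasAntidiagonal.antidiagonal K,
    ∑ d ∈ Finset.HasAntidiagonal.antidiagonal (2 * r + 2 * K),
      Polynomial.C (yC d.1 x.1 * yC d.2 x.2) * (Polynomial.X ^ K * mPoly d.1 d.2 *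
        (1 - Polynomial.X ^ 2) ^ (2 * r - K))

theorem ehC_mul_eq (r : ℕ) : (mk fun N => ehC r N : PowerSeries ℝ) * (1 - X ^ 2) ^ (3 * r) =
    (qPoly r : PowerSeries ℝ) * mS 0 0 := by
  rw [ehC_eq, qPoly]
  simp_rw [← Polynomial.coeToPowerSeries.ringHom_apply, map_sum,
    Polynomial.coeToPowerSeries.ringHom_apply, Finset.sum_mul]
  refine Finset.sum_congr rfl fun K hK => Finset.sum_congr rfl fun x hx =>
    Finset.sum_congr rfl fun d hd => ?_
  have hd' := Finset.HasAntidiagonal.mem_antidiagonal.1 hd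
  have hK' := Finset.mem_range.1 hK
  have := (mPoly_spec (h := r + K) (by omega : d.1 + d.2 = 2 * (r + K))).2.2
  rw [show 3 * r = (r + K) + (2 * r - K) by omega, pow_add]
  simp only [Polynomial.coe_mul, Polynomial.coe_C, Polynomial.coe_pow, Polynomial.coe_sub,
    Polynomial.coe_X, Polynomial.coe_one]
  linear_combination C (yC d.1 x.1 * yC d.2 x.2) * X ^ K * (1 - X ^ 2) ^ (2 * r - K) * this

theorem yC_three_mul (k : ℕ) : yC (3 * k) k = 1 / (6 ^ k * k.factorial) := by
  rw [yC_eq, if_pos le_rfl, Nat.sub_self, coeff_zero_eq_constantCoeff, map_pow]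
  have : (6 : ℝ) / ((2 + 1) * (1 + 1)) = 1 := by norm_num
  simp [expTailQuot, Nat.factorial, this]

theorem epsr_eq (r : ℕ) : 4 ^ r * epsr r =
    2 ^ (2 * r) * yC (3 * (2 * r)) (2 * r) * ((2 * (3 * r) - 1).doubleFactorial : ℝ) := by
  have h : ((6 * r).factorial : ℝ) =
      ((2 * (3 * r) - 1).doubleFactorial : ℝ) * (2 ^ (3 * r) * (3 * r).factorial) := by
    rcases r with _ | r
    · simp
    · rw [show 6 * (r + 1) = (2 * (3 * (r + 1)) - 1) + 1 by omega,
        Nat.factorial_eq_mul_doubleFactorial,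
        show 2 * (3 * (r + 1)) - 1 + 1 = 2 * (3 * (r + 1)) by omega, Nat.doubleFactorial_two_mul]
      push_cast
      ring
  rw [epsr, yC_three_mul, h]
  have e1 : (2 : ℝ) ^ (5 * r) = 32 ^ r := by rw [pow_mul]; norm_num
  have e2 : (2 : ℝ) ^ (3 * r) = 8 ^ r := by rw [pow_mul]; norm_num
  have e3 : (3 : ℝ) ^ (2 * r) = 9 ^ r := by rw [pow_mul]; norm_num
  have e4 : (6 : ℝ) ^ (2 * r) = 36 ^ r := by rw [pow_mul]; norm_num
  have e5 : (2 : ℝ) ^ (2 * r) = 4 ^ r := by rw [pow_mul]; norm_num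
  have e6 : (36 : ℝ) ^ r = 4 ^ r * 9 ^ r := by rw [← mul_pow]; norm_num
  have e7 : (32 : ℝ) ^ r = 4 ^ r * 8 ^ r := by rw [← mul_pow]; norm_num
  rw [e1, e2, e3, e4, e5, e6, e7]
  field_simp

theorem qPoly_eval_one (r : ℕ) : (qPoly r).eval 1 = 4 ^ r * epsr r := by
  rw [epsr_eq, qPoly, Polynomial.eval_finsetSum, Finset.sum_range_succ, Finset.sum_eq_zero, zero_add]
  · rw [Polynomial.eval_finsetSum]
    simp_rw [Polynomial.eval_finsetSum]
    have := sum_yC (2 * r) (2 * r + 2 * (2 * r))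
    rw [show 3 * (2 * r) = 2 * r + 2 * (2 * r) by ring, ← this, Finset.sum_mul]
    refine Finset.sum_congr rfl fun x _ => ?_
    rw [Finset.sum_mul]
    refine Finset.sum_congr rfl fun d hd => ?_
    have hd' := Finset.HasAntidiagonal.mem_antidiagonal.1 hd
    have := (mPoly_spec (h := 3 * r) (by omega : d.1 + d.2 = 2 * (3 * r))).2.1
    simp [this]
  · intro K hK
    have hK' := Finset.mem_range.1 hK
    rw [Polynomial.eval_finsetSum]
    refine Finset.sum_eq_zero fun x _ => ?_
    rw [Polynomial.eval_finsetSum]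
    refine Finset.sum_eq_zero fun d _ => ?_
    simp
    right; right; omega

theorem norm_aeval_le_of_nonneg (m : Polynomial ℝ) (hm : ∀ k, 0 ≤ m.coeff k) {t : ℂ} (ht : ‖t‖ ≤ 1) :
    ‖Polynomial.aeval t m‖ ≤ m.eval 1 := by
  rw [Polynomial.aeval_eq_sum_range, Polynomial.eval_eq_sum_range]
  refine (norm_sum_le _ _).trans (Finset.sum_le_sum fun k _ => ?_)
  rw [one_pow, mul_one, norm_smul, Real.norm_of_nonneg (hm k), norm_pow]
  exact mul_le_of_le_one_right (hm k) (pow_le_one₀ (norm_nonneg _) ht)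

theorem doubleFactorial_mul_pow_le (K r j : ℕ) :
    ((2 * (r + K) - 1).doubleFactorial : ℝ) * (K : ℝ) ^ j ≤
      ((2 * (r + K + j) - 1).doubleFactorial : ℝ) := by
  induction j with
  | zero => simp
  | succ j ih =>
    by_cases h : r + K + j = 0
    · obtain ⟨rfl, rfl, rfl⟩ : r = 0 ∧ K = 0 ∧ j = 0 := by omega
      simp
    · rw [show 2 * (r + K + (j + 1)) - 1 = (2 * (r + K + j) - 1) + 2 by omega,
        Nat.doubleFactorial_add_two, pow_succ, ← mul_assoc, mul_comm]
      push_cast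
      refine mul_le_mul ?_ ih (by positivity) (by positivity)
      have : K ≤ 2 * (r + K + j) - 1 + 2 := by omega
      exact_mod_cast this

theorem norm_qPoly_le (r : ℕ) {t : ℂ} {δ : ℝ} (hδ : 0 < δ) (ht : ‖t‖ ^ 2 ≤ 1 - δ) :
    ‖Polynomial.aeval t (qPoly r) / (1 - t ^ 2) ^ (3 * r)‖ ≤
      4 ^ r * epsr r * (Real.exp (6 * δ) / δ ^ 3) ^ r := by
  have ht1 : ‖t‖ ≤ 1 := by nlinarith [norm_nonneg t]
  have hden : δ ≤ ‖1 - t ^ 2‖ := by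
    have := norm_sub_norm_le (1 : ℂ) (t ^ 2)
    rw [norm_one, norm_pow] at this
    linarith
  have hden0 : 0 < ‖1 - t ^ 2‖ := hδ.trans_le hden
  have hne : (1 - t ^ 2 : ℂ) ≠ 0 := norm_pos_iff.1 hden0
  have hK : ∀ K ∈ Finset.range (2 * r + 1),
      ‖Polynomial.aeval t (∑ x ∈ Finset.HasAntidiagonal.antidiagonal K,
        ∑ d ∈ Finset.HasAntidiagonal.antidiagonal (2 * r + 2 * K),
        Polynomial.C (yC d.1 x.1 * yC d.2 x.2) * (Polynomial.X ^ K * mPoly d.1 d.2 *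
        (1 - Polynomial.X ^ 2) ^ (2 * r - K))) / (1 - t ^ 2) ^ (3 * r)‖ ≤
      4 ^ r * epsr r * δ⁻¹ ^ (3 * r) * ((6 * r * δ) ^ (2 * r - K) / (2 * r - K).factorial) := by
    intro K hK
    have hK' := Finset.mem_range.1 hK
    obtain ⟨j, hj⟩ : ∃ j, 2 * r = K + j := ⟨2 * r - K, by omega⟩
    have hj' : 2 * r - K = j := by omega
    have h1 : ‖Polynomial.aeval t (∑ x ∈ Finset.HasAntidiagonal.antidiagonal K,
        ∑ d ∈ Finset.HasAntidiagonal.antidiagonal (2 * r + 2 * K),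
        Polynomial.C (yC d.1 x.1 * yC d.2 x.2) * (Polynomial.X ^ K * mPoly d.1 d.2 *
        (1 - Polynomial.X ^ 2) ^ (2 * r - K))) / (1 - t ^ 2) ^ (3 * r)‖ ≤
        ∑ x ∈ Finset.HasAntidiagonal.antidiagonal K,
        ∑ d ∈ Finset.HasAntidiagonal.antidiagonal (2 * r + 2 * K),
          yC d.1 x.1 * yC d.2 x.2 *
            (((2 * (r + K) - 1).doubleFactorial : ℝ) * δ⁻¹ ^ (r + K)) := by
      rw [map_sum, Finset.sum_div]
      refine (norm_sum_le _ _).trans (Finset.sum_le_sum fun x _ => ?_)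
      rw [map_sum, Finset.sum_div]
      refine (norm_sum_le _ _).trans (Finset.sum_le_sum fun d hd => ?_)
      have hd' := Finset.HasAntidiagonal.mem_antidiagonal.1 hd
      obtain ⟨s1, s2, -⟩ := mPoly_spec (h := r + K) (by omega : d.1 + d.2 = 2 * (r + K))
      have hm := norm_aeval_le_of_nonneg _ s1 ht1
      rw [s2] at hm
      have hy : 0 ≤ yC d.1 x.1 * yC d.2 x.2 := mul_nonneg (yC_nonneg _ _) (yC_nonneg _ _)
      have e : Polynomial.aeval t (Polynomial.C (yC d.1 x.1 * yC d.2 x.2) *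
          (Polynomial.X ^ K * mPoly d.1 d.2 * (1 - Polynomial.X ^ 2) ^ (2 * r - K))) /
          (1 - t ^ 2) ^ (3 * r) = ((yC d.1 x.1 * yC d.2 x.2 : ℝ) : ℂ) *
            (t ^ K * Polynomial.aeval t (mPoly d.1 d.2) * ((1 - t ^ 2)⁻¹) ^ (r + K)) := by
        rw [show 3 * r = (r + K) + (2 * r - K) by omega, pow_add, inv_pow]
        simp only [map_mul, Polynomial.aeval_C, Polynomial.aeval_X, map_sub, map_pow, map_one,
          Complex.coe_algebraMap]
        field_simp
        push_cast
        ring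
      rw [e, norm_mul, Complex.norm_real, Real.norm_of_nonneg hy]
      refine mul_le_mul_of_nonneg_left ?_ hy
      rw [norm_mul, norm_mul, norm_pow, norm_pow, norm_inv]
      refine mul_le_mul ?_ (pow_le_pow_left₀ (by positivity) (inv_anti₀ hδ hden) _)
        (by positivity) (by positivity)
      calc _ ≤ 1 * ‖Polynomial.aeval t (mPoly d.1 d.2)‖ :=
            mul_le_mul_of_nonneg_right (pow_le_one₀ (norm_nonneg _) ht1) (norm_nonneg _)
        _ ≤ _ := by rw [one_mul]; exact hm
    refine h1.trans ?_
    simp_rw [← Finset.sum_mul]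
    rw [sum_yC, hj', epsr_eq, yC_three_mul]
    have hy := yC_le K j
    rw [show 3 * K + j = 2 * r + 2 * K by omega] at hy
    have hdf := doubleFactorial_mul_pow_le K r j
    rw [show r + K + j = 3 * r by omega] at hdf
    have hfac : ((2 * r).factorial : ℝ) ≤ K.factorial * (2 * r : ℝ) ^ j := by
      have h2 : (2 * r).factorial ≤ K.factorial * (2 * r) ^ j := by
        rw [hj, mul_comm]
        have := Nat.factorial_mul_descFactorial (n := K + j) (k := j) (by omega)
        rw [Nat.add_sub_cancel] at this
        rw [← this, mul_comm]
        exact Nat.mul_le_mul_right _ (Nat.descFactorial_le_pow _ _)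
      exact_mod_cast h2
    have hδp : δ⁻¹ ^ (3 * r) = δ⁻¹ ^ (r + K) * δ⁻¹ ^ j := by
      rw [← pow_add]; congr 1; omega
    set D := ((2 * (r + K) - 1).doubleFactorial : ℝ)
    set D3 := ((2 * (3 * r) - 1).doubleFactorial : ℝ)
    calc 2 ^ K * yC (2 * r + 2 * K) K * (D * δ⁻¹ ^ (r + K))
        ≤ 2 ^ K * (1 / (6 ^ K * K.factorial) * ((K : ℝ) ^ j / j.factorial)) *
            (D * δ⁻¹ ^ (r + K)) := by gcongr
      _ = (1 / 3) ^ K * δ⁻¹ ^ (r + K) / j.factorial * ((D * K ^ j) * (1 / K.factorial)) := by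
          rw [show (6 : ℝ) = 2 * 3 by norm_num, mul_pow, one_div_pow]
          field_simp
      _ ≤ (1 / 3) ^ K * δ⁻¹ ^ (r + K) / j.factorial *
            (D3 * ((2 * r : ℝ) ^ j / (2 * r).factorial)) := by
          refine mul_le_mul_of_nonneg_left (mul_le_mul hdf ?_ (by positivity) (by positivity))
            (by positivity)
          rw [div_le_div_iff₀ (by positivity) (by positivity)]
          linarith
      _ = _ := by
          rw [hδp, mul_pow (6 * (r : ℝ)) δ j]
          rw [show (6 * (r : ℝ)) = 3 * (2 * r) by ring, mul_pow 3 (2 * (r : ℝ)) j,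
            show (6 : ℝ) = 2 * 3 by norm_num, mul_pow 2 3, one_div_pow]
          have : (3 : ℝ) ^ (2 * r) = 3 ^ K * 3 ^ j := by rw [hj, pow_add]
          rw [this]
          field_simp
          rw [mul_assoc, ← mul_pow, one_div_mul_cancel hδ.ne', one_pow, mul_one]
  have hsum : ∑ K ∈ Finset.range (2 * r + 1),
      ((6 * r * δ) ^ (2 * r - K) / (2 * r - K).factorial) ≤ Real.exp (6 * r * δ) := by
    have := Finset.sum_range_reflect (fun j => (6 * r * δ) ^ j / (j.factorial : ℝ)) (2 * r + 1)
    simp only [Nat.add_sub_cancel] at this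
    rw [this]
    exact Real.sum_le_exp_of_nonneg (by positivity) _
  rw [qPoly, map_sum, Finset.sum_div]
  refine (norm_sum_le _ _).trans ((Finset.sum_le_sum hK).trans ?_)
  rw [← Finset.mul_sum, div_pow, ← Real.exp_nat_mul, ← pow_mul, inv_pow]
  have he : 0 ≤ epsr r := by rw [epsr]; positivity
  calc _ ≤ 4 ^ r * epsr r * (δ ^ (3 * r))⁻¹ * Real.exp (6 * r * δ) := by gcongr
    _ = _ := by rw [show (r : ℝ) * (6 * δ) = 6 * r * δ by ring]; field_simp

theorem epsr_le (r : ℕ) : epsr r ≤ (3 / 2) ^ r * r.factorial := by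
  induction r with
  | zero => simp [epsr]
  | succ r ih =>
    have h : epsr (r + 1) = epsr r * ((6 * r + 1) * (6 * r + 5) / (24 * (r + 1))) := by
      rw [epsr, epsr, show 6 * (r + 1) = 6 * r + 1 + 1 + 1 + 1 + 1 + 1 by ring,
        show 3 * (r + 1) = 3 * r + 1 + 1 + 1 by ring, show 2 * (r + 1) = 2 * r + 1 + 1 by ring,
        show 5 * (r + 1) = 5 * r + 5 by ring]
      simp only [Nat.factorial_succ, pow_succ]
      push_cast
      field_simp
      ring
    rw [h, Nat.factorial_succ, pow_succ]
    push_cast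
    have : ((6 * r + 1) * (6 * r + 5) / (24 * (r + 1)) : ℝ) ≤ 3 / 2 * (r + 1) := by
      rw [div_le_iff₀ (by positivity)]
      nlinarith [(Nat.cast_nonneg r : (0 : ℝ) ≤ r)]
    have he : 0 ≤ epsr r := by rw [epsr]; positivity
    calc epsr r * ((6 * r + 1) * (6 * r + 5) / (24 * (r + 1)))
        ≤ ((3 / 2) ^ r * (r.factorial : ℝ)) * (3 / 2 * (r + 1)) := by gcongr
      _ = _ := by ring

/-- The square root of a power series with constant coefficient `1`, on coefficients. -/
noncomputable def sqrtSeq {A : Type*} [CommRing A] [Algebra ℚ A] (q : ℕ → A) : ℕ → A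
  | 0 => 1
  | r + 1 => rat A (1 / 2) *
      (q (r + 1) - ∑ k : Fin r, sqrtSeq q (k + 1) * sqrtSeq q (r - k))
  decreasing_by all_goals omega

theorem sum_sqrtSeq {A : Type*} [CommRing A] [Algebra ℚ A] (q : ℕ → A) (h0 : q 0 = 1) (r : ℕ) :
    ∑ x ∈ Finset.HasAntidiagonal.antidiagonal r, sqrtSeq q x.1 * sqrtSeq q x.2 = q r := by
  rcases r with _ | r
  · simp [sqrtSeq, h0]
  · rw [Finset.Nat.sum_antidiagonal_eq_sum_range_succ (fun i j => sqrtSeq q i * sqrtSeq q j),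
      Finset.sum_range_succ, Finset.sum_range_succ']
    have h1 : sqrtSeq q (r + 1) = rat A (1 / 2) *
        (q (r + 1) - ∑ k : Fin r, sqrtSeq q (k + 1) * sqrtSeq q (r - k)) := by
      rw [sqrtSeq]
    have h2 : sqrtSeq q 0 = 1 := by rw [sqrtSeq]
    rw [Fin.sum_univ_eq_sum_range (fun k => sqrtSeq q (k + 1) * sqrtSeq q (r - k))] at h1
    have h3 : ∀ k, r + 1 - (k + 1) = r - k := fun k => by omega
    simp only [Nat.sub_self, h2, h3, Nat.sub_zero]
    have h4 := two_mul_rat_half (A := A)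
    rw [h1]
    linear_combination (q (r + 1) - ∑ k ∈ Finset.range r, sqrtSeq q (k + 1) * sqrtSeq q (r - k)) * h4

/-- The polynomials whose generating series is the square root of that of `qPoly`. -/
noncomputable def pPoly : ℕ → Polynomial ℝ := sqrtSeq qPoly

theorem mPoly_zero_zero : mPoly 0 0 = 1 := by
  have h := (mPoly_spec (h := 0) (i := 0) (j := 0) rfl).2.2
  have h1 : mS 0 0 ≠ 0 := by
    intro h
    have := congrArg (coeff 0) h
    simp [mS] at this
  rw [pow_zero, mul_one] at h
  have : (mPoly 0 0 : PowerSeries ℝ) = 1 := mul_right_cancel₀ h1 (by rw [← h, one_mul])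
  exact_mod_cast this

theorem qPoly_zero : qPoly 0 = 1 := by
  simp [qPoly, mPoly_zero_zero, yC]

theorem sum_pPoly (r : ℕ) :
    ∑ x ∈ Finset.HasAntidiagonal.antidiagonal r, pPoly x.1 * pPoly x.2 = qPoly r :=
  sum_sqrtSeq qPoly qPoly_zero r

theorem pPoly_zero : pPoly 0 = 1 := by rw [pPoly, sqrtSeq]

theorem pPoly_eval_one (f : ℕ → ℝ) (hf0 : f 0 = 1)
    (hrec : ∀ r : ℕ, 1 ≤ r → ∑ k ∈ Finset.range (r + 1), f k * f (r - k) = epsr r) (r : ℕ) :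
    (pPoly r).eval 1 = 4 ^ r * f r := by
  induction r using Nat.strong_induction_on with
  | _ r ih =>
    rcases r with _ | r
    · simp [pPoly_zero, hf0]
    · have h1 := congrArg (Polynomial.eval 1) (sum_pPoly (r + 1))
      rw [Polynomial.eval_finsetSum, qPoly_eval_one, ← hrec (r + 1) (by omega), Finset.mul_sum,
        Finset.Nat.sum_antidiagonal_eq_sum_range_succ
          (fun i j => Polynomial.eval 1 (pPoly i * pPoly j)),
        Finset.sum_range_succ, Finset.sum_range_succ', Finset.sum_range_succ,
        Finset.sum_range_succ'] at h1
      have h3 : ∑ k ∈ Finset.range r, Polynomial.eval 1 (pPoly (k + 1) * pPoly (r + 1 - (k + 1))) =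
          ∑ k ∈ Finset.range r, 4 ^ (r + 1) * (f (k + 1) * f (r + 1 - (k + 1))) := by
        refine Finset.sum_congr rfl fun k hk => ?_
        have hk' := Finset.mem_range.1 hk
        rw [Polynomial.eval_mul, ih _ (by omega), ih _ (by omega)]
        have : (4 : ℝ) ^ (r + 1) = 4 ^ (k + 1) * 4 ^ (r + 1 - (k + 1)) := by
          rw [← pow_add]; congr 1; omega
        rw [this]
        ring
      rw [h3] at h1
      simp only [Polynomial.eval_mul, pPoly_zero, Polynomial.eval_one, hf0, Nat.sub_self,
        Nat.sub_zero] at h1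
      linarith

/-- The power series of `(1 - X²)^{-1/4}`. -/
noncomputable def kap : PowerSeries ℝ :=
  subst (X ^ 2 : PowerSeries ℝ) (rescale (-1 : ℝ) (binomialSeries ℝ (-(1 / 4) : ℝ)))

theorem choose_neg_half (p : ℕ) : (-1) ^ p * Ring.choose (-(1 / 2) : ℝ) p =
    ((2 * p).factorial : ℝ) / (4 ^ p * p.factorial * p.factorial) := by
  induction p with
  | zero => simp
  | succ p ih =>
    have h : Ring.choose (-(1 / 2) : ℝ) (p + 1) =
        Ring.choose (-(1 / 2) : ℝ) p * ((-(1 / 2) - p) / (p + 1)) := by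
      rw [Ring.choose_eq_smul, Ring.choose_eq_smul, descPochhammer_succ_right,
        Polynomial.smeval_mul, Nat.factorial_succ]
      simp [Polynomial.smeval_natCast, Polynomial.smeval_sub]
      field_simp
    rw [h, pow_succ, show (-1 : ℝ) ^ p * -1 * (Ring.choose (-(1 / 2) : ℝ) p * ((-(1 / 2) - p) / (p + 1)))
      = ((-1) ^ p * Ring.choose (-(1 / 2) : ℝ) p) * ((1 / 2 + p) / (p + 1)) by ring, ih,
      show 2 * (p + 1) = 2 * p + 1 + 1 by ring]
    simp only [Nat.factorial_succ, pow_succ]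
    push_cast
    field_simp
    ring

theorem kap_sq : kap ^ 2 = mS 0 0 := by
  rw [kap, sq, ← subst_mul hasSubst_sq, ← map_mul, ← binomialSeries_add]
  ext n
  rw [coeff_subst_X_pow two_ne_zero, coeff_rescale, binomialSeries_coeff,
    show (-(1 / 4) + -(1 / 4) : ℝ) = -(1 / 2) by norm_num, smul_eq_mul, mul_one, choose_neg_half, mS,
    coeff_mk]
  split_ifs with h
  · obtain ⟨p, rfl⟩ := h
    rw [Finset.sum_eq_single (p, p)]
    · rw [Nat.mul_div_cancel_left _ (by norm_num), pow_mul, if_pos rfl, zero_add]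
      norm_num
    · rintro ⟨a, b⟩ hab hne
      have := Finset.HasAntidiagonal.mem_antidiagonal.1 hab
      simp only at this ⊢
      rw [if_neg]
      intro h
      apply hne
      ext <;> simp only <;> omega
    · intro h
      exact absurd (Finset.HasAntidiagonal.mem_antidiagonal.2 (by simp only; ring)) h
  · symm
    refine Finset.sum_eq_zero fun x hx => ?_
    have := Finset.HasAntidiagonal.mem_antidiagonal.1 hx
    rw [if_neg]
    intro h'
    apply h
    omega

theorem constantCoeff_kap : constantCoeff kap = 1 := by
  rw [kap, ← coeff_zero_eq_constantCoeff_apply, coeff_subst_X_pow two_ne_zero]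
  simp

/-- The power series of `(1 - X²)⁻¹`. -/
noncomputable def geoS : PowerSeries ℝ := mk fun n => if 2 ∣ n then 1 else 0

theorem one_sub_mul_geoS : (1 - X ^ 2) * geoS = 1 := by
  ext n
  rw [sub_mul, one_mul, map_sub, coeff_X_pow_mul', geoS, coeff_mk, coeff_mk, coeff_one]
  rcases n with _ | _ | n
  · simp
  · simp
  · simp

/-- The coefficients (in `a`) of the square root of `ehS`. -/
noncomputable def chS (r : ℕ) : PowerSeries ℝ := kap * (pPoly r : PowerSeries ℝ) * geoS ^ (3 * r)

/-- The square root of `ehS`. -/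
noncomputable def zS : PowerSeries (PowerSeries ℝ) := mk fun N => mk fun r => coeff N (chS r)

theorem zS_sq : zS ^ 2 = ehS := by
  ext N r
  have h1 : ∑ x ∈ Finset.HasAntidiagonal.antidiagonal r, chS x.1 * chS x.2 = mk fun N => ehC r N := by
    have hg : ((1 - X ^ 2) ^ (3 * r) * geoS ^ (3 * r) : PowerSeries ℝ) = 1 := by
      rw [← mul_pow, one_sub_mul_geoS, one_pow]
    have h2 : ∑ x ∈ Finset.HasAntidiagonal.antidiagonal r, chS x.1 * chS x.2 =
        kap ^ 2 * (qPoly r : PowerSeries ℝ) * geoS ^ (3 * r) := by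
      rw [← sum_pPoly, ← Polynomial.coeToPowerSeries.ringHom_apply, map_sum, Finset.mul_sum,
        Finset.sum_mul]
      refine Finset.sum_congr rfl fun x hx => ?_
      have := Finset.HasAntidiagonal.mem_antidiagonal.1 hx
      rw [← this, mul_add, pow_add, chS, chS, map_mul, Polynomial.coeToPowerSeries.ringHom_apply,
        Polynomial.coeToPowerSeries.ringHom_apply]
      ring
    rw [h2, kap_sq, mul_comm (mS 0 0), ← ehC_mul_eq, mul_assoc, hg, mul_one]
  have h3 := congrArg (coeff N) h1
  rw [coeff_mk, map_sum] at h3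
  rw [ehS, coeff_mk, coeff_mk, ← h3, sq, coeff_mul, map_sum]
  simp_rw [coeff_mul]
  rw [Finset.sum_comm]
  simp [zS]

/-- Power series with nonnegative coefficients. -/
def nonnegS : Subsemiring (PowerSeries ℝ) where
  carrier := {P | ∀ n, 0 ≤ coeff n P}
  mul_mem' := by
    intro P Q hP hQ n
    rw [coeff_mul]
    exact Finset.sum_nonneg fun x _ => mul_nonneg (hP _) (hQ _)
  one_mem' := by
    intro n
    rw [coeff_one]
    split_ifs <;> simp
  add_mem' := by
    intro P Q hP hQ n
    rw [map_add]
    exact add_nonneg (hP n) (hQ n)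
  zero_mem' := by
    intro n
    simp

theorem mem_nonnegS {P : PowerSeries ℝ} : P ∈ nonnegS ↔ ∀ n, 0 ≤ coeff n P := Iff.rfl

theorem rat_mem_nonnegS (q : ℚ) (hq : 0 ≤ q) : rat (PowerSeries ℝ) q ∈ nonnegS := by
  rw [rat_eq_C, mem_nonnegS]
  intro n
  rw [coeff_C]
  split_ifs
  · exact_mod_cast hq
  · exact le_rfl

theorem X_mem_nonnegS : (X : PowerSeries ℝ) ∈ nonnegS := by
  intro n
  rw [coeff_X]
  split_ifs <;> simp

theorem coeff_derivative_treeS_mem (n : ℕ) :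
    coeff n (d⁄dX (PowerSeries ℝ) (treeS (X : PowerSeries ℝ))) ∈ nonnegS := by
  rw [coeff_derivative, coeff_treeS]
  refine mul_mem (mul_mem (pow_mem X_mem_nonnegS n) (rat_mem_nonnegS _ (by positivity))) ?_
  have : ((n : PowerSeries ℝ) + 1) = rat (PowerSeries ℝ) (n + 1) := by simp [rat]
  rw [this]
  exact rat_mem_nonnegS _ (by positivity)

theorem coeff_eS_mem (n : ℕ) : coeff n (eS (X : PowerSeries ℝ)) ∈ nonnegS :=
  coeff_mem_of_derivative_eq nonnegS rat_mem_nonnegS _ _ (derivative_eS X)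
    (by rw [constantCoeff_eS]; exact one_mem _) coeff_derivative_treeS_mem n

/-- The quotient of `biS` by the tree part, up to rescaling. -/
noncomputable def hHat : PowerSeries (PowerSeries ℝ) := lagS 1 zS

theorem coeff_zero_chS_zero : coeff 0 (chS 0) = 1 := by
  rw [chS, pPoly_zero]
  simp [constantCoeff_kap]

theorem coeff_zero_hHat : coeff 0 hHat = coeff 0 zS := by
  rw [hHat, lagS, coeff_mk, coeff_zero_eq_constantCoeff_apply]
  simp [constantCoeff_expS]

theorem constantCoeff_biS : constantCoeff biS = 1 := by
  rw [← coeff_zero_eq_constantCoeff_apply, biS, coeff_egf, bipW_zero]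
  simp [rat]

theorem biS_eq : biS = eS X * rescale (X : PowerSeries ℝ) hHat := by
  have hsq : biS ^ 2 = (eS X * rescale (X : PowerSeries ℝ) hHat) ^ 2 := by
    apply subS_injective (X : PowerSeries ℝ)
    have h1 : subS (X : PowerSeries ℝ) (rescale (X : PowerSeries ℝ) hHat) =
        rescale (X : PowerSeries ℝ) zS := by
      have := subS_rescale (X : PowerSeries ℝ) 1 hHat
      rw [mul_one] at this
      rw [this, hHat, subS_lagS]
    rw [subS_biS_sq, pow_two, subS_mul, subS_mul, h1, eS, subS_lagS, ← zS_sq, map_pow]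
    have e1 : (expS 2 : PowerSeries (PowerSeries ℝ)) = expS 1 * expS 1 := by
      rw [← expS_add]; norm_num
    have e2 : (expQ (-X) : PowerSeries (PowerSeries ℝ)) =
        expQ (-(rat (PowerSeries ℝ) (1 / 2) * X)) * expQ (-(rat (PowerSeries ℝ) (1 / 2) * X)) := by
      rw [← expQ_add]
      congr 1
      have := two_mul_rat_half (A := PowerSeries ℝ)
      linear_combination X * this
    rw [e1, e2]
    ring
  rcases sq_eq_sq_iff_eq_or_eq_neg.1 hsq with h | h
  · exact h
  · exfalso
    have h1 := congrArg (fun P => coeff 0 (coeff 0 P)) h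
    have h2 : coeff 0 (coeff 0 (eS X * rescale (X : PowerSeries ℝ) hHat)) = 1 := by
      have : coeff 0 (rescale (X : PowerSeries ℝ) hHat) = coeff 0 zS := by
        rw [coeff_rescale, pow_zero, one_mul, coeff_zero_hHat]
      rw [coeff_mul, Finset.Nat.antidiagonal_zero, Finset.sum_singleton, this,
        coeff_zero_eq_constantCoeff_apply (eS _), constantCoeff_eS, one_mul, zS,
        coeff_mk, coeff_mk, coeff_zero_chS_zero]
    have h3 : coeff 0 (coeff 0 biS) = 1 := by
      rw [coeff_zero_eq_constantCoeff_apply biS, constantCoeff_biS, coeff_zero_one]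
    rw [map_neg, map_neg, h2, h3] at h1
    norm_num at h1

theorem constantCoeff_hHat : constantCoeff hHat = 1 := by
  have h := congrArg constantCoeff biS_eq
  rw [map_mul, constantCoeff_biS, constantCoeff_eS, one_mul] at h
  have h2 : constantCoeff (rescale (X : PowerSeries ℝ) hHat) = constantCoeff hHat := by
    rw [← coeff_zero_eq_constantCoeff_apply, coeff_rescale, pow_zero, one_mul,
      coeff_zero_eq_constantCoeff_apply]
  rw [← h2, ← h]

theorem derivative_mul' {A : Type*} [CommRing A] (P Q : PowerSeries A) :
    d⁄dX A (P * Q) = P * d⁄dX A Q + Q * d⁄dX A P := by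
  rw [Derivation.leibniz, smul_eq_mul, smul_eq_mul]

theorem eS_ne_zero {A : Type*} [CommRing A] [Algebra ℚ A] [Nontrivial A] (α : A) : eS α ≠ 0 := by
  intro h
  have := constantCoeff_eS α
  rw [h, map_zero] at this
  exact zero_ne_one this

/-- The generating function of connected bipartite graphs. -/
noncomputable def conS : PowerSeries (PowerSeries ℝ) := egf (conW (expS 1 - 1))

theorem derivative_rescale_hHat :
    d⁄dX (PowerSeries ℝ) (rescale (X : PowerSeries ℝ) hHat) =
      (d⁄dX (PowerSeries ℝ) conS - d⁄dX (PowerSeries ℝ) (treeS X)) *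
        rescale (X : PowerSeries ℝ) hHat := by
  have h : d⁄dX (PowerSeries ℝ) biS = d⁄dX (PowerSeries ℝ) conS * biS := derivative_egf_bipW _
  rw [biS_eq, derivative_mul', derivative_eS] at h
  apply mul_left_cancel₀ (eS_ne_zero (X : PowerSeries ℝ))
  linear_combination h

theorem X_pow_dvd_coeff_conS_sub (n : ℕ) : (X : PowerSeries ℝ) ^ (n + 1) ∣
    coeff n (d⁄dX (PowerSeries ℝ) conS - d⁄dX (PowerSeries ℝ) (treeS X)) := by
  have hu : IsUnit hHat := by
    rw [isUnit_iff_constantCoeff, constantCoeff_hHat]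
    exact isUnit_one
  obtain ⟨u, hu'⟩ := hu.exists_right_inv
  have hd : d⁄dX (PowerSeries ℝ) (rescale (X : PowerSeries ℝ) hHat) =
      C (X : PowerSeries ℝ) * rescale (X : PowerSeries ℝ) (d⁄dX (PowerSeries ℝ) hHat) := by
    ext1 n
    rw [coeff_derivative, coeff_rescale, coeff_C_mul, coeff_rescale, coeff_derivative]
    ring
  have h : d⁄dX (PowerSeries ℝ) conS - d⁄dX (PowerSeries ℝ) (treeS X) =
      C (X : PowerSeries ℝ) * rescale (X : PowerSeries ℝ) (d⁄dX (PowerSeries ℝ) hHat * u) := by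
    have h1 : rescale (X : PowerSeries ℝ) hHat * rescale (X : PowerSeries ℝ) u = 1 := by
      rw [← map_mul, hu', map_one]
    have h2 := derivative_rescale_hHat
    rw [hd] at h2
    rw [map_mul, ← mul_assoc, h2, mul_assoc, h1, mul_one]
  rw [h, coeff_C_mul, coeff_rescale, ← mul_assoc, ← pow_succ']
  exact dvd_mul_right _ _

theorem conW_mem (n : ℕ) : conW (expS (1 : ℝ) - 1) n ∈ nonnegS := by
  have hw : (expS (1 : ℝ) - 1) ∈ nonnegS := by
    intro n
    rw [map_sub, coeff_expS_real, coeff_one]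
    split_ifs with h
    · simp [h]
    · rw [sub_zero]; positivity
  unfold conW conV
  refine sum_mem fun G _ => ?_
  split_ifs
  · exact pow_mem hw _
  · exact zero_mem _

theorem coeff_conS_sub_mem (n : ℕ) :
    coeff n (d⁄dX (PowerSeries ℝ) conS - d⁄dX (PowerSeries ℝ) (treeS X)) ∈ nonnegS := by
  have hc : coeff n (d⁄dX (PowerSeries ℝ) conS) ∈ nonnegS := by
    rw [conS, derivative_egf, coeff_egf]
    exact mul_mem (rat_mem_nonnegS _ (by positivity)) (conW_mem _)
  intro m
  by_cases hm : m < n + 1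
  · obtain ⟨Q, hQ⟩ := X_pow_dvd_coeff_conS_sub n
    rw [hQ, coeff_X_pow_mul', if_neg (by omega)]
  · rw [map_sub, map_sub]
    have : coeff m (coeff n (d⁄dX (PowerSeries ℝ) (treeS (X : PowerSeries ℝ)))) = 0 := by
      have e : ((n : PowerSeries ℝ) + 1) = C ((n : ℝ) + 1) := by simp
      rw [coeff_derivative, coeff_treeS, rat_eq_C, e, mul_assoc, ← map_mul, mul_comm, coeff_C_mul,
        coeff_X_pow, if_neg (by omega), mul_zero]
    rw [this, sub_zero]
    exact hc m

theorem coeff_rescale_hHat_mem (n : ℕ) :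
    coeff n (rescale (X : PowerSeries ℝ) hHat) ∈ nonnegS :=
  coeff_mem_of_derivative_eq nonnegS rat_mem_nonnegS _ _ derivative_rescale_hHat
    (by
      rw [← coeff_zero_eq_constantCoeff_apply, coeff_rescale, pow_zero, one_mul,
        coeff_zero_eq_constantCoeff_apply, constantCoeff_hHat]
      exact one_mem _) coeff_conS_sub_mem n

theorem coeff_hHat_mem (n : ℕ) : coeff n hHat ∈ nonnegS := by
  intro r
  have := coeff_rescale_hHat_mem n (r + n)
  rwa [coeff_rescale, coeff_X_pow_mul] at this

/-- The coefficients of `hHat` at a fixed power of the inner variable. -/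
noncomputable def hrS (r : ℕ) : PowerSeries ℝ := mk fun i => coeff r (coeff i hHat)

theorem hrS_eq (r : ℕ) : hrS r = lagS 1 (chS r) := by
  have key : ∀ (P : PowerSeries ℝ) (Z : PowerSeries (PowerSeries ℝ)) (n : ℕ),
      coeff r (coeff n (PowerSeries.map (C : ℝ →+* PowerSeries ℝ) P * Z)) = coeff n (P * mk fun N => coeff r (coeff N Z)) := by
    intro P Z n
    rw [coeff_mul, coeff_mul, map_sum]
    refine Finset.sum_congr rfl fun x _ => ?_
    rw [coeff_map, coeff_C_mul, coeff_mk]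
  ext n
  rw [hrS, coeff_mk, hHat, lagS, lagS, coeff_mk, coeff_mk]
  have h1 : ((1 - C (1 : PowerSeries ℝ) * X) * expS ((n : PowerSeries ℝ) * 1) :
      PowerSeries (PowerSeries ℝ)) = PowerSeries.map (C : ℝ →+* PowerSeries ℝ)
        ((1 - C (1 : ℝ) * X) * expS ((n : ℝ) * 1)) := by
    rw [map_mul, map_expS, map_sub, map_mul, map_one, map_C, map_X, map_mul, map_natCast, map_one, map_one, map_one]
  rw [h1, key]
  congr 2
  ext N
  simp [zS]

/-- `[x^n] e_a(x) H_r(a x)`. -/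
noncomputable def pnr (a : ℝ) (n r : ℕ) : ℝ := coeff n (eS a * rescale a (hrS r))

theorem pnr_eq (a : ℝ) (n r : ℕ) : pnr a n r =
    coeff n ((1 - C a * X) * expS (n * a) * (expS 1 * expQ (-(1 / 2 * a)) * rescale a (chS r))) := by
  have h : eS a * rescale a (hrS r) =
      lagS a (expS 1 * expQ (-(1 / 2 * a)) * rescale a (chS r)) := by
    rw [← lagS_subS a (eS a * _)]
    congr 1
    have h1 := subS_rescale a 1 (hrS r)
    rw [mul_one] at h1
    rw [subS_mul, h1, hrS_eq, subS_lagS, eS, subS_lagS]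
    simp [rat]
  rw [pnr, h, lagS, coeff_mk]

/-- The power series `P` converges absolutely at `t`, with sum `v`. -/
def Ev {𝕜 : Type*} [RCLike 𝕜] (P : PowerSeries ℝ) (t v : 𝕜) : Prop :=
  Summable (fun n => ‖((coeff n P : ℝ) : 𝕜) * t ^ n‖) ∧
    HasSum (fun n => ((coeff n P : ℝ) : 𝕜) * t ^ n) v

section

variable {𝕜 : Type*} [RCLike 𝕜] {P Q : PowerSeries ℝ} {t v w : 𝕜}

theorem Ev.unique (h : Ev P t v) (h' : Ev P t w) : v = w := h.2.unique h'.2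

theorem Ev.add (h : Ev P t v) (h' : Ev Q t w) : Ev (P + Q) t (v + w) := by
  have e : ∀ n, ((coeff n (P + Q) : ℝ) : 𝕜) * t ^ n =
      ((coeff n P : ℝ) : 𝕜) * t ^ n + ((coeff n Q : ℝ) : 𝕜) * t ^ n := by
    intro n
    rw [map_add]; push_cast; ring
  refine ⟨?_, ?_⟩
  · simp_rw [e]
    exact (h.1.add h'.1).of_nonneg_of_le (fun _ => norm_nonneg _) fun _ => norm_add_le _ _
  · simp_rw [e]
    exact h.2.add h'.2

theorem ev_mul (h : Ev P t v) (h' : Ev Q t w) : Ev (P * Q) t (v * w) := by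
  have e : ∀ n, ((coeff n (P * Q) : ℝ) : 𝕜) * t ^ n =
      ∑ x ∈ Finset.HasAntidiagonal.antidiagonal n,
        (((coeff x.1 P : ℝ) : 𝕜) * t ^ x.1) * (((coeff x.2 Q : ℝ) : 𝕜) * t ^ x.2) := by
    intro n
    rw [coeff_mul]
    push_cast
    rw [Finset.sum_mul]
    refine Finset.sum_congr rfl fun x hx => ?_
    rw [← Finset.HasAntidiagonal.mem_antidiagonal.1 hx, pow_add]
    ring
  have hs := summable_norm_sum_mul_antidiagonal_of_summable_norm h.1 h'.1
  refine ⟨?_, ?_⟩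
  · simp_rw [e]; exact hs
  · simp_rw [e]
    have := tsum_mul_tsum_eq_tsum_sum_antidiagonal_of_summable_norm h.1 h'.1
    rw [h.2.tsum_eq, h'.2.tsum_eq] at this
    rw [this]
    exact hs.of_norm.hasSum

theorem ev_monomial (m : ℕ) (c : ℝ) (t : 𝕜) : Ev (monomial m c) t ((c : 𝕜) * t ^ m) := by
  have e : ∀ n, n ≠ m → ((coeff n (monomial m c) : ℝ) : 𝕜) * t ^ n = 0 := by
    intro n hn
    rw [coeff_monomial, if_neg hn]
    simp
  refine ⟨?_, ?_⟩
  · refine summable_of_ne_finset_zero (s := {m}) fun n hn => ?_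
    rw [e n (by simpa using hn), norm_zero]
  · have := hasSum_single m e
    simpa [coeff_monomial] using this

theorem ev_C (c : ℝ) (t : 𝕜) : Ev (C c) t (c : 𝕜) := by
  have := ev_monomial 0 c t
  rwa [pow_zero, mul_one, monomial_zero_eq_C_apply] at this

theorem ev_one (t : 𝕜) : Ev (1 : PowerSeries ℝ) t (1 : 𝕜) := by
  have := ev_C 1 t
  rwa [map_one, RCLike.ofReal_one] at this

theorem ev_zero (t : 𝕜) : Ev (0 : PowerSeries ℝ) t (0 : 𝕜) := by
  have := ev_C 0 t
  rwa [map_zero, RCLike.ofReal_zero] at this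

theorem ev_X (t : 𝕜) : Ev (X : PowerSeries ℝ) t t := by
  have := ev_monomial 1 1 t
  rwa [pow_one, RCLike.ofReal_one, one_mul] at this

theorem ev_pow (h : Ev P t v) (k : ℕ) : Ev (P ^ k) t (v ^ k) := by
  induction k with
  | zero => rw [pow_zero, pow_zero]; exact ev_one t
  | succ k ih => rw [pow_succ, pow_succ]; exact ev_mul ih h

theorem ev_sub (h : Ev P t v) (h' : Ev Q t w) : Ev (P - Q) t (v - w) := by
  have := h.add (ev_mul (ev_C (-1) t) h')
  convert this using 1
  · rw [map_neg, map_one]; ring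
  · push_cast; ring

theorem ev_sum {ι : Type*} (s : Finset ι) {F : ι → PowerSeries ℝ} {f : ι → 𝕜}
    (h : ∀ i ∈ s, Ev (F i) t (f i)) : Ev (∑ i ∈ s, F i) t (∑ i ∈ s, f i) := by
  induction s using Finset.induction_on with
  | empty => simpa using ev_zero t
  | insert i s hi ih =>
    rw [Finset.sum_insert hi, Finset.sum_insert hi]
    exact (h i (Finset.mem_insert_self _ _)).add
      (ih fun j hj => h j (Finset.mem_insert_of_mem hj))

theorem ev_polynomial (p : Polynomial ℝ) (t : 𝕜) :
    Ev (p : PowerSeries ℝ) t (Polynomial.aeval t p) := by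
  induction p using Polynomial.induction_on' with
  | add p q hp hq => rw [Polynomial.coe_add, map_add]; exact hp.add hq
  | monomial m c =>
    rw [Polynomial.coe_monomial, Polynomial.aeval_monomial]
    exact ev_monomial m c t

theorem ev_expS (c : ℝ) (t : 𝕜) : Ev (expS c) t (NormedSpace.exp ((c : 𝕜) * t)) := by
  have e : ∀ n, ((coeff n (expS c) : ℝ) : 𝕜) * t ^ n =
      ((c : 𝕜) * t) ^ n / (n.factorial : 𝕜) := by
    intro n
    rw [coeff_expS_real]
    push_cast
    rw [mul_pow]
    ring
  unfold Ev
  simp_rw [e]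
  refine ⟨NormedSpace.norm_expSeries_div_summable _, NormedSpace.expSeries_div_hasSum_exp _⟩

/-- Substituting a square. -/
theorem ev_even {P R : PowerSeries ℝ} (hR : ∀ n, coeff n R = if 2 ∣ n then coeff (n / 2) P else 0)
    (h : Ev P (t ^ 2) v) : Ev R t v := by
  have hi : Function.Injective (fun k : ℕ => 2 * k) := fun a b h => by simpa using h
  have hz : ∀ n ∉ Set.range (fun k : ℕ => 2 * k), ((coeff n R : ℝ) : 𝕜) * t ^ n = 0 := by
    intro n hn
    rw [hR, if_neg, RCLike.ofReal_zero, zero_mul]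
    rintro ⟨k, rfl⟩
    exact hn ⟨k, rfl⟩
  have e : ∀ k, ((coeff (2 * k) R : ℝ) : 𝕜) * t ^ (2 * k) =
      ((coeff k P : ℝ) : 𝕜) * (t ^ 2) ^ k := by
    intro k
    rw [hR, if_pos (dvd_mul_right _ _), Nat.mul_div_cancel_left _ two_pos, pow_mul]
  refine ⟨?_, ?_⟩
  · rw [← hi.summable_iff (fun n hn => by rw [hz n hn, norm_zero])]
    simpa only [Function.comp_def, e] using h.1
  · rw [← hi.hasSum_iff hz]
    simpa only [Function.comp_def, e] using h.2

theorem ev_expQ (d : ℝ) (t : 𝕜) : Ev (expQ d) t (NormedSpace.exp ((d : 𝕜) * t ^ 2)) := by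
  refine ev_even (P := expS d) (fun n => ?_) (ev_expS d (t ^ 2))
  rw [coeff_expQ, coeff_expS_real]
  split_ifs
  · simp
  · rfl

theorem ev_geoS (ht : ‖t‖ < 1) : Ev geoS t (1 - t ^ 2)⁻¹ := by
  have ht2 : ‖t ^ 2‖ < 1 := by
    rw [norm_pow]; exact pow_lt_one₀ (norm_nonneg _) ht two_ne_zero
  refine ev_even (P := mk fun _ => 1) (fun n => ?_) ?_
  · simp [geoS]
  · refine ⟨?_, ?_⟩
    · simp only [coeff_mk, RCLike.ofReal_one, one_mul, norm_pow]
      exact summable_geometric_of_lt_one (by positivity) (by rwa [norm_pow] at ht2)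
    · simp only [coeff_mk, RCLike.ofReal_one, one_mul]
      exact hasSum_geometric_of_norm_lt_one ht2

end

theorem ev_kap {t : ℂ} (ht : ‖t‖ < 1) : Ev kap t ((1 - t ^ 2) ^ (-(1 / 4) : ℂ)) := by
  have ht2 : ‖-t ^ 2‖ < 1 := by
    rw [norm_neg, norm_pow]; exact pow_lt_one₀ (norm_nonneg _) ht two_ne_zero
  have h := (Complex.one_add_cpow_hasFPowerSeriesOnBall_zero (a := (-(1 / 4) : ℂ))).hasSum
    (y := -t ^ 2) (by
      rw [Metric.mem_eball, edist_zero_right, ← ofReal_norm]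
      exact ENNReal.ofReal_lt_one.2 ht2)
  have h' : HasSum (fun n => ((coeff n (rescale (-1 : ℝ) (PowerSeries.binomialSeries ℝ
      (-(1 / 4) : ℝ))) : ℝ) : ℂ) * (t ^ 2) ^ n) ((1 - t ^ 2) ^ (-(1 / 4) : ℂ)) := by
    have e : ∀ n, (_root_.binomialSeries ℂ (-(1 / 4) : ℂ) n fun _ => -t ^ 2) =
        ((coeff n (rescale (-1 : ℝ) (PowerSeries.binomialSeries ℝ
          (-(1 / 4) : ℝ))) : ℝ) : ℂ) * (t ^ 2) ^ n := by
      intro n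
      have := Complex.ofReal_choose (-(1 / 4) : ℝ) n
      push_cast at this
      rw [binomialSeries_apply, coeff_rescale, binomialSeries_coeff, ← this]
      simp only [smul_eq_mul, mul_one, List.ofFn_const, List.prod_replicate, neg_pow (t ^ 2)]
      push_cast
      ring
    simp only [e] at h
    rwa [zero_add, ← sub_eq_add_neg] at h
  refine ev_even (P := rescale (-1 : ℝ) (PowerSeries.binomialSeries ℝ (-(1 / 4) : ℝ)))
    (fun n => ?_) ⟨h'.summable.norm, h'⟩
  rw [kap, coeff_subst_X_pow two_ne_zero]
  rfl

theorem Ev.hasSum_real {P : PowerSeries ℝ} {t v : ℝ} (h : Ev P t v) :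
    HasSum (fun n => coeff n P * t ^ n) v := h.2

theorem ev_of_summable_nonneg {P : PowerSeries ℝ} {t : ℝ} (ht : 0 ≤ t) (hP : P ∈ nonnegS)
    (h : Summable fun n => coeff n P * t ^ n) : Ev P t (∑' n, coeff n P * t ^ n) := by
  refine ⟨?_, h.hasSum⟩
  refine h.congr fun n => ?_
  rw [Real.norm_eq_abs]
  exact (abs_of_nonneg (mul_nonneg (hP n) (pow_nonneg ht n))).symm

theorem ev_coeff_eS (a : ℝ) (j : ℕ) : Ev (coeff j (eS (X : PowerSeries ℝ))) a (coeff j (eS a)) := by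
  have h1 := map_eS (Polynomial.coeToPowerSeries.ringHom (R := ℝ)) (Polynomial.X : Polynomial ℝ)
  have h2 := map_eS (Polynomial.evalRingHom a) (Polynomial.X : Polynomial ℝ)
  rw [Polynomial.coeToPowerSeries.ringHom_apply, Polynomial.coe_X] at h1
  rw [Polynomial.coe_evalRingHom, Polynomial.eval_X] at h2
  rw [← h1, ← h2, coeff_map, coeff_map, Polynomial.coeToPowerSeries.ringHom_apply,
    Polynomial.coe_evalRingHom]
  have := ev_polynomial (coeff j (eS (Polynomial.X : Polynomial ℝ))) a
  rwa [Polynomial.coe_aeval_eq_eval] at this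

theorem coeff_eS_nonneg {a : ℝ} (ha : 0 ≤ a) (j : ℕ) : 0 ≤ coeff j (eS a) :=
  (ev_coeff_eS a j).hasSum_real.nonneg fun n => mul_nonneg (coeff_eS_mem j n) (pow_nonneg ha n)

theorem ev_coeff_biS (a : ℝ) (n : ℕ) :
    Ev (coeff n biS) a (1 / (n.factorial : ℝ) * bipW (Real.exp a - 1) n) := by
  rw [biS, coeff_egf, rat_eq_C]
  have h0 : Ev (expS 1 - 1) a (Real.exp a - 1) := by
    refine ev_sub ?_ (ev_one a)
    have := ev_expS 1 a
    rwa [RCLike.ofReal_real_eq_id, id, one_mul, ← Real.exp_eq_exp_ℝ] at this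
  have h1 : Ev (bipW (expS (1 : ℝ) - 1) n) a (bipW (Real.exp a - 1) n) := by
    unfold bipW bipV
    refine ev_sum _ fun G _ => ?_
    split_ifs
    · exact ev_pow h0 _
    · exact ev_zero a
  have h2 := ev_mul (ev_C ((1 / (n.factorial : ℚ) : ℚ) : ℝ) a) h1
  convert h2 using 1
  push_cast
  rfl

theorem coeff_biS_eq (n : ℕ) : coeff n biS = ∑ x ∈ Finset.HasAntidiagonal.antidiagonal n,
    coeff x.1 (eS (X : PowerSeries ℝ)) * (X ^ x.2 * coeff x.2 hHat) := by
  rw [biS_eq, coeff_mul]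
  simp_rw [coeff_rescale]

theorem summable_coeff_hHat {a : ℝ} (ha : 0 < a) (i : ℕ) :
    Summable fun r => coeff r (coeff i hHat) * a ^ r := by
  have h := (ev_coeff_biS a i).hasSum_real.summable
  have h' : Summable fun r => coeff (r + i) (coeff i biS) * a ^ (r + i) :=
    h.comp_injective (add_left_injective i)
  refine (h'.mul_right ((a ^ i)⁻¹)).of_nonneg_of_le
    (fun r => mul_nonneg (coeff_hHat_mem i r) (pow_nonneg ha.le r)) fun r => ?_
  have : coeff r (coeff i hHat) ≤ coeff (r + i) (coeff i biS) := by
    rw [coeff_biS_eq, map_sum]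
    have h0 : coeff r (coeff i hHat) = coeff (r + i) (coeff 0 (eS (X : PowerSeries ℝ)) *
        (X ^ i * coeff i hHat)) := by
      rw [coeff_zero_eq_constantCoeff_apply, constantCoeff_eS, one_mul, coeff_X_pow_mul]
    rw [h0]
    refine Finset.single_le_sum (f := fun x : ℕ × ℕ => coeff (r + i)
      (coeff x.1 (eS (X : PowerSeries ℝ)) * (X ^ x.2 * coeff x.2 hHat))) (fun x _ => ?_)
      (a := ((0, i) : ℕ × ℕ)) (by simp)
    exact mul_mem (coeff_eS_mem _) (mul_mem (pow_mem X_mem_nonnegS _) (coeff_hHat_mem _)) _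
  rw [pow_add, ← mul_assoc, mul_assoc _ (a ^ i), mul_inv_cancel₀ (by positivity), mul_one]
  exact mul_le_mul_of_nonneg_right this (pow_nonneg ha.le r)

/-- The value at `a` of a coefficient of `hHat`. -/
noncomputable def hVal (a : ℝ) (i : ℕ) : ℝ := ∑' r, coeff r (coeff i hHat) * a ^ r

theorem ev_coeff_hHat {a : ℝ} (ha : 0 < a) (i : ℕ) : Ev (coeff i hHat) a (hVal a i) :=
  ev_of_summable_nonneg ha.le (coeff_hHat_mem i) (summable_coeff_hHat ha i)

theorem hVal_nonneg {a : ℝ} (ha : 0 < a) (i : ℕ) : 0 ≤ hVal a i :=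
  (ev_coeff_hHat ha i).hasSum_real.nonneg fun r =>
    mul_nonneg (coeff_hHat_mem i r) (pow_nonneg ha.le r)

theorem hVal_zero {a : ℝ} (ha : 0 < a) : hVal a 0 = 1 := by
  have := ev_coeff_hHat ha 0
  rw [coeff_zero_eq_constantCoeff_apply, constantCoeff_hHat] at this
  exact this.unique (ev_one a)

theorem egf_bipW_exp {a : ℝ} (ha : 0 < a) : egf (bipW (Real.exp a - 1)) =
    eS a * rescale a (mk (hVal a)) := by
  ext n
  have h1 := ev_coeff_biS a n
  rw [coeff_biS_eq] at h1
  have h2 := h1.unique (ev_sum _ fun x _ => ev_mul (ev_coeff_eS a x.1)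
    (ev_mul (ev_pow (ev_X a) x.2) (ev_coeff_hHat ha x.2)))
  rw [coeff_egf, coeff_mul]
  simp_rw [coeff_rescale, coeff_mk]
  rw [← h2]
  simp [rat]

theorem pnr_eq_sum (a : ℝ) (n r : ℕ) : pnr a n r =
    ∑ x ∈ Finset.HasAntidiagonal.antidiagonal n,
      coeff x.1 (eS a) * (a ^ x.2 * coeff r (coeff x.2 hHat)) := by
  rw [pnr, coeff_mul]
  simp_rw [coeff_rescale, hrS, coeff_mk]

theorem pnr_nonneg {a : ℝ} (ha : 0 ≤ a) (n r : ℕ) : 0 ≤ pnr a n r := by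
  rw [pnr_eq_sum]
  exact Finset.sum_nonneg fun x _ => mul_nonneg (coeff_eS_nonneg ha _)
    (mul_nonneg (pow_nonneg ha _) (coeff_hHat_mem _ _))

theorem hasSum_pnr {a b : ℝ} (hb : 0 < b) (n : ℕ) :
    HasSum (fun r => b ^ r * pnr a n r) (coeff n (eS a * rescale a (mk (hVal b)))) := by
  have h : HasSum (fun r => ∑ x ∈ Finset.HasAntidiagonal.antidiagonal n,
      coeff x.1 (eS a) * (a ^ x.2 * (coeff r (coeff x.2 hHat) * b ^ r)))
      (∑ x ∈ Finset.HasAntidiagonal.antidiagonal n, coeff x.1 (eS a) * (a ^ x.2 * hVal b x.2)) :=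
    hasSum_sum fun x _ => ((ev_coeff_hHat hb x.2).hasSum_real.mul_left _).mul_left _
  rw [coeff_mul]
  simp_rw [coeff_rescale, coeff_mk]
  convert h using 2 with r
  rw [pnr_eq_sum, Finset.mul_sum]
  exact Finset.sum_congr rfl fun x _ => by ring

theorem hasSum_pnr_self {a : ℝ} (ha : 0 < a) (n : ℕ) :
    HasSum (fun r => a ^ r * pnr a n r)
      (1 / (n.factorial : ℝ) * bipW (Real.exp a - 1) n) := by
  have := hasSum_pnr (a := a) ha n
  rw [← egf_bipW_exp ha, coeff_egf] at this
  simpa [rat] using this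

theorem exp_pow_mul_le {a : ℝ} (ha : 0 ≤ a) {k n : ℕ} (hk : k ≤ n) :
    (Real.exp (2 * a) - 1 + 1) ^ (k * (n - k)) ≤ Real.exp (a * n ^ 2 / 2) := by
  rw [sub_add_cancel, ← Real.exp_nat_mul]
  apply Real.exp_le_exp.2
  push_cast [Nat.cast_sub hk]
  nlinarith [mul_nonneg ha (sq_nonneg ((n : ℝ) - 2 * k))]

theorem tsum_two_mul_pow_pnr_le {a : ℝ} (ha : 0 < a) (n : ℕ) :
    ∑' r, (2 * a) ^ r * pnr a n r ≤ 1 / (n.factorial : ℝ) * Real.exp (a * n ^ 2 / 2) := by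
  have h2a : 0 < 2 * a := by positivity
  rw [(hasSum_pnr h2a n).tsum_eq]
  set V : PowerSeries ℝ := mk (hVal (2 * a)) with hV
  have hsq : egf (bipW (Real.exp (2 * a) - 1)) ^ 2 = rescale 2 (eS a * rescale a (V ^ 2)) := by
    rw [egf_bipW_exp h2a, mul_pow, eS_two_mul_sq, map_mul, map_pow (rescale a), map_pow (rescale 2),
      rescale_rescale, mul_comm a 2]
  have hle : coeff n (eS a * rescale a V) ≤ coeff n (eS a * rescale a (V ^ 2)) := by
    rw [coeff_mul, coeff_mul]
    refine Finset.sum_le_sum fun x _ => mul_le_mul_of_nonneg_left ?_ (coeff_eS_nonneg ha.le _)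
    rw [coeff_rescale, coeff_rescale]
    refine mul_le_mul_of_nonneg_left ?_ (pow_nonneg ha.le _)
    rw [sq, coeff_mul]
    have := Finset.single_le_sum (f := fun y : ℕ × ℕ => coeff y.1 V * coeff y.2 V)
      (s := Finset.HasAntidiagonal.antidiagonal x.2) (fun y _ => by
        rw [hV, coeff_mk, coeff_mk]
        exact mul_nonneg (hVal_nonneg h2a _) (hVal_nonneg h2a _))
      (a := ((0, x.2) : ℕ × ℕ)) (by simp)
    have h0 : coeff 0 V = 1 := by rw [hV, coeff_mk, hVal_zero h2a]
    simp only [h0, one_mul] at this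
    exact this
  refine hle.trans ?_
  have h1 := congrArg (coeff n) hsq
  rw [coeff_rescale, sq, coeff_egf_mul, bipW_sq] at h1
  have h3 : ∑ k ∈ Finset.range (n + 1), (n.choose k : ℝ) *
      (Real.exp (2 * a) - 1 + 1) ^ (k * (n - k)) ≤ 2 ^ n * Real.exp (a * n ^ 2 / 2) := by
    have : (2 : ℝ) ^ n = ∑ k ∈ Finset.range (n + 1), (n.choose k : ℝ) := by
      exact_mod_cast (Nat.sum_range_choose n).symm
    rw [this, Finset.sum_mul]
    refine Finset.sum_le_sum fun k hk => mul_le_mul_of_nonneg_left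
      (exp_pow_mul_le ha.le (by have := Finset.mem_range.1 hk; omega)) (by positivity)
  have h4 : rat ℝ (1 / n.factorial) = 1 / (n.factorial : ℝ) := by simp [rat]
  rw [h4] at h1
  have h5 : (2 : ℝ) ^ n * coeff n (eS a * rescale a (V ^ 2)) ≤
      2 ^ n * (1 / (n.factorial : ℝ) * Real.exp (a * n ^ 2 / 2)) := by
    rw [← h1]
    calc _ ≤ 1 / (n.factorial : ℝ) * (2 ^ n * Real.exp (a * n ^ 2 / 2)) :=
          mul_le_mul_of_nonneg_left h3 (by positivity)
      _ = _ := by ring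
  exact le_of_mul_le_mul_left h5 (by positivity)

/-- The rational functions `P_r(t) / (1 - t²)^{3r}`. -/
noncomputable def cR (r : ℕ) (t : ℂ) : ℂ := Polynomial.aeval t (pPoly r) / (1 - t ^ 2) ^ (3 * r)

theorem sum_cR (r : ℕ) {t : ℂ} : ∑ x ∈ Finset.HasAntidiagonal.antidiagonal r, cR x.1 t * cR x.2 t =
    Polynomial.aeval t (qPoly r) / (1 - t ^ 2) ^ (3 * r) := by
  rw [← sum_pPoly, map_sum, Finset.sum_div]
  refine Finset.sum_congr rfl fun x hx => ?_
  rw [cR, cR, map_mul, div_mul_div_comm, ← pow_add, ← mul_add,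
    Finset.HasAntidiagonal.mem_antidiagonal.1 hx]

theorem factorial_succ_mul_le (i j : ℕ) :
    (i + 1).factorial * (j + 1).factorial ≤ (i + j + 1).factorial := by
  induction j with
  | zero => simp
  | succ j ih =>
    rw [Nat.factorial_succ (j + 1), show i + (j + 1) + 1 = (i + j + 1) + 1 by ring,
      Nat.factorial_succ (i + j + 1)]
    calc _ = (j + 1 + 1) * ((i + 1).factorial * (j + 1).factorial) := by ring
      _ ≤ _ := Nat.mul_le_mul (by omega) ih

theorem norm_cR_le (r : ℕ) {t : ℂ} {δ : ℝ} (hδ : 0 < δ) (ht : ‖t‖ ^ 2 ≤ 1 - δ) :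
    ‖cR r t‖ ≤ r.factorial * (6 * Real.exp (6 * δ) / δ ^ 3) ^ r := by
  set x := 6 * Real.exp (6 * δ) / δ ^ 3 with hx
  have hx0 : 0 ≤ x := by positivity
  have hE : ∀ r, ‖∑ y ∈ Finset.HasAntidiagonal.antidiagonal r, cR y.1 t * cR y.2 t‖ ≤
      r.factorial * x ^ r := by
    intro r
    rw [sum_cR]
    refine (norm_qPoly_le r hδ ht).trans ?_
    calc _ ≤ 4 ^ r * ((3 / 2) ^ r * r.factorial) * (Real.exp (6 * δ) / δ ^ 3) ^ r := by
          gcongr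
          exact epsr_le r
      _ = _ := by
        rw [hx, mul_div_assoc, mul_pow, show (6 : ℝ) = 4 * (3 / 2) by norm_num, mul_pow]
        ring
  induction r using Nat.strong_induction_on with
  | _ r ih =>
    rcases r with _ | _ | r
    · simp [cR, pPoly_zero]
    · have h := hE 1
      rw [Finset.Nat.sum_antidiagonal_eq_sum_range_succ (fun i j => cR i t * cR j t),
        Finset.sum_range_succ, Finset.sum_range_one] at h
      have h0 : cR 0 t = 1 := by simp [cR, pPoly_zero]
      simp only [h0, Nat.sub_zero, Nat.sub_self, one_mul, mul_one, ← two_mul, norm_mul,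
        RCLike.norm_ofNat] at h
      have : 0 ≤ (Nat.factorial 1 : ℝ) * x ^ 1 := by positivity
      rw [zero_add]
      linarith
    · have h := hE (r + 2)
      rw [Finset.Nat.sum_antidiagonal_eq_sum_range_succ (fun i j => cR i t * cR j t),
        Finset.sum_range_succ, Finset.sum_range_succ'] at h
      have h0 : cR 0 t = 1 := by simp [cR, pPoly_zero]
      simp only [h0, Nat.sub_zero, Nat.sub_self, one_mul, mul_one] at h
      have hS : ‖∑ k ∈ Finset.range (r + 1), cR (k + 1) t * cR (r + 2 - (k + 1)) t‖ ≤
          (r + 2).factorial * x ^ (r + 2) := by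
        refine (norm_sum_le _ _).trans ?_
        calc _ ≤ ∑ k ∈ Finset.range (r + 1), ((r + 1).factorial : ℝ) * x ^ (r + 2) := by
              refine Finset.sum_le_sum fun k hk => ?_
              have hk' := Finset.mem_range.1 hk
              obtain ⟨j, rfl⟩ := Nat.exists_eq_add_of_le (show k ≤ r by omega)
              rw [show k + j + 2 - (k + 1) = j + 1 by omega, norm_mul]
              calc _ ≤ ((k + 1).factorial * x ^ (k + 1)) * ((j + 1).factorial * x ^ (j + 1)) := by
                    gcongr
                    · exact ih _ (by omega)
                    · exact ih _ (by omega)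
                _ = (((k + 1).factorial * (j + 1).factorial : ℕ) : ℝ) * x ^ (k + j + 2) := by
                    push_cast; ring
                _ ≤ _ := by
                    gcongr
                    exact factorial_succ_mul_le k j
          _ = (r + 1) * ((r + 1).factorial * x ^ (r + 2)) := by simp
          _ ≤ _ := by
            rw [Nat.factorial_succ (r + 1)]
            push_cast
            have : 0 ≤ ((r + 1).factorial : ℝ) * x ^ (r + 2) := by positivity
            nlinarith
      have h2 : 2 * ‖cR (r + 2) t‖ ≤ (r + 2).factorial * x ^ (r + 2) +
          (r + 2).factorial * x ^ (r + 2) := by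
        calc 2 * ‖cR (r + 2) t‖ = ‖(∑ k ∈ Finset.range (r + 1),
              cR (k + 1) t * cR (r + 2 - (k + 1)) t + cR (r + 2) t + cR (r + 2) t) -
              ∑ k ∈ Finset.range (r + 1), cR (k + 1) t * cR (r + 2 - (k + 1)) t‖ := by
              rw [add_assoc, add_sub_cancel_left, ← two_mul, norm_mul, RCLike.norm_ofNat]
          _ ≤ _ := (norm_sub_le _ _).trans (add_le_add h hS)
      linarith

theorem ev_chS (r : ℕ) {t : ℂ} (ht : ‖t‖ < 1) :
    Ev (chS r) t ((1 - t ^ 2) ^ (-(1 / 4) : ℂ) * cR r t) := by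
  have := ev_mul (ev_mul (ev_kap ht) (ev_polynomial (pPoly r) t)) (ev_pow (ev_geoS ht) (3 * r))
  rw [inv_pow] at this
  rw [chS, cR, mul_div_assoc', div_eq_mul_inv _ (_ ^ (3 * r))]
  exact this

/-- The scaled generating function whose coefficients give `pnr`. -/
noncomputable def circS (a : ℝ) (n r : ℕ) : PowerSeries ℝ :=
  (1 - X) * expS (n : ℝ) * (expS (1 / a) * expQ (-(1 / (2 * a))) * chS r)

theorem pnr_eq_coeff_circS {a : ℝ} (ha : a ≠ 0) (n r : ℕ) :
    pnr a n r = a ^ n * coeff n (circS a n r) := by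
  rw [pnr_eq, ← coeff_rescale, circS]
  have h2 : a * (1 / a) = 1 := by field_simp
  have h3 : a ^ 2 * -(1 / (2 * a)) = -(1 / 2 * a) := by field_simp
  simp only [map_mul, map_sub, map_one, rescale_expS, rescale_expQ, rescale_X, h2, h3,
    mul_comm a (n : ℝ)]

theorem ev_circS (a : ℝ) (n r : ℕ) {t : ℂ} (ht : ‖t‖ < 1) :
    Ev (circS a n r) t ((1 - t) * (1 - t ^ 2) ^ (-(1 / 4) : ℂ) * cR r t *
      Complex.exp (n * t + t / a - t ^ 2 / (2 * a))) := by
  have h := ev_mul (ev_mul (ev_sub (ev_one t) (ev_X t)) (ev_expS (n : ℝ) t))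
    (ev_mul (ev_mul (ev_expS (1 / a) t) (ev_expQ (-(1 / (2 * a))) t)) (ev_chS r ht))
  simp only [← Complex.exp_eq_exp_ℂ] at h
  rw [circS]
  convert h using 1
  have e : (n * t + t / a - t ^ 2 / (2 * a) : ℂ) = ((n : ℝ) : ℂ) * t + ((1 / a : ℝ) : ℂ) * t +
      ((-(1 / (2 * a)) : ℝ) : ℂ) * t ^ 2 := by
    push_cast
    ring
  rw [e, Complex.exp_add, Complex.exp_add]
  simp only [Complex.coe_algebraMap]
  ring

theorem integral_exp_circle {ν : ℝ} (hν : 0 < ν) (β : ℝ) {k : ℤ} (hk : k ≠ 0) :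
    ∫ τ in (-(Real.pi / ν))..(Real.pi / ν), Complex.exp (k * (ν * (β + τ * Complex.I))) = 0 := by
  have hc : (k * ν * Complex.I : ℂ) ≠ 0 := by
    simp [hk, hν.ne']
  have e : ∀ τ : ℝ, Complex.exp (k * (ν * (β + τ * Complex.I))) =
      Complex.exp (k * ν * β) * Complex.exp (k * ν * Complex.I * τ) := by
    intro τ
    rw [← Complex.exp_add]
    ring_nf
  simp_rw [e]
  rw [intervalIntegral.integral_const_mul, integral_exp_mul_complex hc]
  have h1 : (k * ν * Complex.I * (Real.pi / ν : ℝ) : ℂ) =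
      k * ν * Complex.I * (-(Real.pi / ν) : ℝ) + k * (2 * Real.pi * Complex.I) := by
    have : (ν : ℂ) ≠ 0 := by exact_mod_cast hν.ne'
    push_cast
    field_simp
    ring
  rw [h1, Complex.exp_add, Complex.exp_int_mul_two_pi_mul_I, mul_one, sub_self, zero_div, mul_zero]

/-- The coefficients of a power series as integrals over a circle. -/
theorem coeff_eq_integral {P : PowerSeries ℝ} {G : ℂ → ℂ} {ν β : ℝ} (hν : 0 < ν)
    (hP : ∀ τ : ℝ, Ev P (Complex.exp (-(ν * (β + τ * Complex.I))))
      (G (Complex.exp (-(ν * (β + τ * Complex.I)))))) (n : ℕ) :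
    ((coeff n P : ℝ) : ℂ) = ν / (2 * Real.pi) *
      ∫ τ in (-(Real.pi / ν))..(Real.pi / ν), G (Complex.exp (-(ν * (β + τ * Complex.I)))) *
        Complex.exp (n * (ν * (β + τ * Complex.I))) := by
  set t : ℝ → ℂ := fun τ => Complex.exp (-(ν * (β + τ * Complex.I))) with ht
  have hnorm : ∀ τ, ‖t τ‖ = Real.exp (-(ν * β)) := by
    intro τ
    rw [ht, Complex.norm_exp]
    simp
  have hnorm' : ∀ τ : ℝ, ‖Complex.exp (n * (ν * (β + τ * Complex.I)))‖ =
      Real.exp (n * (ν * β)) := by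
    intro τ
    rw [Complex.norm_exp]
    congr 1
    rw [← Complex.ofReal_natCast, Complex.re_ofReal_mul, Complex.re_ofReal_mul]
    simp
  have hsum : Summable fun m => ‖((coeff m P : ℝ) : ℂ)‖ * Real.exp (-(ν * β)) ^ m := by
    have := (hP 0).1
    refine this.congr fun m => ?_
    rw [norm_mul, norm_pow, ← hnorm 0]
    rfl
  have hInt := intervalIntegral.hasSum_integral_of_dominated_convergence (μ := MeasureTheory.volume)
    (a := -(Real.pi / ν)) (b := Real.pi / ν)
    (F := fun m τ => ((coeff m P : ℝ) : ℂ) * t τ ^ m *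
      Complex.exp (n * (ν * (β + τ * Complex.I))))
    (f := fun τ => G (t τ) * Complex.exp (n * (ν * (β + τ * Complex.I))))
    (fun m _ => ‖((coeff m P : ℝ) : ℂ)‖ * Real.exp (-(ν * β)) ^ m * Real.exp (n * (ν * β)))
    (fun m => by
      refine Continuous.aestronglyMeasurable ?_
      rw [ht]
      fun_prop)
    (fun m => Eventually.of_forall fun τ _ => by
      rw [norm_mul, norm_mul, norm_pow, hnorm, hnorm'])
    (Eventually.of_forall fun τ _ => hsum.mul_right _)
    (by simp)
    (Eventually.of_forall fun τ _ => (hP τ).2.mul_right _)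
  have hterm : ∀ m, ∫ τ in (-(Real.pi / ν))..(Real.pi / ν), ((coeff m P : ℝ) : ℂ) * t τ ^ m *
      Complex.exp (n * (ν * (β + τ * Complex.I))) =
      if m = n then ((coeff n P : ℝ) : ℂ) * (2 * Real.pi / ν) else 0 := by
    intro m
    have e : ∀ τ : ℝ, ((coeff m P : ℝ) : ℂ) * t τ ^ m *
        Complex.exp (n * (ν * (β + τ * Complex.I))) = ((coeff m P : ℝ) : ℂ) *
        Complex.exp (((n - m : ℤ) : ℂ) * (ν * (β + τ * Complex.I))) := by
      intro τ
      rw [ht, ← Complex.exp_nat_mul, mul_assoc, ← Complex.exp_add]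
      congr 2
      push_cast
      ring
    simp_rw [e]
    rw [intervalIntegral.integral_const_mul]
    split_ifs with h
    · subst h
      simp
      left
      ring
    · rw [integral_exp_circle hν β (by omega), mul_zero]
  simp_rw [hterm] at hInt
  have h2 := hInt.unique (hasSum_ite_eq n _)
  rw [h2]
  have : (ν : ℂ) ≠ 0 := by exact_mod_cast hν.ne'
  have hpi : (Real.pi : ℂ) ≠ 0 := by exact_mod_cast Real.pi_ne_zero
  field_simp

theorem pow_mul_pnr_eq_integral {a ν β : ℝ} (ha : a ≠ 0) (hν : 0 < ν) (hβ : 0 < β) (n r : ℕ) :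
    ((a ^ r * pnr a n r : ℝ) : ℂ) = (a ^ n * Real.exp (n + 1 / (2 * a)) * (ν / (2 * Real.pi)) : ℝ) *
      ∫ τ in (-(Real.pi / ν))..(Real.pi / ν),
        (1 - Complex.exp (-(ν * (β + τ * Complex.I)))) *
        (1 - Complex.exp (-(ν * (β + τ * Complex.I))) ^ 2) ^ (-(1 / 4) : ℂ) *
        (a ^ r * cR r (Complex.exp (-(ν * (β + τ * Complex.I))))) *
        Complex.exp (n * (Complex.exp (-(ν * (β + τ * Complex.I))) - 1 +
            ν * (β + τ * Complex.I)) -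
          (1 - Complex.exp (-(ν * (β + τ * Complex.I)))) ^ 2 / (2 * a)) := by
  have h := coeff_eq_integral (P := circS a n r) (G := fun t => (1 - t) *
    (1 - t ^ 2) ^ (-(1 / 4) : ℂ) * cR r t * Complex.exp (n * t + t / a - t ^ 2 / (2 * a)))
    (β := β) hν (fun τ => ev_circS a n r (by
      rw [Complex.norm_exp]
      simp
      positivity)) n
  rw [pnr_eq_coeff_circS ha]
  have ha' : (a : ℂ) ≠ 0 := by exact_mod_cast ha
  push_cast
  rw [h, ← intervalIntegral.integral_const_mul, ← intervalIntegral.integral_const_mul,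
    ← intervalIntegral.integral_const_mul, ← intervalIntegral.integral_const_mul]
  refine intervalIntegral.integral_congr fun τ _ => ?_
  set t := Complex.exp (-(ν * (β + τ * Complex.I))) with ht
  set s := (β + τ * Complex.I : ℂ)
  have e : Complex.exp (n * t + t / a - t ^ 2 / (2 * a)) * Complex.exp (n * (ν * s)) =
      Complex.exp (n + 1 / (2 * a)) *
        Complex.exp (n * (t - 1 + ν * s) - (1 - t) ^ 2 / (2 * a)) := by
    rw [← Complex.exp_add, ← Complex.exp_add]
    congr 1
    field_simp
    ring
  linear_combination (a ^ r * a ^ n * (ν / (2 * Real.pi)) * (1 - t) *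
    (1 - t ^ 2) ^ (-(1 / 4) : ℂ) * cR r t) * e

end

section

open Complex Set MeasureTheory

/-- The integrand `s^p e^{s³/3}`. -/
noncomputable def airyF (p : ℝ) (s : ℂ) : ℂ := s ^ (p : ℂ) * exp (s ^ 3 / 3)

/-- The primitive sixth root of unity. -/
noncomputable def om : ℂ := exp ((Real.pi / 3 : ℝ) * I)

theorem om_re : om.re = 1 / 2 := by
  rw [om, exp_ofReal_mul_I_re, Real.cos_pi_div_three]

theorem om_im : om.im = √3 / 2 := by
  rw [om, exp_ofReal_mul_I_im, Real.sin_pi_div_three]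

theorem norm_om : ‖om‖ = 1 := norm_exp_ofReal_mul_I _

theorem om_pow_three : om ^ 3 = -1 := by
  rw [om, ← exp_nat_mul, ← exp_pi_mul_I]
  congr 1
  push_cast
  ring

/-- The direction of the rays in a homotopy from a vertical ray to a ray of argument `π / 3`. -/
noncomputable def rayD (θ : ℝ) : ℂ := (1 - θ) * I + θ * om

/-- The homotopy of rays. -/
noncomputable def rayS (β θ x : ℝ) : ℂ := (1 - θ) * β + x * rayD θ

theorem rayD_re (θ : ℝ) : (rayD θ).re = θ / 2 := by
  simp [rayD, om_re]
  ring

theorem rayD_im (θ : ℝ) : (rayD θ).im = 1 - θ + θ * (√3 / 2) := by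
  simp [rayD, om_im]

theorem rayS_re (β θ x : ℝ) : (rayS β θ x).re = (1 - θ) * β + x * (θ / 2) := by
  simp [rayS, rayD_re]

theorem rayS_im (β θ x : ℝ) : (rayS β θ x).im = x * (1 - θ + θ * (√3 / 2)) := by
  simp [rayS, rayD_im]

theorem norm_rayD_le {θ : ℝ} (hθ : θ ∈ Icc (0 : ℝ) 1) : ‖rayD θ‖ ≤ 1 := by
  rw [rayD]
  refine (norm_add_le _ _).trans ?_
  have : (1 - θ : ℂ) = ((1 - θ : ℝ) : ℂ) := by push_cast; ring
  rw [norm_mul, norm_mul, norm_om, norm_I, this, norm_real, norm_real, Real.norm_eq_abs,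
    Real.norm_eq_abs, abs_of_nonneg hθ.1, abs_of_nonneg (by linarith [hθ.2])]
  linarith

theorem one_le_sqrt_three : (1.7 : ℝ) ≤ √3 := by
  apply Real.le_sqrt_of_sq_le
  norm_num

theorem rayD_im_ge {θ : ℝ} (hθ : θ ∈ Icc (0 : ℝ) 1) : √3 / 2 ≤ (rayD θ).im := by
  rw [rayD_im]
  have : √3 ≤ 2 := by
    rw [Real.sqrt_le_left (by norm_num)]
    norm_num
  nlinarith [hθ.2]

theorem rayS_cube_re_le {β θ x : ℝ} (hβ : 0 < β) (hθ : θ ∈ Icc (0 : ℝ) 1) (hx : 0 ≤ x) :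
    (rayS β θ x ^ 3 / 3).re ≤
      β ^ 3 / 3 + min (β / 2) (1 / 3) + β ^ 2 / 2 * x - min (β / 2) (1 / 3) * x ^ 2 := by
  set c := min (β / 2) (1 / 3) with hc
  have hc0 : 0 < c := lt_min (by positivity) (by norm_num)
  have hc1 : c ≤ β / 2 := min_le_left _ _
  have hc2 : c ≤ 1 / 3 := min_le_right _ _
  have him := rayD_im_ge hθ
  have hre := rayD_re θ
  set b := (1 - θ) * β with hb
  set e := (rayD θ).re
  set m := (rayD θ).im
  obtain ⟨h0, h1⟩ := hθ
  have hb0 : 0 ≤ b := mul_nonneg (by linarith) hβ.le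
  have hbβ : b ≤ β := by nlinarith
  have hm2 : 3 / 4 ≤ m ^ 2 := by
    have := pow_le_pow_left₀ (by positivity) him 2
    rw [div_pow, Real.sq_sqrt (by norm_num)] at this
    linarith
  have heq : (rayS β θ x ^ 3 / 3).re =
      (b ^ 3 + 3 * b ^ 2 * x * e + 3 * b * x ^ 2 * (e ^ 2 - m ^ 2) +
        x ^ 3 * (e * (e ^ 2 - 3 * m ^ 2))) / 3 := by
    have h1 : rayS β θ x = ⟨b + x * e, x * m⟩ := by
      apply Complex.ext
      · simp only [rayS_re, hb, hre]
      · simp only [rayS_im]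
        rw [← rayD_im]
    have h2 : rayS β θ x ^ 3 / 3 = ((1 / 3 : ℝ) : ℂ) * rayS β θ x ^ 3 := by push_cast; ring
    rw [h2, re_ofReal_mul, h1, pow_succ, pow_two]
    simp only [mul_re, mul_im]
    ring
  rw [heq]
  have he0 : 0 ≤ e := by rw [hre]; linarith
  have he1 : e ≤ 1 / 2 := by rw [hre]; linarith
  have he2 : e ^ 2 ≤ 1 / 4 := by nlinarith
  have t1 : b ^ 3 ≤ β ^ 3 := pow_le_pow_left₀ hb0 hbβ 3
  have t2 : 3 * b ^ 2 * x * e ≤ 3 * β ^ 2 * x * (1 / 2) := by gcongr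
  have t3 : 3 * b * x ^ 2 * (e ^ 2 - m ^ 2) ≤ 3 * b * x ^ 2 * (-(1 / 2)) := by
    gcongr
    linarith
  have t4 : x ^ 3 * (e * (e ^ 2 - 3 * m ^ 2)) ≤ x ^ 3 * (e * (-2)) := by
    gcongr
    linarith
  have t5 : c * x ^ 2 - c ≤ b * x ^ 2 / 2 + θ * x ^ 3 / 3 := by
    have hbb : (1 - θ) * c ≤ b / 2 := by
      rw [hb]; nlinarith
    have hb' : (1 - θ) * c * x ^ 2 ≤ b / 2 * x ^ 2 := by gcongr
    have : θ * (c * (x ^ 2 - 1)) ≤ θ * (x ^ 3 / 3) := by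
      refine mul_le_mul_of_nonneg_left ?_ h0
      rcases le_total x 1 with h | h
      · have : c * (x ^ 2 - 1) ≤ 0 := mul_nonpos_of_nonneg_of_nonpos hc0.le (by nlinarith)
        have : 0 ≤ x ^ 3 := by positivity
        linarith
      · have : c * (x ^ 2 - 1) ≤ 1 / 3 * (x ^ 2 - 1) := by
          refine mul_le_mul_of_nonneg_right hc2 (by nlinarith)
        nlinarith
    have hcθ : 0 ≤ c * (1 - θ) := mul_nonneg hc0.le (by linarith)
    nlinarith
  have t6 : x ^ 3 * (e * (-2)) = - (θ * x ^ 3) := by rw [hre]; ring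
  linarith

/-- A Gaussian bound, uniform along the homotopy. -/
noncomputable def rayB (β x : ℝ) : ℝ :=
  Real.exp (β ^ 3 / 3 + min (β / 2) (1 / 3) + β ^ 2 / 2 * x - min (β / 2) (1 / 3) * x ^ 2)

theorem norm_exp_rayS_le {β θ x : ℝ} (hβ : 0 < β) (hθ : θ ∈ Icc (0 : ℝ) 1) (hx : 0 ≤ x) :
    ‖exp (rayS β θ x ^ 3 / 3)‖ ≤ rayB β x := by
  rw [norm_exp]
  exact Real.exp_le_exp.2 (rayS_cube_re_le hβ hθ hx)

theorem norm_rayS_le {β θ x : ℝ} (hβ : 0 < β) (hθ : θ ∈ Icc (0 : ℝ) 1) (hx : 0 ≤ x) :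
    ‖rayS β θ x‖ ≤ β + x := by
  rw [rayS]
  refine (norm_add_le _ _).trans ?_
  have : ((1 - θ) * β : ℂ) = (((1 - θ) * β : ℝ) : ℂ) := by push_cast; ring
  rw [norm_mul _ (rayD θ), this, norm_real, norm_real, Real.norm_eq_abs, Real.norm_eq_abs,
    abs_of_nonneg hx, abs_of_nonneg (mul_nonneg (by linarith [hθ.2]) hβ.le)]
  have := norm_rayD_le hθ
  nlinarith [hθ.1]

theorem rayS_mem_slitPlane {β θ x : ℝ} (hβ : 0 < β) (hθ : θ ∈ Icc (0 : ℝ) 1) (hx : 0 ≤ x)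
    (h : 0 < x ∨ θ < 1) : rayS β θ x ∈ slitPlane := by
  rw [mem_slitPlane_iff]
  by_cases hx0 : 0 < x
  · right
    rw [rayS_im, ← rayD_im]
    have := rayD_im_ge hθ
    have := one_le_sqrt_three
    exact (mul_pos hx0 (by linarith)).ne'
  · left
    rw [rayS_re]
    have h' := h.resolve_left hx0
    have := mul_pos (sub_pos.2 h') hβ
    have := mul_nonneg hx (by linarith [hθ.1] : 0 ≤ θ / 2)
    linarith

theorem exists_rpow_le_exp (q : ℝ) {c : ℝ} (hc : 0 < c) :
    ∃ K : ℝ, 0 < K ∧ ∀ z, c ≤ z → z ^ q ≤ K * Real.exp z := by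
  obtain ⟨n, hn⟩ := exists_nat_ge q
  refine ⟨c ^ q * (n.factorial / c ^ n), by positivity, fun z hz => ?_⟩
  have h1 : z ^ q = c ^ q * (z / c) ^ q := by
    rw [← Real.mul_rpow hc.le (by have := hc.trans_le hz; positivity), mul_div_cancel₀ _ hc.ne']
  have h2 : (z / c) ^ q ≤ (z / c) ^ (n : ℝ) :=
    Real.rpow_le_rpow_of_exponent_le (by rwa [le_div_iff₀ hc, one_mul]) hn
  have h3 := Real.pow_div_factorial_le_exp z (hc.le.trans hz) n
  rw [div_le_iff₀ (by positivity)] at h3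
  rw [h1, mul_assoc]
  refine mul_le_mul_of_nonneg_left (h2.trans ?_) (by positivity)
  rw [Real.rpow_natCast, div_pow, div_mul_eq_mul_div]
  gcongr
  linarith

theorem integrableOn_rpow_mul_rayB (q : ℝ) {β : ℝ} (hβ : 0 < β) :
    IntegrableOn (fun x => (β + x) ^ q * rayB β x) (Ioi 0) := by
  obtain ⟨K, hK, h⟩ := exists_rpow_le_exp q hβ
  have hc : 0 < min (β / 2) (1 / 3) := lt_min (by positivity) (by norm_num)
  have h1 := (integrable_cexp_quadratic (b := (min (β / 2) (1 / 3) : ℝ)) (by simpa using hc)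
    ((1 + β ^ 2 / 2 : ℝ) : ℂ) ((β + β ^ 3 / 3 + min (β / 2) (1 / 3) : ℝ) : ℂ)).norm
  refine Integrable.mono' ((h1.const_mul K).integrableOn (s := Ioi 0)) ?_ ?_
  · refine ContinuousOn.aestronglyMeasurable ?_ measurableSet_Ioi
    intro x hx
    have hx' : (0 : ℝ) < x := hx
    refine ContinuousAt.continuousWithinAt (ContinuousAt.mul ?_ ?_)
    · exact (continuousAt_const.add continuousAt_id).rpow_const (Or.inl (by simp; linarith))
    · unfold rayB
      fun_prop
  · refine (ae_restrict_iff' measurableSet_Ioi).2 (Eventually.of_forall fun x hx => ?_)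
    have hx' : (0 : ℝ) < x := hx
    have hB : 0 ≤ rayB β x := (Real.exp_pos _).le
    rw [Real.norm_eq_abs, abs_of_nonneg (by positivity)]
    calc _ ≤ K * Real.exp (β + x) * rayB β x := by
          gcongr
          exact h _ (by linarith)
      _ = _ := by
          rw [rayB, mul_assoc, ← Real.exp_add, norm_exp]
          congr 2
          have : (-((min (β / 2) (1 / 3) : ℝ) : ℂ) * x ^ 2 + ((1 + β ^ 2 / 2 : ℝ) : ℂ) * x +
              ((β + β ^ 3 / 3 + min (β / 2) (1 / 3) : ℝ) : ℂ)) =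
              ((-(min (β / 2) (1 / 3)) * x ^ 2 + (1 + β ^ 2 / 2) * x +
              (β + β ^ 3 / 3 + min (β / 2) (1 / 3)) : ℝ) : ℂ) := by
            push_cast
            rfl
          rw [this, ofReal_re]
          ring

/-- The derivative of `airyF`. -/
noncomputable def airyF' (p : ℝ) (s : ℂ) : ℂ :=
  (p * s ^ ((p - 1 : ℝ) : ℂ) + s ^ (p : ℂ) * s ^ 2) * exp (s ^ 3 / 3)

theorem hasDerivAt_airyF (p : ℝ) {s : ℂ} (hs : s ∈ slitPlane) :
    HasDerivAt (airyF p) (airyF' p s) s := by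
  have h1 := (hasStrictDerivAt_cpow_const (c := (p : ℂ)) hs).hasDerivAt
  have h2 : HasDerivAt (fun s : ℂ => exp (s ^ 3 / 3)) (exp (s ^ 3 / 3) * s ^ 2) s := by
    refine HasDerivAt.congr_deriv ((hasDerivAt_pow 3 s).div_const 3).cexp ?_
    push_cast
    ring
  refine HasDerivAt.congr_deriv (h1.mul h2) ?_
  rw [airyF']
  push_cast
  ring

theorem continuousAt_airyF' (p : ℝ) {s : ℂ} (hs : s ∈ slitPlane) : ContinuousAt (airyF' p) s := by
  unfold airyF'
  refine ContinuousAt.mul (ContinuousAt.add (continuousAt_const.mul ?_)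
    (ContinuousAt.mul ?_ (by fun_prop))) (by fun_prop)
  · exact continuousAt_id.cpow continuousAt_const hs
  · exact continuousAt_id.cpow continuousAt_const hs

theorem norm_airyF_rayS_le {p β θ x : ℝ} (hp : 0 ≤ p) (hβ : 0 < β) (hθ : θ ∈ Icc (0 : ℝ) 1)
    (hx : 0 ≤ x) : ‖airyF p (rayS β θ x)‖ ≤ (β + x) ^ p * rayB β x := by
  rw [airyF, norm_mul, norm_cpow_real]
  exact mul_le_mul (Real.rpow_le_rpow (norm_nonneg _) (norm_rayS_le hβ hθ hx) hp)
    (norm_exp_rayS_le hβ hθ hx) (norm_nonneg _) (by positivity)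

theorem norm_airyF'_rayS_le {p β θ x : ℝ} (hp : 1 ≤ p) (hβ : 0 < β) (hθ : θ ∈ Icc (0 : ℝ) 1)
    (hx : 0 ≤ x) : ‖airyF' p (rayS β θ x)‖ ≤
      (p * (β + x) ^ (p - 1) + (β + x) ^ p * (β + x) ^ 2) * rayB β x := by
  have hs := norm_rayS_le hβ hθ hx
  rw [airyF', norm_mul]
  refine mul_le_mul ((norm_add_le _ _).trans ?_) (norm_exp_rayS_le hβ hθ hx) (norm_nonneg _)
    (by positivity)
  rw [norm_mul, norm_mul, norm_cpow_real, norm_cpow_real, norm_real, norm_pow, Real.norm_eq_abs,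
    abs_of_nonneg (by linarith)]
  have : 0 ≤ p - 1 := by linarith
  gcongr

theorem hasDerivAt_rayS_left (β θ x : ℝ) :
    HasDerivAt (fun θ : ℝ => rayS β θ x) (-β + x * (om - I)) θ := by
  have h0 : HasDerivAt (fun θ : ℝ => (θ : ℂ)) 1 θ := Complex.ofRealCLM.hasDerivAt
  have h1 := (h0.const_sub 1).mul_const (β : ℂ)
  have h2 := (((h0.const_sub 1).mul_const I).add (h0.mul_const om)).const_mul (x : ℂ)
  exact (h1.add h2).congr_deriv (by ring)

theorem hasDerivAt_rayS_right (β θ x : ℝ) :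
    HasDerivAt (fun x : ℝ => rayS β θ x) (rayD θ) x := by
  have h0 : HasDerivAt (fun x : ℝ => (x : ℂ)) 1 x := Complex.ofRealCLM.hasDerivAt
  exact ((h0.mul_const (rayD θ)).const_add ((1 - θ) * β : ℂ)).congr_deriv (by ring)

theorem hasDerivAt_rayD (θ : ℝ) : HasDerivAt rayD (om - I) θ := by
  have h0 : HasDerivAt (fun θ : ℝ => (θ : ℂ)) 1 θ := Complex.ofRealCLM.hasDerivAt
  exact (((h0.const_sub 1).mul_const I).add (h0.mul_const om)).congr_deriv (by ring)

/-- The common mixed derivative along the homotopy. -/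
noncomputable def rayW (p β θ x : ℝ) : ℂ :=
  airyF' p (rayS β θ x) * (-β + x * (om - I)) * rayD θ + airyF p (rayS β θ x) * (om - I)

theorem hasDerivAt_rayW_left {p β θ x : ℝ} (hs : rayS β θ x ∈ slitPlane) :
    HasDerivAt (fun θ => airyF p (rayS β θ x) * rayD θ) (rayW p β θ x) θ :=
  (HasDerivAt.comp (h := fun θ => rayS β θ x) θ (hasDerivAt_airyF p hs)
    (hasDerivAt_rayS_left β θ x)).mul (hasDerivAt_rayD θ)

theorem hasDerivAt_rayW_right {p β θ x : ℝ} (hs : rayS β θ x ∈ slitPlane) :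
    HasDerivAt (fun x : ℝ => airyF p (rayS β θ x) * (-β + x * (om - I))) (rayW p β θ x) x := by
  have h0 : HasDerivAt (fun x : ℝ => (x : ℂ)) 1 x := Complex.ofRealCLM.hasDerivAt
  refine HasDerivAt.congr_deriv ((HasDerivAt.comp (h := fun x => rayS β θ x) x
    (hasDerivAt_airyF p hs) (hasDerivAt_rayS_right β θ x)).mul
    ((h0.mul_const (om - I)).const_add (-β : ℂ))) ?_
  rw [rayW]
  simp only [Function.comp_apply]
  ring

theorem norm_om_sub_I_le : ‖om - I‖ ≤ 2 := by
  refine (norm_sub_le _ _).trans ?_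
  rw [norm_om, norm_I]
  norm_num

theorem norm_rayS_left_le {β x : ℝ} (hβ : 0 < β) (hx : 0 ≤ x) :
    ‖(-β + x * (om - I) : ℂ)‖ ≤ 2 * (β + x) := by
  refine (norm_add_le _ _).trans ?_
  rw [norm_neg, norm_mul, norm_real, norm_real, Real.norm_eq_abs, Real.norm_eq_abs, abs_of_pos hβ,
    abs_of_nonneg hx]
  nlinarith [norm_om_sub_I_le]

/-- A majorant of `rayW`. -/
noncomputable def rayWB (p β x : ℝ) : ℝ :=
  (2 * p + 2) * ((β + x) ^ p * rayB β x) + 2 * ((β + x) ^ (p + 3) * rayB β x)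

theorem integrableOn_rayWB (p : ℝ) {β : ℝ} (hβ : 0 < β) : IntegrableOn (rayWB p β) (Ioi 0) :=
  ((integrableOn_rpow_mul_rayB p hβ).const_mul _).add
    ((integrableOn_rpow_mul_rayB (p + 3) hβ).const_mul _)

theorem norm_rayW_le {p β θ x : ℝ} (hp : 1 ≤ p) (hβ : 0 < β) (hθ : θ ∈ Icc (0 : ℝ) 1)
    (hx : 0 ≤ x) : ‖rayW p β θ x‖ ≤ rayWB p β x := by
  have hβx : 0 < β + x := by linarith
  have hB : 0 ≤ rayB β x := (Real.exp_pos _).le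
  rw [rayW]
  refine (norm_add_le _ _).trans ?_
  rw [norm_mul, norm_mul, norm_mul]
  have h1 := norm_airyF'_rayS_le hp hβ hθ hx
  have h2 := norm_airyF_rayS_le (zero_le_one.trans hp) hβ hθ hx
  calc _ ≤ (p * (β + x) ^ (p - 1) + (β + x) ^ p * (β + x) ^ 2) * rayB β x * (2 * (β + x)) * 1 +
        (β + x) ^ p * rayB β x * 2 := by
        gcongr
        · exact norm_rayS_left_le hβ hx
        · exact norm_rayD_le hθ
        · exact norm_om_sub_I_le
    _ = _ := by
        rw [rayWB, Real.rpow_add hβx, Real.rpow_sub_one hβx.ne', show (3 : ℝ) = (3 : ℕ) by norm_num,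
          Real.rpow_natCast]
        field_simp
        ring

theorem continuousOn_airyF_rayS {p β θ : ℝ} (hβ : 0 < β) (hθ : θ ∈ Icc (0 : ℝ) 1) :
    ContinuousOn (fun x => airyF p (rayS β θ x)) (Ioi 0) := fun x hx =>
  ((hasDerivAt_airyF p (rayS_mem_slitPlane hβ hθ (le_of_lt hx) (Or.inl hx))).comp x
    (hasDerivAt_rayS_right β θ x)).continuousAt.continuousWithinAt

theorem aestronglyMeasurable_rayW {p β θ : ℝ} (hβ : 0 < β) (hθ : θ ∈ Icc (0 : ℝ) 1) :
    AEStronglyMeasurable (rayW p β θ) (volume.restrict (Ioi 0)) := by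
  refine ContinuousOn.aestronglyMeasurable ?_ measurableSet_Ioi
  refine ContinuousOn.add (ContinuousOn.mul (ContinuousOn.mul ?_ (by fun_prop)) (by fun_prop))
    (ContinuousOn.mul (continuousOn_airyF_rayS hβ hθ) (by fun_prop))
  exact fun x hx => ContinuousAt.continuousWithinAt <| ContinuousAt.comp (f := rayS β θ)
    (continuousAt_airyF' p (rayS_mem_slitPlane hβ hθ (le_of_lt hx) (Or.inl hx)))
    (hasDerivAt_rayS_right β θ x).continuousAt

theorem integrableOn_airyF_rayS {p β θ : ℝ} (hp : 0 ≤ p) (hβ : 0 < β) (hθ : θ ∈ Icc (0 : ℝ) 1) :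
    IntegrableOn (fun x => airyF p (rayS β θ x) * rayD θ) (Ioi 0) := by
  refine Integrable.mul_const ?_ _
  refine Integrable.mono' (integrableOn_rpow_mul_rayB p hβ)
    ((continuousOn_airyF_rayS hβ hθ).aestronglyMeasurable measurableSet_Ioi) ?_
  exact (ae_restrict_iff' measurableSet_Ioi).2 (Eventually.of_forall fun x hx =>
    norm_airyF_rayS_le hp hβ hθ (le_of_lt hx))

/-- The integral along the rays of the homotopy. -/
noncomputable def rayH (p β θ : ℝ) : ℂ := ∫ x in Ioi (0 : ℝ), airyF p (rayS β θ x) * rayD θ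

theorem continuousOn_rayH {p β : ℝ} (hp : 0 ≤ p) (hβ : 0 < β) :
    ContinuousOn (rayH p β) (Icc 0 1) := by
  refine continuousOn_of_dominated (bound := fun x => (β + x) ^ p * rayB β x)
    (fun θ hθ => (integrableOn_airyF_rayS hp hβ hθ).1) (fun θ hθ => ?_)
    (integrableOn_rpow_mul_rayB p hβ) ?_
  · refine (ae_restrict_iff' measurableSet_Ioi).2 (Eventually.of_forall fun x hx => ?_)
    have hB : 0 ≤ rayB β x := (Real.exp_pos _).le
    have : 0 < β + x := add_pos hβ hx
    rw [norm_mul]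
    calc _ ≤ (β + x) ^ p * rayB β x * 1 := mul_le_mul (norm_airyF_rayS_le hp hβ hθ (le_of_lt hx))
          (norm_rayD_le hθ) (norm_nonneg _) (by positivity)
      _ = _ := mul_one _
  · refine (ae_restrict_iff' measurableSet_Ioi).2 (Eventually.of_forall fun x hx θ hθ => ?_)
    exact (hasDerivAt_rayW_left (rayS_mem_slitPlane hβ hθ (le_of_lt hx)
      (Or.inl hx))).continuousAt.continuousWithinAt

theorem integral_rayW {p β θ : ℝ} (hp : 1 ≤ p) (hβ : 0 < β) (hθ : θ ∈ Ioo (0 : ℝ) 1) :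
    ∫ x in Ioi (0 : ℝ), rayW p β θ x = airyF p (((1 - θ) * β : ℝ) : ℂ) * β := by
  have hθ' := Ioo_subset_Icc_self hθ
  have hW : IntegrableOn (rayW p β θ) (Ioi 0) :=
    Integrable.mono' (integrableOn_rayWB p hβ) (aestronglyMeasurable_rayW hβ hθ')
      ((ae_restrict_iff' measurableSet_Ioi).2 (Eventually.of_forall fun x hx =>
        norm_rayW_le hp hβ hθ' (le_of_lt hx)))
  have hd : ∀ x ∈ Ici (0 : ℝ), HasDerivAt (fun x : ℝ => airyF p (rayS β θ x) *
      (-β + x * (om - I))) (rayW p β θ x) x := fun x hx =>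
    hasDerivAt_rayW_right (rayS_mem_slitPlane hβ hθ' hx (Or.inr hθ.2))
  have hI : IntegrableOn (fun x : ℝ => airyF p (rayS β θ x) * (-β + x * (om - I))) (Ioi 0) := by
    refine Integrable.mono' ((integrableOn_rpow_mul_rayB (p + 1) hβ).const_mul 2)
      (((continuousOn_airyF_rayS hβ hθ').mul (by fun_prop)).aestronglyMeasurable
        measurableSet_Ioi) ?_
    refine (ae_restrict_iff' measurableSet_Ioi).2 (Eventually.of_forall fun x hx => ?_)
    have hβx : 0 < β + x := add_pos hβ hx
    have hB : 0 ≤ rayB β x := (Real.exp_pos _).le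
    rw [norm_mul]
    calc _ ≤ (β + x) ^ p * rayB β x * (2 * (β + x)) := mul_le_mul
          (norm_airyF_rayS_le (zero_le_one.trans hp) hβ hθ' (le_of_lt hx))
          (norm_rayS_left_le hβ (le_of_lt hx)) (norm_nonneg _) (by positivity)
      _ = _ := by
        rw [Real.rpow_add_one hβx.ne']
        ring
  have hd' : ∀ x ∈ Ioi (0 : ℝ), HasDerivAt (fun x : ℝ => airyF p (rayS β θ x) *
      (-β + x * (om - I))) (rayW p β θ x) x := fun x hx => hd x (mem_Ici.2 (le_of_lt hx))
  have ht := tendsto_zero_of_hasDerivAt_of_integrableOn_Ioi hd' hW hI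
  rw [integral_Ioi_of_hasDerivAt_of_tendsto
    (hd 0 self_mem_Ici).continuousAt.continuousWithinAt hd' hW ht]
  simp [rayS]

theorem hasDerivAt_rayH {p β θ : ℝ} (hp : 1 ≤ p) (hβ : 0 < β) (hθ : θ ∈ Ioo (0 : ℝ) 1) :
    HasDerivAt (rayH p β) (airyF p (((1 - θ) * β : ℝ) : ℂ) * β) θ := by
  have hp0 := zero_le_one.trans hp
  rw [← integral_rayW hp hβ hθ]
  have hn : Ioo (0 : ℝ) 1 ∈ nhds θ := Ioo_mem_nhds hθ.1 hθ.2
  refine (hasDerivAt_integral_of_dominated_loc_of_deriv_le (bound := rayWB p β)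
    (F := fun θ x => airyF p (rayS β θ x) * rayD θ) (F' := rayW p β)
    (μ := volume.restrict (Ioi 0)) hn ?_
    (integrableOn_airyF_rayS hp0 hβ (Ioo_subset_Icc_self hθ))
    (aestronglyMeasurable_rayW hβ (Ioo_subset_Icc_self hθ)) ?_ (integrableOn_rayWB p hβ) ?_).2
  · filter_upwards [hn] with z hz
    exact (integrableOn_airyF_rayS hp0 hβ (Ioo_subset_Icc_self hz)).1
  · exact (ae_restrict_iff' measurableSet_Ioi).2 (Eventually.of_forall fun x hx z hz =>
      norm_rayW_le hp hβ (Ioo_subset_Icc_self hz) (le_of_lt hx))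
  · exact (ae_restrict_iff' measurableSet_Ioi).2 (Eventually.of_forall fun x hx z hz =>
      hasDerivAt_rayW_left (rayS_mem_slitPlane hβ (Ioo_subset_Icc_self hz) (le_of_lt hx)
        (Or.inl hx)))

theorem airyF_ofReal_im (p : ℝ) {x : ℝ} (hx : 0 ≤ x) : (airyF p x).im = 0 := by
  rw [airyF, ← ofReal_cpow hx]
  have : exp ((x : ℂ) ^ 3 / 3) = ((Real.exp (x ^ 3 / 3) : ℝ) : ℂ) := by push_cast; rfl
  rw [this, ← ofReal_mul, ofReal_im]

theorem rayH_zero_im {p β : ℝ} (hp : 1 ≤ p) (hβ : 0 < β) :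
    (rayH p β 0).im = (rayH p β 1).im := by
  have hd : ∀ θ ∈ Ioo (0 : ℝ) 1, HasDerivAt (fun θ => (rayH p β θ).im) 0 θ := by
    intro θ hθ
    have h := Complex.imCLM.hasFDerivAt.comp_hasDerivAt θ (hasDerivAt_rayH hp hβ hθ)
    refine HasDerivAt.congr_deriv h ?_
    rw [imCLM_apply, im_mul_ofReal, airyF_ofReal_im _ (mul_nonneg (by linarith [hθ.2]) hβ.le), zero_mul]
  obtain ⟨c, -, h⟩ := exists_hasDerivAt_eq_slope (fun θ => (rayH p β θ).im) (fun _ => 0)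
    zero_lt_one (Complex.continuous_im.comp_continuousOn (continuousOn_rayH (by linarith) hβ)) hd
  simp only [sub_zero, div_one] at h
  linarith

theorem integrable_exp_abs_sub_sq (A : ℝ) {b : ℝ} (hb : 0 < b) :
    Integrable (fun τ : ℝ => Real.exp (A * |τ| - b * τ ^ 2)) := by
  refine Integrable.mono' ((integrable_exp_neg_mul_sq (half_pos hb)).const_mul
    (Real.exp (A ^ 2 / (2 * b)))) (Continuous.aestronglyMeasurable (by fun_prop))
    (Eventually.of_forall fun τ => ?_)
  rw [Real.norm_eq_abs, Real.abs_exp, ← Real.exp_add, Real.exp_le_exp]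
  have h : 0 ≤ (A - b * |τ|) ^ 2 / (2 * b) := by positivity
  have h2 : (A - b * |τ|) ^ 2 / (2 * b) = A ^ 2 / (2 * b) - A * |τ| + b * |τ| ^ 2 / 2 := by
    field_simp
    ring
  rw [h2, sq_abs] at h
  linarith

theorem vert_re (β τ : ℝ) : (β + τ * I : ℂ).re = β := by simp

theorem vert_mem_slitPlane {β : ℝ} (hβ : 0 < β) (τ : ℝ) : (β + τ * I : ℂ) ∈ slitPlane := by
  rw [mem_slitPlane_iff, vert_re]
  exact Or.inl hβ

theorem le_norm_vert (β τ : ℝ) : β ≤ ‖(β + τ * I : ℂ)‖ := by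
  conv_lhs => rw [← vert_re β τ]
  exact re_le_norm _

theorem norm_vert_le {β : ℝ} (hβ : 0 < β) (τ : ℝ) : ‖(β + τ * I : ℂ)‖ ≤ β + |τ| := by
  refine (norm_add_le _ _).trans ?_
  simp [abs_of_pos hβ]

theorem norm_sq_vert (β τ : ℝ) : ‖(β + τ * I : ℂ)‖ ^ 2 = β ^ 2 + τ ^ 2 := by
  rw [Complex.sq_norm, normSq_apply]
  simp
  ring

theorem vert_cube_re (β τ : ℝ) : ((β + τ * I : ℂ) ^ 3 / 3).re = β ^ 3 / 3 - β * τ ^ 2 := by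
  have h2 : (β + τ * I : ℂ) ^ 3 / 3 = ((1 / 3 : ℝ) : ℂ) * (β + τ * I) ^ 3 := by push_cast; ring
  rw [h2, re_ofReal_mul, pow_succ, pow_two]
  simp only [mul_re, mul_im, add_re, add_im, ofReal_re, ofReal_im, I_re, I_im]
  ring

theorem norm_airyF_vert (p β τ : ℝ) :
    ‖airyF p (β + τ * I)‖ = ‖(β + τ * I : ℂ)‖ ^ p * Real.exp (β ^ 3 / 3 - β * τ ^ 2) := by
  rw [airyF, norm_mul, norm_cpow_real, norm_exp, vert_cube_re]

theorem hasDerivAt_vert (β τ : ℝ) : HasDerivAt (fun τ : ℝ => (β + τ * I : ℂ)) I τ := by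
  have h0 : HasDerivAt (fun θ : ℝ => (θ : ℂ)) 1 τ := Complex.ofRealCLM.hasDerivAt
  exact ((h0.mul_const I).const_add (β : ℂ)).congr_deriv (one_mul _)

theorem hasDerivAt_airyF_vert (p : ℝ) {β : ℝ} (hβ : 0 < β) (τ : ℝ) :
    HasDerivAt (fun τ : ℝ => airyF p (β + τ * I)) (airyF' p (β + τ * I) * I) τ :=
  HasDerivAt.comp (h := fun τ : ℝ => (β + τ * I : ℂ)) τ
    (hasDerivAt_airyF p (vert_mem_slitPlane hβ τ)) (hasDerivAt_vert β τ)

theorem continuous_airyF_vert (p : ℝ) {β : ℝ} (hβ : 0 < β) :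
    Continuous (fun τ : ℝ => airyF p (β + τ * I)) :=
  continuous_iff_continuousAt.2 fun τ => (hasDerivAt_airyF_vert p hβ τ).continuousAt

theorem integrable_airyF_vert (p : ℝ) {β : ℝ} (hβ : 0 < β) :
    Integrable (fun τ : ℝ => airyF p (β + τ * I)) := by
  obtain ⟨K, hK, h⟩ := exists_rpow_le_exp p hβ
  refine Integrable.mono' ((integrable_exp_abs_sub_sq 1 hβ).const_mul
    (K * Real.exp (β + β ^ 3 / 3))) (continuous_airyF_vert p hβ).aestronglyMeasurable
    (Eventually.of_forall fun τ => ?_)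
  rw [norm_airyF_vert]
  calc _ ≤ K * Real.exp (β + |τ|) * Real.exp (β ^ 3 / 3 - β * τ ^ 2) := by
        gcongr
        refine (h _ (le_norm_vert β τ)).trans ?_
        gcongr
        exact norm_vert_le hβ τ
    _ = _ := by
        rw [mul_assoc, mul_assoc, ← Real.exp_add, ← Real.exp_add]
        ring_nf

/-- The integral of `s^{1-y} e^{s³/3}` along a vertical line. -/
noncomputable def airyJ (y β : ℝ) : ℂ := ∫ τ : ℝ, airyF (1 - y) (β + τ * I)

theorem airyF'_eq (p : ℝ) {s : ℂ} (hs : s ≠ 0) :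
    airyF' p s = p * airyF (p - 1) s + airyF (p + 2) s := by
  have : s ^ ((p + 2 : ℝ) : ℂ) = s ^ (p : ℂ) * s ^ 2 := by
    push_cast
    rw [cpow_add _ _ hs, cpow_ofNat]
  rw [airyF', airyF, airyF, this]
  ring

theorem airyJ_sub_three (y : ℝ) {β : ℝ} (hβ : 0 < β) :
    airyJ (y - 3) β = (y - 2) * airyJ y β := by
  have e : ∀ τ : ℝ, airyF' (2 - y) (β + τ * I) * I =
      (((2 - y : ℝ) : ℂ) * airyF (1 - y) (β + τ * I) + airyF (1 - (y - 3)) (β + τ * I)) * I := by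
    intro τ
    rw [airyF'_eq _ (slitPlane_ne_zero (vert_mem_slitPlane hβ τ))]
    ring_nf
  have hi := (((integrable_airyF_vert (1 - y) hβ).const_mul ((2 - y : ℝ) : ℂ)).add
    (integrable_airyF_vert (1 - (y - 3)) hβ)).mul_const I
  have h := integral_eq_zero_of_hasDerivAt_of_integrable (hasDerivAt_airyF_vert (2 - y) hβ)
    (by simp_rw [e]; exact hi) (integrable_airyF_vert (2 - y) hβ)
  simp_rw [e] at h
  rw [integral_mul_const, integral_add ((integrable_airyF_vert (1 - y) hβ).const_mul _)
    (integrable_airyF_vert (1 - (y - 3)) hβ), integral_const_mul] at h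
  have h' := (mul_eq_zero.1 h).resolve_right I_ne_zero
  rw [airyJ, airyJ]
  push_cast at h' ⊢
  linear_combination h'

theorem airyF_conj (p : ℝ) {s : ℂ} (hs : s ∈ slitPlane) :
    airyF p ((starRingEnd ℂ) s) = (starRingEnd ℂ) (airyF p s) := by
  have h := cpow_conj s (p : ℂ) (slitPlane_arg_ne_pi hs)
  rw [conj_ofReal] at h
  have h3 : (starRingEnd ℂ) (3 : ℂ) = 3 := Complex.conj_ofNat 3
  rw [airyF, airyF, map_mul, ← exp_conj, h, conj_conj, map_div₀, map_pow, h3]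

theorem airyJ_eq_rayH_zero (y : ℝ) {β : ℝ} (hβ : 0 < β) :
    airyJ y β = ((2 * (rayH (1 - y) β 0).im : ℝ) : ℂ) := by
  have hi := integrable_airyF_vert (1 - y) hβ
  have hc : ∀ τ : ℝ, airyF (1 - y) (β + (-τ : ℝ) * I) =
      (starRingEnd ℂ) (airyF (1 - y) (β + τ * I)) := by
    intro τ
    rw [← airyF_conj _ (vert_mem_slitPlane hβ τ)]
    simp
  have h0 : rayH (1 - y) β 0 = (∫ τ in Ioi (0 : ℝ), airyF (1 - y) (β + τ * I)) * I := by
    rw [rayH, ← integral_mul_const]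
    simp [rayS, rayD]
  rw [airyJ, ← intervalIntegral.integral_Iic_add_Ioi (b := 0) hi.integrableOn hi.integrableOn,
    ← neg_zero, ← integral_comp_neg_Ioi 0 (fun τ : ℝ => airyF (1 - y) (β + τ * I)), neg_zero]
  simp_rw [hc]
  rw [integral_conj, h0, add_comm, add_conj, mul_I_im]

theorem rayH_one {p : ℝ} (hp : -1 < p) (β : ℝ) : (rayH p β 1).im =
    Real.sin (Real.pi * ((p + 1) / 3)) * ((3 : ℝ) ^ ((p + 1) / 3 - 1) * Real.Gamma ((p + 1) / 3)) := by
  have hl : log om = (Real.pi / 3 : ℝ) * I := by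
    rw [om, log_exp] <;> simp <;> linarith [Real.pi_pos]
  have ho : om ^ (p : ℂ) * om = exp ((Real.pi * ((p + 1) / 3) : ℝ) * I) := by
    have : om ≠ 0 := exp_ne_zero _
    rw [cpow_def_of_ne_zero this, hl]
    conv_lhs => enter [2]; rw [om]
    rw [← exp_add]
    congr 1
    push_cast
    ring
  have e : ∀ x ∈ Ioi (0 : ℝ), airyF p (rayS β 1 x) * rayD 1 =
      ((x ^ p * Real.exp (-(1 / 3) * x ^ (3 : ℝ)) : ℝ) : ℂ) * (om ^ (p : ℂ) * om) := by
    intro x hx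
    have hx' : (0 : ℝ) < x := hx
    have hs : rayS β 1 x = x * om := by simp [rayS, rayD]
    have hd : rayD 1 = om := by simp [rayD]
    have h3 : (x * om : ℂ) ^ 3 / 3 = ((-(1 / 3) * x ^ 3 : ℝ) : ℂ) := by
      rw [mul_pow, om_pow_three]
      push_cast
      ring
    have hm : (x * om : ℂ) ^ (p : ℂ) = ((x ^ p : ℝ) : ℂ) * om ^ (p : ℂ) := by
      have h0 : om ≠ 0 := exp_ne_zero _
      have hx0 : (x : ℂ) ≠ 0 := by exact_mod_cast hx'.ne'
      rw [cpow_def_of_ne_zero (mul_ne_zero hx0 h0), log_ofReal_mul hx' h0, add_mul, exp_add,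
        cpow_def_of_ne_zero h0, ofReal_cpow hx'.le, cpow_def_of_ne_zero hx0, ofReal_log hx'.le]
    rw [hs, hd, airyF, h3, hm, ← ofReal_exp, show (3 : ℝ) = (3 : ℕ) by norm_num, Real.rpow_natCast]
    push_cast
    ring
  rw [rayH, setIntegral_congr_fun measurableSet_Ioi e, integral_mul_const, integral_complex_ofReal,
    _root_.integral_rpow_mul_exp_neg_mul_rpow (by norm_num) hp (by norm_num), ho, im_ofReal_mul,
    exp_ofReal_mul_I_im, Real.rpow_sub_one (by norm_num), one_div, Real.inv_rpow (by norm_num),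
    neg_div, Real.rpow_neg (by norm_num), inv_inv]
  ring

theorem sin_mul_Gamma {z : ℝ} (hz : 0 < z) :
    Real.sin (Real.pi * z) * Real.Gamma z = Real.pi * (Real.Gamma (1 - z))⁻¹ := by
  have h := Real.Gamma_mul_Gamma_one_sub z
  have hG := (Real.Gamma_pos_of_pos hz).ne'
  by_cases hs : Real.sin (Real.pi * z) = 0
  · rw [hs, div_zero] at h
    rw [(mul_eq_zero.1 h).resolve_left hG, hs]
    simp
  · have h1 : Real.Gamma (1 - z) ≠ 0 := by
      intro h1
      rw [h1, mul_zero] at h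
      exact div_ne_zero Real.pi_ne_zero hs h.symm
    rw [eq_div_iff hs] at h
    rw [← div_eq_mul_inv, eq_div_iff h1]
    linarith

theorem airyJ_of_nonpos {y β : ℝ} (hy : y ≤ 0) (hβ : 0 < β) : airyJ y β =
    ((2 * Real.pi * ((3 : ℝ) ^ (-((y + 1) / 3)) * (Real.Gamma ((y + 1) / 3))⁻¹) : ℝ) : ℂ) := by
  rw [airyJ_eq_rayH_zero y hβ, rayH_zero_im (by linarith) hβ, rayH_one (by linarith)]
  congr 1
  have h := sin_mul_Gamma (z := (1 - y + 1) / 3) (by linarith)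
  rw [show 1 - (1 - y + 1) / 3 = (y + 1) / 3 by ring] at h
  rw [show (1 - y + 1) / 3 - 1 = -((y + 1) / 3) by ring]
  linear_combination 2 * (3 : ℝ) ^ (-((y + 1) / 3)) * h

theorem inv_Gamma_sub_one (w : ℝ) :
    (Real.Gamma (w - 1))⁻¹ = (w - 1) * (Real.Gamma w)⁻¹ := by
  by_cases h : w - 1 = 0
  · rw [h]
    simp
  · have := Real.Gamma_add_one h
    rw [sub_add_cancel] at this
    rw [this, mul_inv]
    field_simp

theorem airyJ_eq {y β : ℝ} (hy : ∀ k : ℤ, y ≠ k) (hβ : 0 < β) : airyJ y β =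
    ((2 * Real.pi * ((3 : ℝ) ^ (-((y + 1) / 3)) * (Real.Gamma ((y + 1) / 3))⁻¹) : ℝ) : ℂ) := by
  obtain ⟨m, hm⟩ := exists_nat_ge (y / 3)
  replace hm : y ≤ 3 * m := by linarith
  induction m generalizing y with
  | zero => exact airyJ_of_nonpos (by simpa using hm) hβ
  | succ m ih =>
    push_cast at hm
    have h := ih (y := y - 3) (fun k hk => hy (k + 3) (by push_cast; linarith)) (by linarith)
    rw [airyJ_sub_three y hβ, show (y - 3 + 1) / 3 = (y + 1) / 3 - 1 by ring, inv_Gamma_sub_one,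
      show -((y + 1) / 3 - 1) = -((y + 1) / 3) + 1 by ring, Real.rpow_add_one (by norm_num)] at h
    have h2 : (y - 2 : ℂ) ≠ 0 := by
      have := sub_ne_zero.2 (hy 2)
      intro h0
      apply this
      push_cast
      exact_mod_cast h0
    apply mul_left_cancel₀ h2
    rw [h]
    push_cast
    ring

/-- `Afun` as an integral along a vertical line. -/
theorem Afun_eq_integral {y lam β : ℝ} (hy : ∀ k : ℤ, y ≠ k) (hβ : |lam| / 2 < β) :
    ((Afun y lam : ℝ) : ℂ) = (Real.exp (-lam ^ 3 / 6) / (2 * Real.pi) : ℝ) *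
      ∫ τ : ℝ, airyF (1 - y) (β + τ * I) * exp (lam * (β + τ * I) ^ 2 / 2) := by
  have hβ0 : 0 < β := (by positivity : 0 ≤ |lam| / 2).trans_lt hβ
  obtain ⟨K, hK, hKb⟩ := exists_rpow_le_exp (1 - y) hβ0
  set F : ℕ → ℝ → ℂ := fun k τ => (lam / 2) ^ k / k.factorial * airyF (1 - (y - 2 * k)) (β + τ * I)
    with hF
  have hFe : ∀ k τ, F k τ = airyF (1 - y) (β + τ * I) *
      ((lam * (β + τ * I) ^ 2 / 2) ^ k / k.factorial) := by
    intro k τ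
    have h0 := slitPlane_ne_zero (vert_mem_slitPlane hβ0 τ)
    have : (β + τ * I : ℂ) ^ ((1 - (y - 2 * k) : ℝ) : ℂ) =
        (β + τ * I : ℂ) ^ ((1 - y : ℝ) : ℂ) * (β + τ * I) ^ (2 * k) := by
      rw [← cpow_natCast, ← cpow_add _ _ h0]
      congr 1
      push_cast
      ring
    rw [hF]
    simp only [airyF, this]
    rw [pow_mul]
    simp only [mul_pow, div_pow]
    ring
  have hInt : ∀ k, Integrable (F k) := fun k => (integrable_airyF_vert _ hβ0).const_mul _
  set G : ℝ → ℝ := fun τ => ‖airyF (1 - y) (β + τ * I)‖ *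
    Real.exp (|lam| * ‖(β + τ * I : ℂ)‖ ^ 2 / 2) with hG
  have hnF : ∀ k τ, ‖F k τ‖ = ‖airyF (1 - y) (β + τ * I)‖ *
      ((|lam| * ‖(β + τ * I : ℂ)‖ ^ 2 / 2) ^ k / k.factorial) := by
    intro k τ
    rw [hFe]
    simp
  have hGi : Integrable G := by
    refine Integrable.mono' ((integrable_exp_abs_sub_sq 1 (sub_pos.2 hβ)).const_mul
      (K * Real.exp (β + β ^ 3 / 3 + |lam| * β ^ 2 / 2)))
      (Continuous.aestronglyMeasurable ((continuous_airyF_vert _ hβ0).norm.mul (by fun_prop)))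
      (Eventually.of_forall fun τ => ?_)
    rw [hG]
    simp only [norm_mul, norm_norm]
    rw [Real.norm_eq_abs, Real.abs_exp, norm_airyF_vert, norm_sq_vert]
    calc _ ≤ K * Real.exp (β + |τ|) * Real.exp (β ^ 3 / 3 - β * τ ^ 2) *
          Real.exp (|lam| * (β ^ 2 + τ ^ 2) / 2) := by
          gcongr
          refine (hKb _ (le_norm_vert β τ)).trans ?_
          gcongr
          exact norm_vert_le hβ0 τ
      _ = _ := by
          rw [mul_assoc, mul_assoc, mul_assoc, ← Real.exp_add, ← Real.exp_add, ← Real.exp_add]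
          ring_nf
  have hs : Integrable (fun τ => ∑' k, ‖F k τ‖) := by
    refine hGi.congr (Eventually.of_forall fun τ => ?_)
    simp_rw [hnF]
    rw [tsum_mul_left, hG, Real.exp_eq_exp_ℝ, NormedSpace.exp_eq_tsum_div]
  have hsum := hasSum_integral_of_summable_integral_norm hInt (by
    have hnn : ∀ m : ℕ, ∑ k ∈ Finset.range m, ∫ τ, ‖F k τ‖ ≤ ∫ τ, G τ := by
      intro m
      rw [← integral_finsetSum _ fun k _ => (hInt k).norm]
      refine integral_mono (integrable_finsetSum _ fun k _ => (hInt k).norm) hGi fun τ => ?_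
      simp_rw [hnF]
      rw [← Finset.mul_sum]
      exact mul_le_mul_of_nonneg_left (Real.sum_le_exp_of_nonneg (by positivity) m) (norm_nonneg _)
    exact summable_of_sum_range_le (fun k => integral_nonneg fun τ => norm_nonneg _) hnn)
  have hterm : ∀ k, ∫ τ, F k τ = (((lam / 2) ^ k / k.factorial * (2 * Real.pi *
      ((3 : ℝ) ^ (-((y - 2 * k + 1) / 3)) * (Real.Gamma ((y - 2 * k + 1) / 3))⁻¹)) : ℝ) : ℂ) := by
    intro k
    have h := airyJ_eq (y := y - 2 * k) (fun j hj => hy (j + 2 * k) (by push_cast; linarith)) hβ0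
    rw [airyJ] at h
    rw [hF]
    simp only
    rw [integral_const_mul, h]
    push_cast
    ring
  have hval : ∀ τ : ℝ, ∑' k, F k τ =
      airyF (1 - y) (β + τ * I) * exp (lam * (β + τ * I) ^ 2 / 2) := by
    intro τ
    simp_rw [hFe]
    rw [tsum_mul_left, exp_eq_exp_ℂ, NormedSpace.exp_eq_tsum_div]
  simp_rw [hterm, hval] at hsum
  rw [← hsum.tsum_eq, ← ofReal_tsum, ← ofReal_mul]
  congr 1
  rw [Afun, ← tsum_mul_left, ← tsum_mul_left]
  refine tsum_congr fun k => ?_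
  have h3 : (3 : ℝ) ^ (-((y - 2 * k + 1) / 3)) =
      ((3 : ℝ) ^ ((2 : ℝ) / 3)) ^ k / (3 : ℝ) ^ ((y + 1) / 3) := by
    rw [← Real.rpow_natCast, ← Real.rpow_mul (by norm_num), ← Real.rpow_sub (by norm_num)]
    ring_nf
  rw [h3, show y - 2 * (k : ℝ) + 1 = y + 1 - 2 * k by ring]
  have hpi := Real.pi_ne_zero
  rw [mul_div_assoc, mul_pow]
  field_simp

end

section

open Set MeasureTheory

theorem abs_exp_neg_sub_le {u : ℝ} (h0 : 0 ≤ u) (h1 : u ≤ 1) :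
    |Real.exp (-u) - (1 - u + u ^ 2 / 2 - u ^ 3 / 6)| ≤ u ^ 4 * (5 / 96) := by
  have h := Real.exp_bound (x := -u) (by rwa [abs_neg, abs_of_nonneg h0]) (n := 4) (by norm_num)
  rw [abs_neg, abs_of_nonneg h0] at h
  convert h using 2
  · simp [Finset.sum_range_succ, Nat.factorial]
    ring
  · norm_num [Nat.factorial]

theorem base_exponent_le {u x : ℝ} (h0 : 0 < u) (h1 : u ≤ 1 / 100) (hx : |x| ≤ u / 100) :
    Real.exp (-u) - 1 + u - (1 - Real.exp (-u)) ^ 2 / (2 * (1 + x)) ≤ 343 / 1000 * u ^ 3 := by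
  have h := abs_le.1 (abs_exp_neg_sub_le h0.le (by linarith))
  set ρ := Real.exp (-u)
  obtain ⟨hx1, hx2⟩ := abs_le.1 hx
  have hu4 : u ^ 4 ≤ u ^ 3 / 100 := by
    have : 0 ≤ u ^ 3 := by positivity
    nlinarith
  have hu3 : 0 < u ^ 3 := by positivity
  have hu2 : u ^ 3 ≤ u ^ 2 / 100 := by nlinarith [sq_nonneg u]
  have hw : u - u ^ 2 / 2 ≤ 1 - ρ := by linarith
  have hw0 : 0 ≤ u - u ^ 2 / 2 := by nlinarith
  have hw2 : u ^ 2 - u ^ 3 ≤ (1 - ρ) ^ 2 := by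
    have := pow_le_pow_left₀ hw0 hw 2
    nlinarith [sq_nonneg (u ^ 2)]
  have hd : (u ^ 2 - u ^ 3) * (1 - u / 100) / 2 ≤ (1 - ρ) ^ 2 / (2 * (1 + x)) := by
    rw [le_div_iff₀ (by linarith)]
    have h3 : (1 - u / 100) * (1 + x) ≤ 1 := by nlinarith
    have h4 : 0 ≤ u ^ 2 - u ^ 3 := by nlinarith
    nlinarith
  nlinarith

theorem real_exponent_le {u x θ : ℝ} (h0 : 0 < u) (h1 : u ≤ 1 / 100) (hx : |x| ≤ u / 100)
    (hθ : |θ| ≤ Real.pi) :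
    Real.exp (-u) * Real.cos θ - 1 + u -
      (1 - 2 * Real.exp (-u) * Real.cos θ + Real.exp (-u) ^ 2 * Real.cos (2 * θ)) /
        (2 * (1 + x)) ≤ 343 / 1000 * u ^ 3 - u * θ ^ 2 / 10 := by
  have hb := base_exponent_le h0 h1 hx
  have h := abs_le.1 (abs_exp_neg_sub_le h0.le (by linarith))
  have hρ0 := Real.exp_pos (-u)
  set ρ := Real.exp (-u)
  obtain ⟨hx1, hx2⟩ := abs_le.1 hx
  have hρ : 99 / 100 ≤ ρ := by
    have := Real.add_one_le_exp (-u)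
    linarith
  have hw : 199 / 100 * u ≤ 2 * (1 - ρ) := by
    have hu4 : u ^ 4 ≤ u ^ 3 / 100 := by
      have : 0 ≤ u ^ 3 := by positivity
      nlinarith
    have hu3 : 0 < u ^ 3 := by positivity
    nlinarith
  have hc : 1 / 5 * θ ^ 2 ≤ 1 - Real.cos θ := by
    have h2 := Real.cos_le_one_sub_mul_cos_sq hθ
    have h3 : 1 / 5 ≤ 2 / Real.pi ^ 2 := by
      rw [div_le_div_iff₀ (by norm_num) (by positivity)]
      nlinarith [Real.pi_lt_d2, Real.pi_pos]
    nlinarith [sq_nonneg θ]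
  set c := 1 - Real.cos θ with hcd
  have hc0 : 0 ≤ c := (by positivity : 0 ≤ 1 / 5 * θ ^ 2).trans hc
  have e1 : Real.cos θ = 1 - c := by rw [hcd]; ring
  have e2 : Real.cos (2 * θ) = 1 - 4 * c + 2 * c ^ 2 := by
    rw [Real.cos_two_mul, e1]
    ring
  have hx0 : 0 < 1 + x := by linarith
  have e : ρ * Real.cos θ - 1 + u -
      (1 - 2 * ρ * Real.cos θ + ρ ^ 2 * Real.cos (2 * θ)) / (2 * (1 + x)) =
      (ρ - 1 + u - (1 - ρ) ^ 2 / (2 * (1 + x))) -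
        ρ * c * ((2 * (1 - ρ) + x + ρ * c) / (1 + x)) := by
    rw [e2, e1]
    field_simp
    ring
  rw [e]
  have h5 : 19 / 10 * u ≤ (2 * (1 - ρ) + x + ρ * c) / (1 + x) := by
    rw [le_div_iff₀ hx0]
    have : 0 ≤ ρ * c := by positivity
    nlinarith
  have h6 : 99 / 100 * (1 / 5 * θ ^ 2) * (19 / 10 * u) ≤
      ρ * c * ((2 * (1 - ρ) + x + ρ * c) / (1 + x)) := by gcongr
  have : 0 ≤ θ ^ 2 * u := by positivity
  nlinarith

/-- The point of the circle of integration. -/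
noncomputable def circE (ν β τ : ℝ) : ℂ := Complex.exp (-(ν * (β + τ * Complex.I)))

/-- The exponent in the circle integral. -/
noncomputable def circX (n ν a β τ : ℝ) : ℂ :=
  n * (circE ν β τ - 1 + ν * (β + τ * Complex.I)) - (1 - circE ν β τ) ^ 2 / (2 * a)

/-- The rescaled integrand of the circle integral. -/
noncomputable def circI (n ν a β : ℝ) (r : ℕ) (τ : ℝ) : ℂ :=
  ((1 - circE ν β τ) / ν) * ((1 - circE ν β τ ^ 2) / ν) ^ (-(1 / 4) : ℂ) *
    (a ^ r * cR r (circE ν β τ)) * Complex.exp (circX n ν a β τ)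

theorem circE_eq (ν β τ : ℝ) : circE ν β τ = ((Real.exp (-(ν * β)) : ℝ) : ℂ) *
    Complex.exp (((-(ν * τ) : ℝ) : ℂ) * Complex.I) := by
  rw [circE, Complex.ofReal_exp, ← Complex.exp_add]
  congr 1
  push_cast
  ring

theorem circE_re (ν β τ : ℝ) :
    (circE ν β τ).re = Real.exp (-(ν * β)) * Real.cos (ν * τ) := by
  rw [circE_eq, Complex.re_ofReal_mul, Complex.exp_ofReal_mul_I_re, Real.cos_neg]

theorem circE_sq (ν β τ : ℝ) : circE ν β τ ^ 2 = circE (2 * ν) β τ := by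
  rw [circE, circE, ← Complex.exp_nat_mul]
  congr 1
  push_cast
  ring

theorem norm_circE (ν β τ : ℝ) : ‖circE ν β τ‖ = Real.exp (-(ν * β)) := by
  rw [circE_eq, norm_mul, Complex.norm_exp_ofReal_mul_I, mul_one, Complex.norm_real,
    Real.norm_eq_abs, Real.abs_exp]

theorem norm_one_sub_circE_le {ν β τ : ℝ} (hν : 0 < ν) (hβ : 0 < β) :
    ‖(1 - circE ν β τ) / ν‖ ≤ β + |τ| := by
  have hr := circE_re ν β τ
  have hnorm := norm_circE ν β τ
  rw [norm_div, Complex.norm_real, Real.norm_eq_abs, abs_of_pos hν, div_le_iff₀ hν]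
  refine abs_le_of_sq_le_sq' ?_ (by positivity) |>.2
  have e : ‖1 - circE ν β τ‖ ^ 2 = 1 - 2 * (circE ν β τ).re + ‖circE ν β τ‖ ^ 2 := by
    rw [Complex.sq_norm, Complex.sq_norm, Complex.normSq_apply, Complex.normSq_apply]
    simp
    ring
  rw [e, hr, hnorm]
  set u := ν * β with hu
  have hu0 : 0 < u := by positivity
  have h1 := Real.add_one_le_exp (-u)
  have h2 : Real.exp (-u) ≤ 1 := Real.exp_le_one_iff.2 (by linarith)
  have h0 := Real.exp_pos (-u)
  have h3 := Real.one_sub_sq_div_two_le_cos (x := ν * τ)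
  set ρ := Real.exp (-u)
  calc 1 - 2 * (ρ * Real.cos (ν * τ)) + ρ ^ 2
      = (1 - ρ) ^ 2 + 2 * ρ * (1 - Real.cos (ν * τ)) := by ring
    _ ≤ u ^ 2 + 2 * 1 * ((ν * τ) ^ 2 / 2) := by
        gcongr
        · linarith
        · linarith [Real.cos_le_one (ν * τ)]
        · linarith
    _ = (ν * β) ^ 2 + ν ^ 2 * |τ| ^ 2 := by rw [sq_abs, hu]; ring
    _ ≤ _ := by
        have : 0 ≤ ν ^ 2 * (β * |τ|) := by positivity
        nlinarith

theorem circE_mem {ν β : ℝ} (hν : 0 < ν) (hβ : 0 < β) (τ : ℝ) :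
    0 < ((1 - circE ν β τ) / ν).re := by
  rw [Complex.div_ofReal_re, Complex.sub_re, Complex.one_re]
  have h := (Complex.re_le_norm (circE ν β τ))
  rw [norm_circE] at h
  have : Real.exp (-(ν * β)) < 1 := Real.exp_lt_one_iff.2 (neg_lt_zero.2 (mul_pos hν hβ))
  exact div_pos (by linarith) hν

theorem circX_re {n ν a β τ x : ℝ} (hn : n ≠ 0) (ha : a * n = 1 + x) (h0 : 1 + x ≠ 0) :
    (circX n ν a β τ).re = n * (Real.exp (-(ν * β)) * Real.cos (ν * τ) - 1 + ν * β -
      (1 - 2 * Real.exp (-(ν * β)) * Real.cos (ν * τ) +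
        Real.exp (-(ν * β)) ^ 2 * Real.cos (2 * (ν * τ))) / (2 * (1 + x))) := by
  have ha' : a = (1 + x) / n := by rw [← ha]; field_simp
  have e : circX n ν a β τ = (n : ℂ) * (circE ν β τ - 1 + ν * β + (ν * τ : ℝ) * Complex.I -
      ((1 / (2 * (1 + x)) : ℝ) : ℂ) * (1 - 2 * circE ν β τ + circE (2 * ν) β τ)) := by
    rw [circX, ha', ← circE_sq]
    have hn' : (n : ℂ) ≠ 0 := by exact_mod_cast hn
    have h0' : (1 + x : ℂ) ≠ 0 := by exact_mod_cast h0
    push_cast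
    field_simp
    ring
  rw [e, Complex.re_ofReal_mul, Complex.sub_re, Complex.re_ofReal_mul]
  have h2 : Real.exp (-(2 * ν * β)) = Real.exp (-(ν * β)) ^ 2 := by
    rw [← Real.exp_nat_mul]
    congr 1
    push_cast
    ring
  have h3 : 2 * circE ν β τ = ((2 : ℝ) : ℂ) * circE ν β τ := by push_cast; rfl
  rw [h3]
  simp only [Complex.add_re, Complex.sub_re, circE_re, Complex.one_re, Complex.re_ofReal_mul,
    Complex.ofReal_re, Complex.I_re, h2, mul_zero, add_zero, ← mul_assoc]
  ring

theorem circX_re_le {n ν a β τ x : ℝ} (hn : n * ν ^ 3 = 1) (ha : a * n = 1 + x) (hν : 0 < ν)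
    (hβ : 1 ≤ β) (h1 : ν * β ≤ 1 / 100) (hx : |x| ≤ ν * β / 100) (hτ : |τ| ≤ Real.pi / ν) :
    (circX n ν a β τ).re ≤ 343 / 1000 * β ^ 3 - τ ^ 2 / 10 := by
  have hn0 : 0 < n := by
    by_contra h
    have : n * ν ^ 3 ≤ 0 := mul_nonpos_of_nonpos_of_nonneg (not_lt.1 h) (by positivity)
    linarith
  obtain ⟨hx1, hx2⟩ := abs_le.1 hx
  rw [circX_re hn0.ne' ha (by linarith)]
  have hθ : |ν * τ| ≤ Real.pi := by
    rw [abs_mul, abs_of_pos hν, mul_comm]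
    rwa [le_div_iff₀ hν] at hτ
  have h := real_exponent_le (by positivity) h1 hx hθ
  calc _ ≤ n * (343 / 1000 * (ν * β) ^ 3 - ν * β * (ν * τ) ^ 2 / 10) := by gcongr
    _ = (n * ν ^ 3) * (343 / 1000 * β ^ 3 - β * τ ^ 2 / 10) := by ring
    _ ≤ _ := by
      rw [hn, one_mul]
      nlinarith [sq_nonneg τ]

theorem norm_kappa_le {ν β τ : ℝ} (hν : 0 < ν) (hβ : 1 ≤ β) (h1 : ν * β ≤ 1 / 100) :
    ‖((1 - circE ν β τ ^ 2) / ν) ^ (-(1 / 4) : ℂ)‖ ≤ 1 := by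
  have e : (-(1 / 4) : ℂ) = ((-(1 / 4) : ℝ) : ℂ) := by push_cast; rfl
  rw [e, Complex.norm_cpow_real]
  refine Real.rpow_le_one_of_one_le_of_nonpos ?_ (by norm_num)
  rw [norm_div, Complex.norm_real, Real.norm_eq_abs, abs_of_pos hν, le_div_iff₀ hν, one_mul]
  have h := norm_sub_norm_le 1 (circE ν β τ ^ 2)
  rw [norm_one, norm_pow, norm_circE] at h
  refine le_trans ?_ h
  have hu : 0 < ν * β := by positivity
  have h2 : ν ≤ ν * β := le_mul_of_one_le_right hν.le hβ
  have h3 := abs_le.1 (abs_exp_neg_sub_le hu.le (by linarith))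
  set u := ν * β
  set ρ := Real.exp (-u)
  have hu3 : 0 < u ^ 3 := by positivity
  have hu4 : u ^ 4 ≤ u ^ 3 / 100 := by nlinarith
  have h4 : ρ ≤ 1 - u + u ^ 2 / 2 := by linarith
  have h0 : 0 < ρ := Real.exp_pos _
  have h5 : ρ ≤ 1 := by nlinarith
  nlinarith

theorem norm_cR_circE_le {n ν a β τ x : ℝ} (r : ℕ) (hn : n * ν ^ 3 = 1) (ha : a * n = 1 + x)
    (hν : 0 < ν) (hβ : 1 ≤ β) (h1 : ν * β ≤ 1 / 100) (hx : |x| ≤ ν * β / 100)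
    (hr : 3 * r ≤ β ^ 3) :
    ‖(a ^ r * cR r (circE ν β τ) : ℂ)‖ ≤ (3 / 10) ^ r := by
  obtain ⟨hx1, hx2⟩ := abs_le.1 hx
  have ha' : a = (1 + x) * ν ^ 3 := by
    rw [← ha, mul_assoc, hn, mul_one]
  have ha0 : 0 ≤ a := by
    rw [ha']
    have : 0 ≤ 1 + x := by linarith
    positivity
  have hu : 0 < ν * β := by positivity
  have h3 := abs_le.1 (abs_exp_neg_sub_le hu.le (by linarith))
  set u := ν * β with hu'
  have hu3 : 0 < u ^ 3 := by positivity
  have hu4 : u ^ 4 ≤ u ^ 3 / 100 := by nlinarith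
  have h4 : Real.exp (-u) ≤ 1 - u + u ^ 2 / 2 := by linarith
  have hρ0 := Real.exp_pos (-u)
  have hδ : ‖circE ν β τ‖ ^ 2 ≤ 1 - 198 / 100 * u := by
    rw [norm_circE, ← hu']
    have := pow_le_pow_left₀ hρ0.le h4 2
    nlinarith
  rw [norm_mul, norm_pow, Complex.norm_real, Real.norm_eq_abs, abs_of_nonneg ha0]
  have h := norm_cR_le r (by positivity) hδ
  have hf : (r.factorial : ℝ) ≤ (β ^ 3 / 3) ^ r := by
    calc (r.factorial : ℝ) ≤ (r : ℝ) ^ r := by exact_mod_cast Nat.factorial_le_pow r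
      _ ≤ _ := by
        gcongr
        linarith
  have hexp : Real.exp (6 * (198 / 100 * u)) ≤ 1.14 := by
    have h6 : 6 * (198 / 100 * u) ≤ 0.12 := by linarith
    refine (Real.exp_le_exp.2 h6).trans ?_
    have := Real.exp_bound_div_one_sub_of_interval (x := 0.12) (by norm_num) (by norm_num)
    refine this.trans (by norm_num)
  calc _ ≤ a ^ r * ((β ^ 3 / 3) ^ r *
        (6 * Real.exp (6 * (198 / 100 * u)) / (198 / 100 * u) ^ 3) ^ r) := by
        gcongr
        refine h.trans ?_
        gcongr
    _ = (a * (β ^ 3 / 3) * (6 * Real.exp (6 * (198 / 100 * u)) / (198 / 100 * u) ^ 3)) ^ r := by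
        rw [mul_assoc a, mul_pow a, mul_pow (β ^ 3 / 3)]
    _ = ((1 + x) * (2 * Real.exp (6 * (198 / 100 * u)) / (198 / 100) ^ 3)) ^ r := by
        congr 1
        rw [ha', hu']
        field_simp
        ring
    _ ≤ (1.01 * (2 * 1.14 / (198 / 100) ^ 3)) ^ r := by
        have : 0 ≤ 1 + x := by linarith
        gcongr
        linarith
    _ ≤ _ := by
        gcongr
        norm_num

theorem norm_circI_le {n ν a β τ x : ℝ} (r : ℕ) (hn : n * ν ^ 3 = 1) (ha : a * n = 1 + x)
    (hν : 0 < ν) (hβ : 1 ≤ β) (h1 : ν * β ≤ 1 / 100) (hx : |x| ≤ ν * β / 100)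
    (hr : 3 * r ≤ β ^ 3) (hτ : |τ| ≤ Real.pi / ν) :
    ‖circI n ν a β r τ‖ ≤
      (β + |τ|) * (3 / 10) ^ r * Real.exp (343 / 1000 * β ^ 3 - τ ^ 2 / 10) := by
  rw [circI, norm_mul, norm_mul, norm_mul, Complex.norm_exp]
  have hβ0 : 0 < β := by linarith
  calc _ ≤ (β + |τ|) * 1 * (3 / 10) ^ r * Real.exp (343 / 1000 * β ^ 3 - τ ^ 2 / 10) := by
        gcongr
        · exact norm_one_sub_circE_le hν hβ0
        · exact norm_kappa_le hν hβ h1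
        · exact norm_cR_circE_le r hn ha hν hβ h1 hx hr
        · exact circX_re_le hn ha hν hβ h1 hx hτ
    _ = _ := by rw [mul_one]

end

section

open Set MeasureTheory Topology

/-- The scale `n^{-1/3}`. -/
noncomputable def nuS (n : ℕ) : ℝ := (n : ℝ) ^ (-(1 : ℝ) / 3)

/-- The edge probability. -/
noncomputable def pS (lam : ℝ) (n : ℕ) : ℝ := (1 + lam * nuS n) / n

/-- The parameter `a` with `e^{-a} = 1 - p`. -/
noncomputable def aS (lam : ℝ) (n : ℕ) : ℝ := -Real.log (1 - pS lam n)

/-- The deviation `a n - 1`. -/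
noncomputable def xS (lam : ℝ) (n : ℕ) : ℝ := aS lam n * n - 1

theorem nuS_pos {n : ℕ} (hn : 0 < n) : 0 < nuS n := Real.rpow_pos_of_pos (by exact_mod_cast hn) _

theorem mul_nuS_pow {n : ℕ} (hn : 0 < n) : (n : ℝ) * nuS n ^ 3 = 1 := by
  have h0 : (0 : ℝ) < n := by exact_mod_cast hn
  rw [nuS, ← Real.rpow_natCast, ← Real.rpow_mul h0.le]
  norm_num
  rw [Real.rpow_neg_one, mul_inv_cancel₀ h0.ne']

theorem tendsto_nuS : Tendsto nuS atTop (𝓝 0) := by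
  have h := (tendsto_rpow_neg_atTop (y := 1 / 3) (by norm_num)).comp
    (tendsto_natCast_atTop_atTop (R := ℝ))
  refine h.congr fun n => ?_
  simp only [Function.comp_apply, nuS]
  congr 1
  norm_num

theorem aS_mul (lam : ℝ) (n : ℕ) : aS lam n * n = 1 + xS lam n := by rw [xS]; ring

theorem mul_pS (lam : ℝ) {n : ℕ} (hn : 0 < n) : (n : ℝ) * pS lam n = 1 + lam * nuS n := by
  have h0 : (n : ℝ) ≠ 0 := by exact_mod_cast hn.ne'
  rw [pS]
  field_simp

theorem tendsto_one_add_lam_nuS (lam : ℝ) : Tendsto (fun n => 1 + lam * nuS n) atTop (𝓝 1) := by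
  simpa using (tendsto_nuS.const_mul lam).const_add 1

theorem tendsto_pS (lam : ℝ) : Tendsto (pS lam) atTop (𝓝 0) := by
  have h := (tendsto_one_add_lam_nuS lam).mul (tendsto_inv_atTop_nhds_zero_nat (𝕜 := ℝ))
  rw [mul_zero] at h
  exact h.congr fun n => by rw [pS, div_eq_mul_inv]

theorem eventually_pS (lam : ℝ) : ∀ᶠ n in atTop, 0 < n ∧ 0 < pS lam n ∧ pS lam n ≤ 1 / 2 := by
  filter_upwards [eventually_gt_atTop 0, (tendsto_pS lam).eventually_le_const (u := 1 / 2) (by norm_num),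
    (tendsto_one_add_lam_nuS lam).eventually_const_lt (u := 0) (by norm_num)] with n h1 h2 h3
  have h0 : (0 : ℝ) < n := by exact_mod_cast h1
  exact ⟨h1, by rw [pS]; positivity, h2⟩

theorem abs_aS_sub_le {lam : ℝ} {n : ℕ} (h0 : 0 < pS lam n) (h1 : pS lam n ≤ 1 / 2) :
    |aS lam n - pS lam n| ≤ 2 * pS lam n ^ 2 := by
  have h := Real.abs_log_sub_add_sum_range_le (x := pS lam n) (by
    rw [abs_of_pos h0]
    linarith) 1
  rw [Finset.sum_range_one, abs_of_pos h0] at h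
  rw [aS, abs_sub_comm]
  calc _ = |pS lam n ^ (0 + 1) / ((0 : ℕ) + 1) + Real.log (1 - pS lam n)| := by
        congr 1
        simp
    _ ≤ _ := h
    _ ≤ _ := by
      rw [div_le_iff₀ (by linarith)]
      norm_num
      nlinarith [sq_nonneg (pS lam n)]

theorem tendsto_xS_div (lam : ℝ) : Tendsto (fun n => xS lam n / nuS n) atTop (𝓝 lam) := by
  have hz : Tendsto (fun n => 2 * (1 + lam * nuS n) ^ 2 * nuS n ^ 2) atTop (𝓝 0) := by
    simpa using (((tendsto_one_add_lam_nuS lam).pow 2).const_mul 2).mul (tendsto_nuS.pow 2)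
  rw [tendsto_iff_norm_sub_tendsto_zero]
  refine squeeze_zero' (Eventually.of_forall fun n => norm_nonneg _) ?_ hz
  filter_upwards [eventually_pS lam] with n ⟨hn, h0, h1⟩
  have hν := nuS_pos hn
  have hn' : (0 : ℝ) < n := by exact_mod_cast hn
  have h := abs_aS_sub_le h0 h1
  have hp := mul_pS lam hn
  have h3 := mul_nuS_pow hn
  have e : xS lam n / nuS n - lam = (n : ℝ) * (aS lam n - pS lam n) / nuS n := by
    rw [mul_sub, hp, xS]
    field_simp
    ring
  rw [Real.norm_eq_abs, e, abs_div, abs_mul, abs_of_pos hν, abs_of_pos hn', div_le_iff₀ hν]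
  calc _ ≤ (n : ℝ) * (2 * pS lam n ^ 2) := by gcongr
    _ = 2 * ((n : ℝ) * pS lam n) ^ 2 * nuS n ^ 2 * nuS n := by
      linear_combination (-2 * (n : ℝ) * pS lam n ^ 2) * h3
    _ = _ := by rw [hp]

theorem tendsto_xS (lam : ℝ) : Tendsto (xS lam) atTop (𝓝 0) := by
  have h := (tendsto_xS_div lam).mul tendsto_nuS
  rw [mul_zero] at h
  refine h.congr' ?_
  filter_upwards [eventually_gt_atTop 0] with n hn
  have := (nuS_pos hn).ne'
  field_simp

/-- The function controlling the normalising constants. -/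
noncomputable def gK (x : ℝ) : ℝ := Real.log (1 + x) + (1 / (1 + x) - (1 + x)) / 2

theorem abs_gK_le {x : ℝ} (hx : |x| ≤ 1 / 2) : |gK x + x ^ 3 / 6| ≤ 3 * x ^ 4 := by
  have h := Real.abs_log_sub_add_sum_range_le (x := -x) (by rw [abs_neg]; linarith) 3
  rw [abs_neg, sub_neg_eq_add] at h
  obtain ⟨hx1, hx2⟩ := abs_le.1 hx
  have h0 : 0 < 1 + x := by linarith
  have h4 : |x| ^ 4 = x ^ 4 := by rw [← abs_pow, abs_of_nonneg (by positivity)]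
  have hd : |x| ^ (3 + 1) / (1 - |x|) ≤ 2 * x ^ 4 := by
    rw [div_le_iff₀ (by linarith), h4]
    nlinarith [mul_nonneg (by positivity : 0 ≤ x ^ 4) (by linarith : 0 ≤ 1 / 2 - |x|)]
  have e : gK x + x ^ 3 / 6 = (∑ i ∈ Finset.range 3, (-x) ^ (i + 1) / (i + 1 : ℝ) +
      Real.log (1 + x)) + x ^ 4 / (2 * (1 + x)) := by
    simp only [Finset.sum_range_succ, Finset.sum_range_zero, gK]
    push_cast
    field_simp
    ring
  have h5 : |x ^ 4 / (2 * (1 + x))| ≤ x ^ 4 := by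
    rw [abs_of_nonneg (by positivity), div_le_iff₀ (by linarith)]
    nlinarith [mul_nonneg (by positivity : 0 ≤ x ^ 4) (by linarith : 0 ≤ 1 / 2 + x)]
  rw [e]
  exact (abs_add_le _ _).trans (by linarith)

theorem tendsto_mul_gK (lam : ℝ) :
    Tendsto (fun n : ℕ => (n : ℝ) * gK (xS lam n)) atTop (𝓝 (-lam ^ 3 / 6)) := by
  have hx := tendsto_xS lam
  have hd := (tendsto_xS_div lam).pow 3
  have h1 : Tendsto (fun n : ℕ => (n : ℝ) * (gK (xS lam n) + xS lam n ^ 3 / 6)) atTop (𝓝 0) := by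
    have hz : Tendsto (fun n => 3 * |(xS lam n / nuS n) ^ 3 * xS lam n|) atTop (𝓝 0) := by
      simpa using ((hd.mul hx).abs).const_mul 3
    refine squeeze_zero_norm' ?_ hz
    filter_upwards [eventually_gt_atTop 0,
      hx.abs.eventually_le_const (u := 1 / 2) (by norm_num)] with n hn hxn
    have hn' : (0 : ℝ) < n := by exact_mod_cast hn
    have hν := (nuS_pos hn).ne'
    have h3 := mul_nuS_pow hn
    rw [norm_mul, Real.norm_eq_abs, Real.norm_eq_abs, abs_of_pos hn']
    calc _ ≤ (n : ℝ) * (3 * xS lam n ^ 4) := by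
          gcongr
          exact abs_gK_le hxn
      _ = 3 * |(n : ℝ) * xS lam n ^ 4| := by
          rw [abs_of_nonneg (by positivity)]
          ring
      _ = _ := by
          congr 2
          field_simp
          linear_combination xS lam n ^ 4 * h3
  have h2 := h1.sub (hd.div_const 6)
  rw [zero_sub, ← neg_div] at h2
  refine h2.congr' ?_
  filter_upwards [eventually_gt_atTop 0] with n hn
  have hν := (nuS_pos hn).ne'
  have h3 := mul_nuS_pow hn
  field_simp
  linear_combination xS lam n ^ 3 * h3

/-- The normalising constant. -/
noncomputable def kS (lam : ℝ) (n : ℕ) : ℝ :=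
  (n : ℝ) ^ ((1 : ℝ) / 12) * (n.factorial * Real.exp (-(aS lam n * (n * (n - 1) / 2)))) *
    (aS lam n ^ n * Real.exp (n + 1 / (2 * aS lam n)) * (nuS n / (2 * Real.pi))) *
    nuS n ^ ((3 : ℝ) / 4)

theorem kS_eq {lam : ℝ} {n : ℕ} (hn : 0 < n) (hx : 0 < 1 + xS lam n) :
    kS lam n = √2 * Stirling.stirlingSeq n *
      Real.exp (n * gK (xS lam n) + (1 + xS lam n) / 2) / (2 * Real.pi) := by
  have hn' : (0 : ℝ) < n := by exact_mod_cast hn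
  have ha : aS lam n = (1 + xS lam n) / n := by
    rw [← aS_mul]
    field_simp
  set x := xS lam n
  have hpow : (n : ℝ) ^ ((1 : ℝ) / 12) * nuS n * nuS n ^ ((3 : ℝ) / 4) = 1 / √n := by
    have h : 1 / √(n : ℝ) = (n : ℝ) ^ (-(1 / 2) : ℝ) := by
      rw [Real.rpow_neg hn'.le, Real.sqrt_eq_rpow, one_div]
    rw [h, nuS, ← Real.rpow_mul hn'.le, ← Real.rpow_add hn', ← Real.rpow_add hn']
    norm_num
  have hexp : Real.exp (n * gK x + (1 + x) / 2) = (1 + x) ^ n *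
      (Real.exp (-(aS lam n * (n * (n - 1) / 2))) * Real.exp (1 / (2 * aS lam n))) := by
    rw [← Real.exp_log (pow_pos hx n), Real.log_pow, ← Real.exp_add, ← Real.exp_add, gK, ha]
    congr 1
    field_simp
    ring
  have hs : Stirling.stirlingSeq n = n.factorial * Real.exp n / (√2 * √n * n ^ n) := by
    rw [Stirling.stirlingSeq, Real.sqrt_mul (by norm_num), div_pow, ← Real.exp_nat_mul, mul_one]
    field_simp
  have ha2 : aS lam n ^ n = (1 + x) ^ n / n ^ n := by rw [ha, div_pow]
  rw [hexp, hs, kS, Real.exp_add, ha2]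
  have h2 : √(2 : ℝ) ≠ 0 := by positivity
  calc _ = ((n : ℝ) ^ ((1 : ℝ) / 12) * nuS n * nuS n ^ ((3 : ℝ) / 4)) *
        (n.factorial * Real.exp n / n ^ n * ((1 + x) ^ n *
        (Real.exp (-(aS lam n * (n * (n - 1) / 2))) * Real.exp (1 / (2 * aS lam n)))) /
          (2 * Real.pi)) := by ring
    _ = _ := by
      rw [hpow]
      field_simp

theorem tendsto_kS (lam : ℝ) : Tendsto (kS lam) atTop
    (𝓝 (√(2 * Real.pi) * Real.exp (-lam ^ 3 / 6 + 1 / 2) / (2 * Real.pi))) := by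
  have hx := tendsto_xS lam
  have h1 : Tendsto (fun n => (1 + xS lam n) / 2) atTop (𝓝 (1 / 2)) := by
    simpa using (hx.const_add 1).div_const 2
  have h := ((Stirling.tendsto_stirlingSeq_sqrt_pi.const_mul √2).mul
    ((Real.continuous_exp.tendsto _).comp ((tendsto_mul_gK lam).add h1))).div_const (2 * Real.pi)
  rw [Real.sqrt_mul (by norm_num)]
  refine h.congr' ?_
  filter_upwards [eventually_gt_atTop 0, hx.eventually_const_lt (u := -1) (by norm_num)]
    with n hn hxn
  rw [kS_eq hn (by linarith)]
  rfl

theorem ofReal_mul_cpow {x : ℝ} (hx : 0 < x) {w : ℂ} (hw : w ≠ 0) (c : ℂ) :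
    ((x : ℂ) * w) ^ c = (x : ℂ) ^ c * w ^ c := by
  have hx' : (x : ℂ) ≠ 0 := by exact_mod_cast hx.ne'
  rw [Complex.cpow_def_of_ne_zero (mul_ne_zero hx' hw), Complex.cpow_def_of_ne_zero hx',
    Complex.cpow_def_of_ne_zero hw, Complex.log_ofReal_mul hx hw, ← Complex.exp_add,
    Complex.ofReal_log hx.le]
  congr 1
  ring

/-- The rescaled Taylor remainder of order three of the exponential. -/
noncomputable def expRem (s : ℂ) (ν : ℝ) : ℂ :=
  (Complex.exp (-(ν * s)) - (1 - ν * s + ν ^ 2 * s ^ 2 / 2 - ν ^ 3 * s ^ 3 / 6)) / ν ^ 3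

theorem tendsto_expRem (s : ℂ) : Tendsto (fun n => expRem s (nuS n)) atTop (𝓝 0) := by
  have hz : Tendsto (fun n => nuS n * (‖s‖ ^ 4 * (5 / 96))) atTop (𝓝 0) := by
    simpa using tendsto_nuS.mul_const (‖s‖ ^ 4 * (5 / 96))
  have h1 : Tendsto (fun n => nuS n * ‖s‖) atTop (𝓝 0) := by
    simpa using tendsto_nuS.mul_const ‖s‖
  refine squeeze_zero_norm' ?_ hz
  filter_upwards [eventually_gt_atTop 0, h1.eventually_le_const (u := 1) (by norm_num)]
    with n hn hs
  have hν := nuS_pos hn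
  set ν := nuS n
  have hns : ‖-((ν : ℂ) * s)‖ = ν * ‖s‖ := by
    rw [norm_neg, norm_mul, Complex.norm_real, Real.norm_eq_abs, abs_of_pos hν]
  have h := Complex.exp_bound (x := -(ν * s)) (by rw [hns]; exact hs) (n := 4) (by norm_num)
  rw [hns] at h
  rw [expRem, norm_div, norm_pow, Complex.norm_real, Real.norm_eq_abs, abs_of_pos hν,
    div_le_iff₀ (by positivity)]
  calc _ = ‖Complex.exp (-(ν * s)) -
        ∑ m ∈ Finset.range 4, (-(ν * s)) ^ m / (m.factorial : ℂ)‖ := by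
        congr 2
        simp [Finset.sum_range_succ, Nat.factorial]
        ring
    _ ≤ _ := h
    _ = _ := by
      norm_num [Nat.factorial]
      ring

theorem ofReal_aS (lam : ℝ) {n : ℕ} (hn : 0 < n) :
    (aS lam n : ℂ) = (1 + xS lam n) * nuS n ^ 3 := by
  have h1 := aS_mul lam n
  have h2 := mul_nuS_pow hn
  have : aS lam n = (1 + xS lam n) * nuS n ^ 3 := by
    linear_combination nuS n ^ 3 * h1 - aS lam n * h2
  exact_mod_cast this

section

variable {β τ : ℝ}

theorem circE_nuS_eq {n : ℕ} (hn : 0 < n) : circE (nuS n) β τ =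
    1 - nuS n * (β + τ * Complex.I) + nuS n ^ 2 * (β + τ * Complex.I) ^ 2 / 2 -
      nuS n ^ 3 * (β + τ * Complex.I) ^ 3 / 6 +
      nuS n ^ 3 * expRem (β + τ * Complex.I) (nuS n) := by
  have h : (nuS n : ℂ) ≠ 0 := by exact_mod_cast (nuS_pos hn).ne'
  rw [circE, expRem]
  field_simp
  ring

theorem tendsto_ofReal_nuS : Tendsto (fun n => (nuS n : ℂ)) atTop (𝓝 0) := by
  exact_mod_cast (Complex.continuous_ofReal.tendsto 0).comp tendsto_nuS

theorem tendsto_ofReal_xS (lam : ℝ) : Tendsto (fun n => 1 + (xS lam n : ℂ)) atTop (𝓝 1) := by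
  have h := (Complex.continuous_ofReal.tendsto 0).comp (tendsto_xS lam)
  simpa using h.const_add 1

theorem tendsto_circE : Tendsto (fun n => circE (nuS n) β τ) atTop (𝓝 1) := by
  have h : Tendsto (fun n => -((nuS n : ℂ) * (β + τ * Complex.I))) atTop (𝓝 0) := by
    simpa using (tendsto_ofReal_nuS.mul_const (β + τ * Complex.I : ℂ)).neg
  have h2 := (Complex.continuous_exp.tendsto 0).comp h
  rwa [Complex.exp_zero] at h2

theorem tendsto_sub_circE : Tendsto (fun n => ((β + τ * Complex.I : ℂ) -
    (1 - circE (nuS n) β τ) / nuS n) / nuS n) atTop (𝓝 ((β + τ * Complex.I) ^ 2 / 2)) := by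
  have h : Tendsto (fun n => (β + τ * Complex.I : ℂ) ^ 2 / 2 -
      nuS n * ((β + τ * Complex.I) ^ 3 / 6) +
      nuS n * expRem (β + τ * Complex.I) (nuS n)) atTop
      (𝓝 ((β + τ * Complex.I : ℂ) ^ 2 / 2 - 0 * ((β + τ * Complex.I) ^ 3 / 6) + 0 * 0)) :=
    ((tendsto_ofReal_nuS.mul_const _).const_sub _).add
      (tendsto_ofReal_nuS.mul (tendsto_expRem _))
  rw [zero_mul, zero_mul, sub_zero, add_zero] at h
  refine h.congr' ?_
  filter_upwards [eventually_gt_atTop 0] with n hn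
  have h0 : (nuS n : ℂ) ≠ 0 := by exact_mod_cast (nuS_pos hn).ne'
  rw [circE_nuS_eq hn]
  field_simp
  ring

theorem tendsto_one_sub_circE : Tendsto (fun n => (1 - circE (nuS n) β τ) / nuS n) atTop
    (𝓝 (β + τ * Complex.I)) := by
  have h := (tendsto_ofReal_nuS.mul (tendsto_sub_circE (β := β) (τ := τ))).const_sub
    (β + τ * Complex.I : ℂ)
  rw [zero_mul, sub_zero] at h
  refine h.congr' ?_
  filter_upwards [eventually_gt_atTop 0] with n hn
  have h0 : (nuS n : ℂ) ≠ 0 := by exact_mod_cast (nuS_pos hn).ne'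
  field_simp
  ring

theorem tendsto_one_sub_circE_sq : Tendsto (fun n => (1 - circE (nuS n) β τ ^ 2) / nuS n) atTop
    (𝓝 (2 * (β + τ * Complex.I))) := by
  have h := (tendsto_circE (β := β) (τ := τ)).const_add 1 |>.mul
    (tendsto_one_sub_circE (β := β) (τ := τ))
  rw [one_add_one_eq_two] at h
  exact h.congr fun n => by ring

theorem tendsto_circX (lam : ℝ) :
    Tendsto (fun n : ℕ => circX n (nuS n) (aS lam n) β τ) atTop
      (𝓝 ((β + τ * Complex.I) ^ 3 / 3 + lam * (β + τ * Complex.I) ^ 2 / 2)) := by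
  set s : ℂ := β + τ * Complex.I with hs
  have hx := tendsto_ofReal_xS lam
  have hd : Tendsto (fun n => (xS lam n : ℂ) / nuS n) atTop (𝓝 lam) := by
    have := (Complex.continuous_ofReal.tendsto lam).comp (tendsto_xS_div lam)
    exact this.congr fun n => by simp
  have h := ((tendsto_expRem s).const_add (-s ^ 3 / 6)).add
    ((((hd.const_mul (s ^ 2)).add ((tendsto_sub_circE (β := β) (τ := τ)).mul
      ((tendsto_one_sub_circE (β := β) (τ := τ)).const_add s)))).div (hx.const_mul 2)
      (by norm_num))
  have e : -s ^ 3 / 6 + 0 + (s ^ 2 * lam + s ^ 2 / 2 * (s + s)) / (2 * 1) =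
      s ^ 3 / 3 + lam * s ^ 2 / 2 := by ring
  rw [← hs, e] at h
  refine h.congr' ?_
  filter_upwards [eventually_gt_atTop 0,
    (tendsto_xS lam).eventually_const_lt (u := -1) (by norm_num)] with n hn hxn
  have hν : (nuS n : ℂ) ≠ 0 := by exact_mod_cast (nuS_pos hn).ne'
  have h3 : (n : ℂ) = 1 / nuS n ^ 3 := by
    rw [eq_div_iff (pow_ne_zero 3 hν)]
    exact_mod_cast mul_nuS_pow hn
  have hx0 : (1 + xS lam n : ℂ) ≠ 0 := by
    have : 1 + xS lam n ≠ 0 := by linarith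
    exact_mod_cast this
  have ha := ofReal_aS lam hn
  rw [circX, Pi.div_apply]
  push_cast
  rw [h3, ha, circE_nuS_eq hn, ← hs]
  field_simp
  ring

theorem tendsto_cR_circE (lam : ℝ) (hβ : 0 < β) {f : ℕ → ℝ} (hf0 : f 0 = 1)
    (hrec : ∀ r : ℕ, 1 ≤ r → ∑ k ∈ Finset.range (r + 1), f k * f (r - k) = epsr r) (r : ℕ) :
    Tendsto (fun n : ℕ => (aS lam n ^ r * cR r (circE (nuS n) β τ) : ℂ)) atTop
      (𝓝 (4 ^ r * f r / (2 * (β + τ * Complex.I)) ^ (3 * r))) := by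
  have hs : (2 * (β + τ * Complex.I) : ℂ) ≠ 0 :=
    mul_ne_zero two_ne_zero (Complex.slitPlane_ne_zero (vert_mem_slitPlane hβ τ))
  have hP : Tendsto (fun n => Polynomial.aeval (circE (nuS n) β τ) (pPoly r)) atTop
      (𝓝 (4 ^ r * f r)) := by
    have := ((pPoly r).continuous_aeval.tendsto (1 : ℂ)).comp (tendsto_circE (β := β) (τ := τ))
    have e : Polynomial.aeval (1 : ℂ) (pPoly r) = 4 ^ r * f r := by
      have h1 := Polynomial.aeval_algebraMap_apply ℂ (1 : ℝ) (pPoly r)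
      rw [map_one, Polynomial.coe_aeval_eq_eval, pPoly_eval_one f hf0 hrec] at h1
      rw [h1]
      simp
    rwa [e] at this
  have h := ((tendsto_ofReal_xS lam).pow r).mul (hP.div
    ((tendsto_one_sub_circE_sq (β := β) (τ := τ)).pow (3 * r)) (pow_ne_zero _ hs))
  rw [one_pow, one_mul] at h
  refine h.congr' ?_
  filter_upwards [eventually_gt_atTop 0] with n hn
  have hν : (nuS n : ℂ) ≠ 0 := by exact_mod_cast (nuS_pos hn).ne'
  have ha := ofReal_aS lam hn
  rw [cR, ha, Pi.div_apply, div_pow, mul_pow, ← pow_mul]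
  field_simp

theorem tendsto_circI (lam : ℝ) (hβ : 0 < β) {f : ℕ → ℝ} (hf0 : f 0 = 1)
    (hrec : ∀ r : ℕ, 1 ≤ r → ∑ k ∈ Finset.range (r + 1), f k * f (r - k) = epsr r) (r : ℕ) :
    Tendsto (fun n : ℕ => circI n (nuS n) (aS lam n) β r τ) atTop
      (𝓝 (((2 : ℝ) ^ (-(1 : ℝ) / 4) * (f r / 2 ^ r) : ℝ) *
        (airyF (1 - (1 / 4 + 3 * r)) (β + τ * Complex.I) *
          Complex.exp (lam * (β + τ * Complex.I) ^ 2 / 2)))) := by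
  have hm := vert_mem_slitPlane hβ τ
  have hs := Complex.slitPlane_ne_zero hm
  have hm2 : (2 * (β + τ * Complex.I) : ℂ) ∈ Complex.slitPlane := by
    rw [Complex.mem_slitPlane_iff]
    left
    simpa using hβ
  have hκ := (tendsto_one_sub_circE_sq (β := β) (τ := τ)).cpow
    (tendsto_const_nhds (x := (-(1 / 4) : ℂ))) hm2
  have h := (((tendsto_one_sub_circE (β := β) (τ := τ)).mul hκ).mul
    (tendsto_cR_circE (τ := τ) lam hβ hf0 hrec r)).mul
    ((Complex.continuous_exp.tendsto _).comp (tendsto_circX (β := β) (τ := τ) lam))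
  convert h using 2
  · rfl
  set s : ℂ := β + τ * Complex.I
  have e1 : (2 * s) ^ (-(1 / 4) : ℂ) = (2 : ℂ) ^ (-(1 / 4) : ℂ) * s ^ (-(1 / 4) : ℂ) := by
    have := ofReal_mul_cpow (x := 2) (by norm_num) hs (-(1 / 4))
    push_cast at this
    exact this
  have e2 : (((2 : ℝ) ^ (-(1 : ℝ) / 4) : ℝ) : ℂ) = (2 : ℂ) ^ (-(1 / 4) : ℂ) := by
    rw [Complex.ofReal_cpow (by norm_num)]
    push_cast
    congr 1
    ring
  have e3 : s ^ ((1 - (1 / 4 + 3 * r) : ℝ) : ℂ) = s * s ^ (-(1 / 4) : ℂ) / s ^ (3 * r) := by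
    have e : ((1 - (1 / 4 + 3 * r) : ℝ) : ℂ) = 1 + -(1 / 4) - (3 * r : ℕ) := by
      push_cast
      ring
    rw [e, Complex.cpow_sub _ _ hs, Complex.cpow_natCast, Complex.cpow_add _ _ hs,
      Complex.cpow_one]
  have e4 : (2 : ℂ) ^ (3 * r) = 4 ^ r * 2 ^ r := by
    rw [pow_mul, ← mul_pow]
    norm_num
  rw [airyF, e3, Complex.exp_add, e1, mul_pow, e4]
  push_cast [e2]
  have h4 : (4 : ℂ) ^ r ≠ 0 := pow_ne_zero _ (by norm_num)
  field_simp

end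

/-- The rescaled `r`-th term of the expansion of the bipartite probability. -/
noncomputable def termS (lam : ℝ) (r n : ℕ) : ℝ :=
  (n : ℝ) ^ ((1 : ℝ) / 12) * (n.factorial * Real.exp (-(aS lam n * (n * (n - 1) / 2)))) *
    (aS lam n ^ r * pnr (aS lam n) n r)

theorem termS_eq_integral {lam β : ℝ} (hβ : 0 < β) (r : ℕ) {n : ℕ} (hn : 0 < n)
    (ha : aS lam n ≠ 0) : (termS lam r n : ℂ) = kS lam n *
      ∫ τ in (-(Real.pi / nuS n))..(Real.pi / nuS n), circI n (nuS n) (aS lam n) β r τ := by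
  have hν := nuS_pos hn
  have hν' : (nuS n : ℂ) ≠ 0 := by exact_mod_cast hν.ne'
  have e : ((nuS n ^ ((3 : ℝ) / 4) : ℝ) : ℂ) = nuS n * (nuS n : ℂ) ^ (-(1 / 4) : ℂ) := by
    rw [Complex.ofReal_cpow hν.le]
    have h := Complex.cpow_add (1 : ℂ) (-(1 / 4)) hν'
    rw [Complex.cpow_one] at h
    rw [← h]
    congr 1
    push_cast
    norm_num
  have h : ∀ τ : ℝ, (1 - circE (nuS n) β τ) * (1 - circE (nuS n) β τ ^ 2) ^ (-(1 / 4) : ℂ) *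
      (aS lam n ^ r * cR r (circE (nuS n) β τ)) *
      Complex.exp (n * (circE (nuS n) β τ - 1 + nuS n * (β + τ * Complex.I)) -
        (1 - circE (nuS n) β τ) ^ 2 / (2 * aS lam n)) =
      ((nuS n ^ ((3 : ℝ) / 4) : ℝ) : ℂ) * circI n (nuS n) (aS lam n) β r τ := by
    intro τ
    have h0 : (1 - circE (nuS n) β τ ^ 2) / nuS n ≠ 0 := by
      have h1 := circE_mem (ν := 2 * nuS n) (by positivity) hβ τ
      intro h2
      rw [circE_sq, div_eq_zero_iff, or_iff_left hν'] at h2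
      rw [h2] at h1
      simp at h1
    have h1 : 1 - circE (nuS n) β τ ^ 2 = nuS n * ((1 - circE (nuS n) β τ ^ 2) / nuS n) := by
      field_simp
    rw [circI, circX, e]
    conv_lhs => rw [h1, ofReal_mul_cpow hν h0]
    push_cast
    field_simp
  have hF := pow_mul_pnr_eq_integral ha hν hβ n r
  have hF2 : (∫ τ in (-(Real.pi / nuS n))..(Real.pi / nuS n),
      ((nuS n ^ ((3 : ℝ) / 4) : ℝ) : ℂ) * circI n (nuS n) (aS lam n) β r τ) = _ :=
    intervalIntegral.integral_congr fun τ _ => (h τ).symm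
  rw [intervalIntegral.integral_const_mul] at hF2
  rw [termS, Complex.ofReal_mul, hF, kS]
  simp only [circE] at hF2
  rw [← hF2]
  push_cast
  ring

/-- The integrand, cut off to the whole line. -/
noncomputable def circJ (lam β : ℝ) (r n : ℕ) : ℝ → ℂ :=
  indicator (Ioc (-(Real.pi / nuS n)) (Real.pi / nuS n)) (circI n (nuS n) (aS lam n) β r)

theorem termS_eq_integral_circJ {lam β : ℝ} (hβ : 0 < β) (r : ℕ) {n : ℕ} (hn : 0 < n)
    (ha : aS lam n ≠ 0) : (termS lam r n : ℂ) = kS lam n * ∫ τ, circJ lam β r n τ := by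
  have h := div_pos Real.pi_pos (nuS_pos hn)
  rw [termS_eq_integral hβ r hn ha, intervalIntegral.integral_of_le (by linarith), circJ,
    integral_indicator measurableSet_Ioc]

theorem measurable_circI (n ν a β : ℝ) (r : ℕ) : Measurable (circI n ν a β r) := by
  have hE : Measurable (circE ν β) := by
    unfold circE
    fun_prop
  have hX : Measurable (circX n ν a β) := by
    unfold circX
    fun_prop
  have hP : Measurable fun τ => Polynomial.aeval (circE ν β τ) (pPoly r) :=
    (pPoly r).continuous_aeval.measurable.comp hE
  unfold circI cR
  fun_prop

theorem tendsto_circJ (lam : ℝ) {β : ℝ} (hβ : 0 < β) {f : ℕ → ℝ} (hf0 : f 0 = 1)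
    (hrec : ∀ r : ℕ, 1 ≤ r → ∑ k ∈ Finset.range (r + 1), f k * f (r - k) = epsr r) (r : ℕ)
    (τ : ℝ) :
    Tendsto (fun n : ℕ => circJ lam β r n τ) atTop
      (𝓝 (((2 : ℝ) ^ (-(1 : ℝ) / 4) * (f r / 2 ^ r) : ℝ) *
        (airyF (1 - (1 / 4 + 3 * r)) (β + τ * Complex.I) *
          Complex.exp (lam * (β + τ * Complex.I) ^ 2 / 2)))) := by
  refine (tendsto_circI lam hβ hf0 hrec r).congr' ?_
  have h1 : Tendsto (fun n => |τ| * nuS n) atTop (𝓝 0) := by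
    simpa using tendsto_nuS.const_mul |τ|
  filter_upwards [eventually_gt_atTop 0, h1.eventually_lt_const Real.pi_pos] with n hn h2
  rw [← lt_div_iff₀ (nuS_pos hn), abs_lt] at h2
  rw [circJ, indicator_of_mem (show τ ∈ Ioc _ _ from ⟨h2.1, h2.2.le⟩)]

/-- The shift in the choice of the saddle point. -/
noncomputable def radS (lam : ℝ) : ℝ := (100 * (|lam| + 1)) ^ 3

/-- The saddle point used for the `r`-th term. -/
noncomputable def betaS (lam : ℝ) (r : ℕ) : ℝ := (3 * (r + radS lam)) ^ ((1 : ℝ) / 3)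

theorem radS_pos (lam : ℝ) : 0 < radS lam := by
  unfold radS
  positivity

theorem betaS_pos (lam : ℝ) (r : ℕ) : 0 < betaS lam r := by
  have := radS_pos lam
  unfold betaS
  positivity

theorem betaS_pow (lam : ℝ) (r : ℕ) : betaS lam r ^ 3 = 3 * (r + radS lam) := by
  have := radS_pos lam
  rw [betaS, ← Real.rpow_natCast, ← Real.rpow_mul (by positivity)]
  norm_num

theorem le_betaS (lam : ℝ) (r : ℕ) : 100 * (|lam| + 1) ≤ betaS lam r := by
  rw [← pow_le_pow_iff_left₀ (by positivity) (betaS_pos lam r).le (n := 3) (by norm_num), betaS_pow]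
  have := radS_pos lam
  rw [← radS]
  have : (0 : ℝ) ≤ r := r.cast_nonneg
  linarith

/-- The dominating function. -/
noncomputable def domS (R : ℝ) (r : ℕ) (τ : ℝ) : ℝ :=
  3 * Real.exp (1029 / 1000 * R) * ((r + R) * (9 / 10) ^ r) * Real.exp (1 * |τ| - 1 / 10 * τ ^ 2)

theorem integrable_domS (R : ℝ) (r : ℕ) : Integrable (domS R r) :=
  (integrable_exp_abs_sub_sq 1 (by norm_num)).const_mul _

theorem integral_domS (R : ℝ) (r : ℕ) : ∫ τ, domS R r τ = 3 * Real.exp (1029 / 1000 * R) *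
    ((r + R) * (9 / 10) ^ r) * ∫ τ : ℝ, Real.exp (1 * |τ| - 1 / 10 * τ ^ 2) :=
  integral_const_mul _ _

theorem domS_nonneg {R : ℝ} (hR : 0 ≤ R) (r : ℕ) (τ : ℝ) : 0 ≤ domS R r τ := by
  unfold domS
  positivity

theorem bound_le_domS (lam : ℝ) (r : ℕ) (τ : ℝ) :
    (betaS lam r + |τ|) * (3 / 10) ^ r *
      Real.exp (343 / 1000 * betaS lam r ^ 3 - τ ^ 2 / 10) ≤ domS (radS lam) r τ := by
  have h1 : 1 ≤ betaS lam r := by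
    have := le_betaS lam r
    have := abs_nonneg lam
    linarith
  have hb : betaS lam r ≤ betaS lam r ^ 3 := le_self_pow₀ h1 (by norm_num)
  have hR := radS_pos lam
  have h2 : betaS lam r + |τ| ≤ 3 * (r + radS lam) * Real.exp |τ| := by
    rw [← betaS_pow]
    have h3 := Real.add_one_le_exp |τ|
    have h4 := abs_nonneg τ
    calc _ ≤ betaS lam r ^ 3 * (|τ| + 1) := by nlinarith
      _ ≤ _ := by gcongr
  have he : Real.exp (1029 / 1000) ≤ 3 := by
    have e : (1029 / 1000 : ℝ) = 1 + 29 / 1000 := by norm_num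
    have h5 := Real.exp_bound_div_one_sub_of_interval (x := 29 / 1000) (by norm_num) (by norm_num)
    have h6 := Real.exp_one_lt_d9.le
    rw [e, Real.exp_add]
    calc _ ≤ (2.7182818286 : ℝ) * (1 / (1 - 29 / 1000)) := by gcongr
      _ ≤ 3 := by norm_num
  have h7 : Real.exp (343 / 1000 * betaS lam r ^ 3 - τ ^ 2 / 10) ≤
      3 ^ r * Real.exp (1029 / 1000 * radS lam) * Real.exp (-(1 / 10 * τ ^ 2)) := by
    have e : 343 / 1000 * betaS lam r ^ 3 - τ ^ 2 / 10 =
        r * (1029 / 1000) + 1029 / 1000 * radS lam + -(1 / 10 * τ ^ 2) := by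
      rw [betaS_pow]
      ring
    rw [e, Real.exp_add, Real.exp_add, Real.exp_nat_mul]
    gcongr
  calc _ ≤ (3 * (r + radS lam) * Real.exp |τ|) * (3 / 10) ^ r *
        (3 ^ r * Real.exp (1029 / 1000 * radS lam) * Real.exp (-(1 / 10 * τ ^ 2))) := by gcongr
    _ = 3 * Real.exp (1029 / 1000 * radS lam) * ((r + radS lam) * ((3 / 10) ^ r * 3 ^ r)) *
        (Real.exp |τ| * Real.exp (-(1 / 10 * τ ^ 2))) := by ring
    _ = _ := by
      rw [domS, ← mul_pow, ← Real.exp_add, one_mul, ← sub_eq_add_neg]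
      norm_num

theorem eventually_norm_circJ_le (lam : ℝ) : ∀ᶠ n in atTop, 0 < n ∧ 0 < aS lam n ∧
    ∀ r : ℕ, r ≤ Nat.sqrt n → ∀ τ, ‖circJ lam (betaS lam r) r n τ‖ ≤ domS (radS lam) r τ := by
  have h1 : Tendsto (fun n : ℕ => (√(n : ℝ))⁻¹) atTop (𝓝 0) :=
    tendsto_inv_atTop_zero.comp (Real.tendsto_sqrt_atTop.comp tendsto_natCast_atTop_atTop)
  have h2 : Tendsto (fun n : ℕ => 3 * ((√(n : ℝ))⁻¹ + radS lam * (n : ℝ)⁻¹)) atTop (𝓝 0) := by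
    simpa using (h1.add ((tendsto_inv_atTop_nhds_zero_nat (𝕜 := ℝ)).const_mul (radS lam))).const_mul 3
  filter_upwards [eventually_gt_atTop 0,
    h2.eventually_le_const (u := (1 / 100) ^ 3) (by norm_num),
    (tendsto_xS_div lam).abs.eventually_le_const (u := |lam| + 1) (by linarith),
    (tendsto_xS lam).eventually_const_lt (u := -1) (by norm_num)] with n hn hs hx hx1
  have hn' : (0 : ℝ) < n := by exact_mod_cast hn
  have hν := nuS_pos hn
  refine ⟨hn, ?_, fun r hr τ => ?_⟩
  · have := aS_mul lam n
    exact pos_of_mul_pos_left (this ▸ (by linarith)) hn'.le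
  have hβ := betaS_pos lam r
  have hβ1 := le_betaS lam r
  have hl := abs_nonneg lam
  have hR := radS_pos lam
  rw [circJ, indicator_apply]
  split_ifs with hτ
  · refine (norm_circI_le r (mul_nuS_pow hn) (aS_mul lam n) hν (by linarith) ?_ ?_ ?_ ?_).trans
      (bound_le_domS lam r τ)
    · rw [← pow_le_pow_iff_left₀ (by positivity) (by norm_num) (n := 3) (by norm_num), mul_pow,
        betaS_pow]
      refine le_trans ?_ hs
      have hr' : (r : ℝ) ≤ √n := by
        refine Real.le_sqrt_of_sq_le ?_
        exact_mod_cast (Nat.pow_le_pow_left hr 2).trans (Nat.sqrt_le' n)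
      have e : nuS n ^ 3 = (n : ℝ)⁻¹ := by
        exact eq_inv_of_mul_eq_one_right (mul_nuS_pow hn)
      have e2 : (√(n : ℝ))⁻¹ = (n : ℝ)⁻¹ * √n := by
        have := Real.sqrt_pos.2 hn'
        field_simp
        rw [Real.sq_sqrt hn'.le]
      rw [e, e2]
      calc _ ≤ (n : ℝ)⁻¹ * (3 * (√n + radS lam)) := by gcongr
        _ = _ := by ring
    · rw [abs_div, abs_of_pos hν, div_le_iff₀ hν] at hx
      nlinarith
    · rw [betaS_pow]
      linarith
    · exact abs_le.2 ⟨hτ.1.le, hτ.2⟩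
  · rw [norm_zero]
    exact domS_nonneg hR.le r τ

theorem tendsto_natSqrt : Tendsto Nat.sqrt atTop atTop :=
  tendsto_atTop.2 fun b => (eventually_ge_atTop (b * b)).mono fun _ hn => Nat.le_sqrt.2 hn

theorem tendsto_termS (lam : ℝ) {f : ℕ → ℝ} (hf0 : f 0 = 1)
    (hrec : ∀ r : ℕ, 1 ≤ r → ∑ k ∈ Finset.range (r + 1), f k * f (r - k) = epsr r) (r : ℕ) :
    Tendsto (termS lam r) atTop (𝓝 ((2 : ℝ) ^ (-(1 : ℝ) / 4) * Real.exp (1 / 2) *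
      √(2 * Real.pi) * (f r / 2 ^ r * Afun (1 / 4 + 3 * r) lam))) := by
  have hβ := betaS_pos lam r
  have hβ1 := le_betaS lam r
  have hl := abs_nonneg lam
  have hI : Tendsto (fun n => ∫ τ, circJ lam (betaS lam r) r n τ) atTop
      (𝓝 (∫ τ : ℝ, ((2 : ℝ) ^ (-(1 : ℝ) / 4) * (f r / 2 ^ r) : ℝ) *
        (airyF (1 - (1 / 4 + 3 * r)) (betaS lam r + τ * Complex.I) *
          Complex.exp (lam * (betaS lam r + τ * Complex.I) ^ 2 / 2)))) := by
    refine tendsto_integral_filter_of_dominated_convergence (domS (radS lam) r)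
      (Eventually.of_forall fun _ =>
        ((measurable_circI _ _ _ _ r).indicator measurableSet_Ioc).aestronglyMeasurable) ?_
      (integrable_domS _ r) (Eventually.of_forall fun τ => tendsto_circJ lam hβ hf0 hrec r τ)
    filter_upwards [eventually_norm_circJ_le lam, tendsto_natSqrt.eventually_ge_atTop r] with n hn hr
    exact Eventually.of_forall (hn.2.2 r hr)
  have hy : ∀ k : ℤ, (1 / 4 + 3 * r : ℝ) ≠ k := by
    intro k hk
    have h : (1 + 12 * r : ℝ) = 4 * k := by rw [← hk]; ring
    have h' : (1 + 12 * r : ℤ) = 4 * k := by exact_mod_cast h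
    omega
  have hA := Afun_eq_integral hy (lam := lam) (β := betaS lam r) (by linarith)
  rw [integral_const_mul] at hI
  have hk := (Complex.continuous_ofReal.tendsto _).comp (tendsto_kS lam)
  have h := hk.mul hI
  have hre := (Complex.continuous_re.tendsto _).comp (h.congr' (f₂ := fun n => (termS lam r n : ℂ))
    ((eventually_norm_circJ_le lam).mono fun n hn =>
      (termS_eq_integral_circJ hβ r hn.1 hn.2.1.ne').symm))
  set J := ∫ τ : ℝ, airyF (1 - (1 / 4 + 3 * r)) (betaS lam r + τ * Complex.I) *
    Complex.exp (lam * (betaS lam r + τ * Complex.I) ^ 2 / 2)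
  have e : ((√(2 * Real.pi) * Real.exp (-lam ^ 3 / 6 + 1 / 2) / (2 * Real.pi) : ℝ) : ℂ) *
      (((2 : ℝ) ^ (-(1 : ℝ) / 4) * (f r / 2 ^ r) : ℝ) * J) =
      (((2 : ℝ) ^ (-(1 : ℝ) / 4) * Real.exp (1 / 2) * √(2 * Real.pi) *
        (f r / 2 ^ r * Afun (1 / 4 + 3 * r) lam) : ℝ) : ℂ) := by
    simp only [Complex.ofReal_mul _ (_ * Afun _ _), Complex.ofReal_mul _ (Afun _ _), hA,
      Real.exp_add]
    push_cast
    ring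
  rw [e, Complex.ofReal_re] at hre
  exact hre

theorem exists_summable_bound (lam : ℝ) : ∃ b : ℕ → ℝ, Summable b ∧ (∀ r, 0 ≤ b r) ∧ ∀ᶠ n in atTop,
    ∀ r : ℕ, r ≤ Nat.sqrt n → ‖termS lam r n‖ ≤ b r := by
  have hk := (tendsto_kS lam).norm
  set k0 := ‖√(2 * Real.pi) * Real.exp (-lam ^ 3 / 6 + 1 / 2) / (2 * Real.pi)‖
  refine ⟨fun r => (k0 + 1) * ∫ τ, domS (radS lam) r τ, ?_, fun r => ?_, ?_⟩
  · simp only [integral_domS]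
    have h9 : ‖(9 / 10 : ℝ)‖ < 1 := by norm_num
    have h1 := summable_pow_mul_geometric_of_norm_lt_one 1 h9
    have h2 := (summable_geometric_of_norm_lt_one h9).mul_left (radS lam)
    refine ((((h1.add h2).mul_left (3 * Real.exp (1029 / 1000 * radS lam))).mul_right
      (∫ τ : ℝ, Real.exp (1 * |τ| - 1 / 10 * τ ^ 2))).mul_left (k0 + 1)).congr fun r => ?_
    ring
  · have : 0 ≤ ∫ τ, domS (radS lam) r τ :=
      integral_nonneg fun τ => domS_nonneg (radS_pos lam).le r τ
    positivity
  · filter_upwards [eventually_norm_circJ_le lam, hk.eventually_le_const (lt_add_one k0)]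
      with n hn hkn r hr
    have hβ := betaS_pos lam r
    rw [← Complex.norm_real, termS_eq_integral_circJ hβ r hn.1 hn.2.1.ne', norm_mul,
      Complex.norm_real]
    gcongr
    exact norm_integral_le_of_norm_le (integrable_domS _ r) (Eventually.of_forall (hn.2.2 r hr))

theorem hasSum_termS {lam : ℝ} {n : ℕ} (hp : 0 < pS lam n) (h1 : pS lam n ≤ 1 / 2)
    (ha : 0 < aS lam n) : HasSum (fun r => termS lam r n)
      ((n : ℝ) ^ ((1 : ℝ) / 12) * bipartiteProb lam n) := by
  have h := (hasSum_pnr_self ha n).mul_left ((n : ℝ) ^ ((1 : ℝ) / 12) *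
    (n.factorial * Real.exp (-(aS lam n * (n * (n - 1) / 2)))))
  have hq : 0 < 1 - pS lam n := by linarith
  have hexp : Real.exp (aS lam n) - 1 = pS lam n / (1 - pS lam n) := by
    rw [aS, Real.exp_neg, Real.exp_log hq]
    field_simp
    ring
  have hN : ((n * (n - 1) / 2 : ℕ) : ℝ) = n * (n - 1) / 2 := by
    rw [← Nat.choose_two_right, Nat.cast_choose_two]
  have hpow : Real.exp (-(aS lam n * (n * (n - 1) / 2))) =
      (1 - pS lam n) ^ (n * (n - 1) / 2) := by
    rw [← Real.exp_log (pow_pos hq _), Real.log_pow, hN, aS]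
    congr 1
    ring
  rw [bipartiteProb_eq lam n (pS lam n) rfl (by linarith), ← hpow, ← hexp]
  have hf : (n.factorial : ℝ) ≠ 0 := by exact_mod_cast n.factorial_ne_zero
  have e : ∀ A E B : ℝ, A * (E * B) =
      A * (n.factorial * E) * (1 / n.factorial * B) := fun A E B => by field_simp
  rw [e]
  exact h

theorem termS_nonneg {lam : ℝ} {n : ℕ} (ha : 0 ≤ aS lam n) (r : ℕ) : 0 ≤ termS lam r n := by
  have := pnr_nonneg ha n r
  unfold termS
  positivity

/-- The terms with `r ≤ √n`. -/
noncomputable def headS (lam : ℝ) (n r : ℕ) : ℝ := if r ≤ Nat.sqrt n then termS lam r n else 0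

theorem termS_sub_headS_mem {lam : ℝ} {n : ℕ} (hn : 0 < n) (ha : 0 ≤ aS lam n) (r : ℕ) :
    termS lam r n - headS lam n r ∈ Icc 0 (((n : ℝ) ^ ((1 : ℝ) / 12) *
      (n.factorial * Real.exp (-(aS lam n * (n * (n - 1) / 2)))) *
      (√(n : ℝ))⁻¹) * ((2 * aS lam n) ^ r * pnr (aS lam n) n r)) := by
  have hp := pnr_nonneg ha n r
  rw [headS]
  split_ifs with h
  · rw [sub_self]
    exact ⟨le_rfl, by positivity⟩
  · rw [sub_zero]
    refine ⟨termS_nonneg ha r, ?_⟩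
    have h0 : 0 < √(n : ℝ) := Real.sqrt_pos.2 (by exact_mod_cast hn)
    have h2 : √(n : ℝ) ≤ 2 ^ r := by
      refine Real.sqrt_le_iff.2 ⟨by positivity, ?_⟩
      have h3 := Nat.sqrt_lt'.1 (not_le.1 h)
      have h4 : n ≤ (2 ^ r) ^ 2 := h3.le.trans (Nat.pow_le_pow_left Nat.lt_two_pow_self.le 2)
      exact_mod_cast h4
    have h5 : 1 ≤ (√(n : ℝ))⁻¹ * 2 ^ r := by
      rw [inv_mul_eq_div, le_div_iff₀ h0, one_mul]
      exact h2
    set K := (n : ℝ) ^ ((1 : ℝ) / 12) *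
      (n.factorial * Real.exp (-(aS lam n * (n * (n - 1) / 2)))) with hK
    have hK0 : 0 ≤ K := by positivity
    calc termS lam r n = K * (aS lam n ^ r * pnr (aS lam n) n r) * 1 := by rw [termS, mul_one]
      _ ≤ K * (aS lam n ^ r * pnr (aS lam n) n r) * ((√(n : ℝ))⁻¹ * 2 ^ r) := by gcongr
      _ = _ := by
        rw [mul_pow]
        ring

theorem tsum_termS_sub_headS_mem {lam : ℝ} {n : ℕ} (hn : 0 < n) (ha : 0 < aS lam n) :
    ∑' r, (termS lam r n - headS lam n r) ∈ Icc 0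
      ((n : ℝ) ^ (-(5 : ℝ) / 12) * Real.exp ((1 + xS lam n) / 2)) := by
  have h2a : 0 < 2 * aS lam n := by positivity
  have hn' : (0 : ℝ) < n := by exact_mod_cast hn
  have hs := (hasSum_pnr (a := aS lam n) h2a n).summable
  have hm := termS_sub_headS_mem (lam := lam) hn ha.le
  refine ⟨tsum_nonneg fun r => (hm r).1, ?_⟩
  set K := (n : ℝ) ^ ((1 : ℝ) / 12) *
      (n.factorial * Real.exp (-(aS lam n * (n * (n - 1) / 2)))) * (√(n : ℝ))⁻¹ with hK
  have hf : (n.factorial : ℝ) ≠ 0 := by exact_mod_cast n.factorial_ne_zero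
  calc _ ≤ ∑' r, K * ((2 * aS lam n) ^ r * pnr (aS lam n) n r) :=
        Summable.tsum_le_tsum (fun r => (hm r).2)
          (Summable.of_nonneg_of_le (fun r => (hm r).1) (fun r => (hm r).2) (hs.mul_left K))
          (hs.mul_left K)
    _ = K * ∑' r, (2 * aS lam n) ^ r * pnr (aS lam n) n r := tsum_mul_left
    _ ≤ K * (1 / (n.factorial : ℝ) * Real.exp (aS lam n * n ^ 2 / 2)) := by
        gcongr
        exact tsum_two_mul_pow_pnr_le ha n
    _ = ((n : ℝ) ^ ((1 : ℝ) / 12) * (√(n : ℝ))⁻¹) *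
        (Real.exp (-(aS lam n * (n * (n - 1) / 2))) * Real.exp (aS lam n * n ^ 2 / 2)) := by
        rw [hK]
        field_simp
    _ = _ := by
        rw [← Real.exp_add, Real.sqrt_eq_rpow, ← Real.rpow_neg hn'.le, ← Real.rpow_add hn',
          ← aS_mul]
        congr 2
        · norm_num
        · ring

theorem tendsto_tsum_headS (lam : ℝ) {f : ℕ → ℝ} (hf0 : f 0 = 1)
    (hrec : ∀ r : ℕ, 1 ≤ r → ∑ k ∈ Finset.range (r + 1), f k * f (r - k) = epsr r) :
    Tendsto (fun n => ∑' r, headS lam n r) atTop (𝓝 (∑' r : ℕ, (2 : ℝ) ^ (-(1 : ℝ) / 4) *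
      Real.exp (1 / 2) * √(2 * Real.pi) * (f r / 2 ^ r * Afun (1 / 4 + 3 * r) lam))) := by
  obtain ⟨b, hb, hb0, hle⟩ := exists_summable_bound lam
  refine tendsto_tsum_of_dominated_convergence hb (fun r => ?_) ?_
  · refine (tendsto_termS lam hf0 hrec r).congr' ?_
    filter_upwards [tendsto_natSqrt.eventually_ge_atTop r] with n hn
    rw [headS, if_pos hn]
  · filter_upwards [hle] with n hn r
    rw [headS]
    split_ifs with h
    · exact hn r h
    · rw [norm_zero]
      exact hb0 r

theorem tendsto_mul_bipartiteProb (lam : ℝ) {f : ℕ → ℝ} (hf0 : f 0 = 1)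
    (hrec : ∀ r : ℕ, 1 ≤ r → ∑ k ∈ Finset.range (r + 1), f k * f (r - k) = epsr r) :
    Tendsto (fun n : ℕ => (n : ℝ) ^ ((1 : ℝ) / 12) * bipartiteProb lam n) atTop
      (𝓝 (∑' r : ℕ, (2 : ℝ) ^ (-(1 : ℝ) / 4) *
        Real.exp (1 / 2) * √(2 * Real.pi) * (f r / 2 ^ r * Afun (1 / 4 + 3 * r) lam))) := by
  have hexp : Tendsto (fun n => Real.exp ((1 + xS lam n) / 2)) atTop (𝓝 (Real.exp ((1 + 0) / 2))) :=
    (Real.continuous_exp.tendsto _).comp (((tendsto_xS lam).const_add 1).div_const 2)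
  have hpow : Tendsto (fun n : ℕ => (n : ℝ) ^ (-(5 : ℝ) / 12)) atTop (𝓝 0) := by
    have := (tendsto_rpow_neg_atTop (y := 5 / 12) (by norm_num)).comp
      (tendsto_natCast_atTop_atTop (R := ℝ))
    exact this.congr fun n => by
      rw [Function.comp_apply, neg_div]
  have hz := hpow.mul hexp
  rw [zero_mul] at hz
  have hgood := (eventually_pS lam).and (eventually_norm_circJ_le lam)
  have ht : Tendsto (fun n => ∑' r, (termS lam r n - headS lam n r)) atTop (𝓝 0) := by
    refine squeeze_zero' ?_ ?_ hz <;> filter_upwards [hgood] with n hn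
    · exact (tsum_termS_sub_headS_mem hn.2.1 hn.2.2.1).1
    · exact (tsum_termS_sub_headS_mem hn.2.1 hn.2.2.1).2
  have h := ht.add (tendsto_tsum_headS lam hf0 hrec)
  rw [zero_add] at h
  refine h.congr' ?_
  filter_upwards [hgood] with n hn
  have hs := hasSum_termS hn.1.2.1 hn.1.2.2 hn.2.2.1
  have hh : Summable (headS lam n) := by
    refine summable_of_ne_finset_zero (s := Finset.range (Nat.sqrt n + 1)) fun r hr => ?_
    rw [headS, if_neg]
    simpa [Nat.lt_succ_iff] using hr
  rw [hs.summable.tsum_sub hh, sub_add_cancel, hs.tsum_eq]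

end

end BipProb

/-- with `f` the sequence determined by `f 0 = 1` and
`Σ_{k=0}^r f k f (r-k) = ε_r` (`r ≥ 1`), and
`c(λ) = e^{3/8} √(2π) Σ_r (f_r/2^r) A(1/4+3r, λ)`, one has
`n^{1/12} B_n → 2^{-1/4} e^{1/8} c(λ)`. -/
theorem bipartiteProb_asymptotics (lam : ℝ) (f : ℕ → ℝ) (hf0 : f 0 = 1)
    (hrec : ∀ r : ℕ, 1 ≤ r → ∑ k ∈ Finset.range (r + 1), f k * f (r - k) = epsr r) :
    Tendsto (fun n : ℕ => (n : ℝ) ^ ((1 : ℝ) / 12) * bipartiteProb lam n) atTop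
      (nhds ((2 : ℝ) ^ (-(1 : ℝ) / 4) * Real.exp (1 / 8) *
        (Real.exp (3 / 8) * Real.sqrt (2 * Real.pi) *
          ∑' r : ℕ, f r / 2 ^ r * Afun (1 / 4 + 3 * r) lam))) := by
  have h := BipProb.tendsto_mul_bipartiteProb lam hf0 hrec
  rw [tsum_mul_left, show (1 / 2 : ℝ) = 1 / 8 + 3 / 8 by norm_num, Real.exp_add] at h
  convert h using 2
  ring
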